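/- arXiv:2005.11559 — 7 statements merged into one kernel-verified Lean document; each statement's English description precedes it below -/
import Mathlib

section
/- Assume Hypothesis (U2). Then there exists a constant K ≥ 1 (depending only on the constant C from (U2)) such that for every set of squares A, every dimension d ≥ 1, and every proper generalized arithmetic progression H = P₁ + ⋯ + P_d of dimension d whose side lengths satisfy n_j ≥ |H|^{3/(4d+2)} for every j = 1, …, d (which holds in particular when each n_j is comparable to |H|^{1/d}), one has |A ∩ H| ≤ K · 8^d · |H|^{3/4 − 3/(32d+4)}. -/
open Finset

/-- Hypothesis (U2): an instance of the Uniformity Conjecture. -/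
def U2 (C : ℕ) : Prop :=
  ∀ α β γ : ℤ, α ≠ 0 → β ≠ 0 → γ ≠ 0 → α ≠ β → α ≠ γ → β ≠ γ →
    {p : ℚ × ℚ |
        p.2 ^ 2 = (p.1 ^ 2 + (α : ℚ)) * (p.1 ^ 2 + (β : ℚ)) * (p.1 ^ 2 + (γ : ℚ))}.Finite ∧
    {p : ℚ × ℚ |
        p.2 ^ 2 = (p.1 ^ 2 + (α : ℚ)) * (p.1 ^ 2 + (β : ℚ)) * (p.1 ^ 2 + (γ : ℚ))}.ncard ≤ C

theorem le_card_image_sum_zmod {d : ℕ} (k : Fin d → ℤ) (e : ℕ) (he : 1 ≤ e)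
    (h : ∀ q : ℕ, q ∣ e ^ 2 → (∀ j, (q : ℤ) ∣ k j) → q ≤ e) :
    e ≤ ((Fintype.piFinset fun _ : Fin d => range e).image
      (fun v => ((∑ j, k j * (v j : ℤ) : ℤ) : ZMod (e ^ 2)))).card := by
  have : NeZero (e ^ 2) := ⟨by positivity⟩
  by_cases hord : ∃ j, e ≤ addOrderOf ((k j : ℤ) : ZMod (e ^ 2))
  · obtain ⟨j, hj⟩ := hord
    calc e = ((range e).image (fun i : ℕ => i • ((k j : ℤ) : ZMod (e ^ 2)))).card := by
          rw [card_image_of_injOn, card_range]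
          intro a ha b hb hab
          simp only [coe_range, Set.mem_Iio] at ha hb
          exact nsmul_injOn_Iio_addOrderOf (Set.mem_Iio.2 (by omega)) (Set.mem_Iio.2 (by omega)) hab
      _ ≤ _ := by
          apply card_le_card
          intro y hy
          obtain ⟨i, hi, rfl⟩ := mem_image.1 hy
          refine mem_image.2 ⟨Pi.single j i, ?_, ?_⟩
          · rw [Fintype.mem_piFinset]
            intro l
            by_cases hl : l = j
            · subst hl; simpa using hi
            · simp [hl]; omega
          · rw [sum_eq_single j]
            · simp [mul_comm]
            · intro l _ hl; simp [hl]
            · simp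
  · push Not at hord
    set W := Submodule.span ℤ (Set.range fun j => ((k j : ℤ) : ZMod (e ^ 2))) with hW
    have hsub : ∀ y ∈ W, y ∈ ((Fintype.piFinset fun _ : Fin d => range e).image
      (fun v => ((∑ j, k j * (v j : ℤ) : ℤ) : ZMod (e ^ 2)))) := by
      intro y hy
      obtain ⟨c, rfl⟩ := (Submodule.mem_span_range_iff_exists_fun ℤ).1 hy
      have hpos : ∀ j, 0 < addOrderOf ((k j : ℤ) : ZMod (e ^ 2)) := fun j => addOrderOf_pos _
      refine mem_image.2
        ⟨fun j => (c j % (addOrderOf ((k j : ℤ) : ZMod (e ^ 2)) : ℤ)).toNat, ?_, ?_⟩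
      · rw [Fintype.mem_piFinset]
        intro j
        have h1 := Int.emod_lt_of_pos (c j)
          (b := (addOrderOf ((k j : ℤ) : ZMod (e ^ 2)) : ℤ)) (by exact_mod_cast hpos j)
        have := hord j
        rw [mem_range]; omega
      · push_cast
        refine sum_congr rfl fun j _ => ?_
        have h1 := Int.emod_nonneg (c j)
          (b := (addOrderOf ((k j : ℤ) : ZMod (e ^ 2)) : ℤ)) (by exact_mod_cast (hpos j).ne')
        rw [← mod_addOrderOf_zsmul _ (c j), zsmul_eq_mul, mul_comm]
        congr 1
        rw [← Int.cast_natCast, Int.toNat_of_nonneg h1]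
    have hcard : Nat.card W ≤ ((Fintype.piFinset fun _ : Fin d => range e).image
      (fun v => ((∑ j, k j * (v j : ℤ) : ℤ) : ZMod (e ^ 2)))).card := by
      rw [← Fintype.card_coe, ← Nat.card_eq_fintype_card]
      exact Nat.card_le_card_of_injective (fun y : W => ⟨y.1, hsub y.1 y.2⟩)
        (fun a b hab => Subtype.ext (by simpa using hab))
    refine le_trans ?_ hcard
    have hdvd : Nat.card W ∣ e ^ 2 := by
      have := AddSubgroup.card_addSubgroup_dvd_card W.toAddSubgroup
      rwa [Nat.card_zmod] at this
    obtain ⟨q, hq⟩ := hdvd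
    have hWpos : 0 < Nat.card W := Nat.card_pos
    have hqe : q ≤ e := by
      refine h q ⟨_, by rw [hq, mul_comm]⟩ fun j => ?_
      have hz : Nat.card W • (⟨((k j : ℤ) : ZMod (e ^ 2)),
          Submodule.subset_span ⟨j, rfl⟩⟩ : W) = 0 := card_nsmul_eq_zero'
      have hz' : ((((Nat.card W : ℕ) : ℤ) * k j : ℤ) : ZMod (e ^ 2)) = 0 := by
        have := congrArg Subtype.val hz
        simpa using this
      rw [ZMod.intCast_zmod_eq_zero_iff_dvd] at hz'
      have hq' : ((e ^ 2 : ℕ) : ℤ) = (Nat.card W : ℤ) * q := by exact_mod_cast hq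
      rw [hq'] at hz'
      exact Int.dvd_of_mul_dvd_mul_left (by exact_mod_cast hWpos.ne') hz'
    nlinarith

theorem card_mul_le_of_sq_dvd {d : ℕ} (k₀ : ℤ) (k : Fin d → ℤ)
    (hk : ∀ q : ℕ, (q : ℤ) ∣ k₀ → (∀ j, (q : ℤ) ∣ k j) → Squarefree q)
    (e : ℕ) (he : 1 ≤ e) (b : Fin d → ℕ) (hb : ∀ j, e ≤ b j) (T : Finset (Fin d → ℕ))
    (hT : ∀ c ∈ T, (∀ j, c j < b j) ∧ ((e ^ 2 : ℕ) : ℤ) ∣ k₀ + ∑ j, k j * (c j : ℤ)) :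
    T.card * e ≤ 2 ^ d * ∏ j, b j := by
  rcases T.eq_empty_or_nonempty with rfl | ⟨c₀, hc₀⟩
  · simp
  have hW := le_card_image_sum_zmod k e he (by
    intro q hq hqk
    have h0 : (q : ℤ) ∣ k₀ := by
      have h1 : (q : ℤ) ∣ ∑ j, k j * (c₀ j : ℤ) := dvd_sum fun j _ => (hqk j).mul_right _
      have h2 : (q : ℤ) ∣ k₀ + ∑ j, k j * (c₀ j : ℤ) :=
        (Int.natCast_dvd_natCast.2 hq).trans (hT c₀ hc₀).2
      exact (dvd_add_left h1).1 h2
    exact Nat.le_of_dvd he (((hk q h0 hqk).dvd_pow_iff_dvd two_ne_zero).1 hq))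
  set W := ((Fintype.piFinset fun _ : Fin d => range e).image
      (fun v => ((∑ j, k j * (v j : ℤ) : ℤ) : ZMod (e ^ 2)))) with hWdef
  have hex : ∀ w : ZMod (e ^ 2), ∃ v : Fin d → ℕ, w ∈ W →
      (∀ j, v j < e) ∧ ((∑ j, k j * (v j : ℤ) : ℤ) : ZMod (e ^ 2)) = w := by
    intro w
    by_cases hw : w ∈ W
    · obtain ⟨v, hv, rfl⟩ := mem_image.1 hw
      exact ⟨v, fun _ => ⟨fun j => by simpa using Fintype.mem_piFinset.1 hv j, rfl⟩⟩
    · exact ⟨0, fun h => absurd h hw⟩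
  choose σ hσ using hex
  have hT' : ∀ c ∈ T, ((∑ j, k j * (c j : ℤ) : ℤ) : ZMod (e ^ 2)) = -(k₀ : ZMod (e ^ 2)) := by
    intro c hc
    have := (ZMod.intCast_zmod_eq_zero_iff_dvd _ _).2 (hT c hc).2
    rw [Int.cast_add] at this
    exact (neg_eq_of_add_eq_zero_right this).symm
  calc T.card * e ≤ T.card * W.card := Nat.mul_le_mul_left _ hW
    _ = (T ×ˢ W).card := (card_product _ _).symm
    _ ≤ (Fintype.piFinset fun j => range (2 * b j)).card := by
        apply card_le_card_of_injOn (fun p => p.1 + σ p.2)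
        · rintro ⟨c, w⟩ hp
          obtain ⟨hc, hw⟩ := mem_product.1 (mem_coe.1 hp)
          rw [mem_coe, Fintype.mem_piFinset]
          intro j
          have h1 := (hT c hc).1 j
          have h2 := (hσ w hw).1 j
          have h3 := hb j
          simp only [Pi.add_apply, mem_range]
          omega
        · rintro ⟨c, w⟩ hp ⟨c', w'⟩ hp' heq
          obtain ⟨hc, hw⟩ := mem_product.1 (mem_coe.1 hp)
          obtain ⟨hc', hw'⟩ := mem_product.1 (mem_coe.1 hp')
          simp only at hc hw hc' hw' heq
          have hww : w = w' := by
            have h1 : ((∑ j, k j * ((c + σ w) j : ℤ) : ℤ) : ZMod (e ^ 2)) = -k₀ + w := by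
              simp only [Pi.add_apply, Nat.cast_add, mul_add, sum_add_distrib, Int.cast_add]
              rw [hT' c hc, (hσ w hw).2]
            have h2 : ((∑ j, k j * ((c' + σ w') j : ℤ) : ℤ) : ZMod (e ^ 2)) = -k₀ + w' := by
              simp only [Pi.add_apply, Nat.cast_add, mul_add, sum_add_distrib, Int.cast_add]
              rw [hT' c' hc', (hσ w' hw').2]
            simp only [Pi.add_apply] at h1 h2
            have h3 : ∀ j, c j + σ w j = c' j + σ w' j := fun j => congrFun heq j
            simp only [h3] at h1
            exact add_left_cancel (h1.symm.trans h2)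
          subst hww
          simpa using heq
    _ = 2 ^ d * ∏ j, b j := by simp [Fintype.card_piFinset, prod_mul_distrib]

theorem card_pow_four_le_card_injective_quadruples {α β : Type*} [DecidableEq α] [DecidableEq β]
    (X : Finset α) (c : α → β) (T : Finset β) (hc : ∀ x ∈ X, c x ∈ T)
    (hXT : 8 * T.card ≤ X.card) :
    (X.card : ℝ) ^ 4 ≤ 16 * (T.card : ℝ) ^ 3 *
      (((Fintype.piFinset fun _ : Fin 4 => X).filter
        (fun q => Function.Injective q ∧ ∀ i, c (q i) = c (q 0))).card : ℝ) := by
  set Ω := ((Fintype.piFinset fun _ : Fin 4 => X).filter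
        (fun q => Function.Injective q ∧ ∀ i, c (q i) = c (q 0))) with hΩ
  set F : β → Finset α := fun t => X.filter (fun x => c x = t) with hF
  have h1 : ∑ t ∈ T, ((F t).card).descFactorial 4 ≤ Ω.card := by
    have h2 : ∀ t, ((F t).card).descFactorial 4 = Fintype.card (Fin 4 ↪ F t) := by
      intro t; rw [Fintype.card_embedding_eq]; simp
    rw [← sum_coe_sort]
    simp only [h2]
    rw [← Fintype.card_sigma, ← Fintype.card_coe]
    have hm : ∀ (t : T) (g : Fin 4 ↪ F t), (fun i => (g i : α)) ∈ Ω := by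
      intro t g
      have hg : ∀ i, (g i : α) ∈ X ∧ c (g i) = t := fun i => mem_filter.1 (g i).2
      refine mem_filter.2 ⟨Fintype.mem_piFinset.2 fun i => (hg i).1, ?_, fun i => ?_⟩
      · exact Subtype.val_injective.comp g.injective
      · rw [(hg i).2, (hg 0).2]
    refine Fintype.card_le_of_injective
      (fun p : (Σ t : T, (Fin 4 ↪ F t)) => (⟨fun i => (p.2 i : α), hm p.1 p.2⟩ : Ω)) ?_
    rintro ⟨t, g⟩ ⟨t', g'⟩ h
    have hfun : ∀ i, (g i : α) = g' i := fun i => congrFun (congrArg Subtype.val h) i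
    have htt : t = t' := by
      apply Subtype.ext
      have e1 := (mem_filter.1 (g 0).2).2
      have e2 := (mem_filter.1 (g' 0).2).2
      rw [← e1, ← e2, hfun 0]
    subst htt
    congr 1
    ext i
    exact hfun i
  have h3 : ∑ t ∈ T, (F t).card = X.card := (card_eq_sum_card_fiberwise hc).symm
  rcases Nat.eq_zero_or_pos T.card with hT0 | hTpos
  · have : X.card = 0 := by rw [← h3, card_eq_zero.1 hT0]; simp
    simp [this, hT0]
  have h4 : ∀ N : ℕ, (3 / 32 : ℝ) * ((N : ℝ) ^ 4 - 256) ≤ (N.descFactorial 4 : ℝ) := by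
    intro N
    rcases lt_or_ge N 4 with hN | hN
    · have : (N : ℝ) ^ 4 ≤ 4 ^ 4 := by
        have : (N : ℝ) ≤ 4 := by exact_mod_cast hN.le
        gcongr
      have : (0 : ℝ) ≤ (N.descFactorial 4 : ℝ) := by positivity
      linarith
    · obtain ⟨a, rfl⟩ := Nat.exists_eq_add_of_le hN
      have : (((4 + a).descFactorial 4 : ℕ) : ℝ) = (a + 4) * (a + 3) * (a + 2) * (a + 1) := by
        simp only [Nat.descFactorial, Nat.sub_zero]
        have e1 : 4 + a - 3 = a + 1 := by omega
        have e2 : 4 + a - 2 = a + 2 := by omega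
        have e3 : 4 + a - 1 = a + 3 := by omega
        rw [e1, e2, e3]; push_cast; ring
      rw [this]; push_cast
      have : (0 : ℝ) ≤ a := by positivity
      nlinarith [pow_nonneg this 2, pow_nonneg this 3, pow_nonneg this 4]
  have h5 : (X.card : ℝ) ^ 4 / (T.card : ℝ) ^ 3 ≤ ∑ t ∈ T, ((F t).card : ℝ) ^ 4 := by
    have := pow_sum_div_card_le_sum_pow (s := T) (f := fun t => ((F t).card : ℝ))
      (fun _ _ => by positivity) 3
    rwa [← Nat.cast_sum, h3] at this
  have h6 : (3 / 32 : ℝ) * (∑ t ∈ T, ((F t).card : ℝ) ^ 4 - 256 * T.card) ≤ Ω.card := by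
    calc _ = ∑ t ∈ T, (3 / 32 : ℝ) * (((F t).card : ℝ) ^ 4 - 256) := by
          rw [← mul_sum, sum_sub_distrib]; simp; ring
      _ ≤ ∑ t ∈ T, (((F t).card.descFactorial 4 : ℕ) : ℝ) := sum_le_sum fun t _ => h4 _
      _ ≤ Ω.card := by exact_mod_cast h1
  have hτ : (0 : ℝ) < T.card := by exact_mod_cast hTpos
  have h7 : (4096 : ℝ) * (T.card : ℝ) ^ 4 ≤ (X.card : ℝ) ^ 4 := by
    have : (8 * T.card : ℝ) ≤ X.card := by exact_mod_cast hXT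
    calc _ = (8 * T.card : ℝ) ^ 4 := by ring
      _ ≤ _ := by gcongr
  rw [div_le_iff₀ (by positivity)] at h5
  have h8 := mul_le_mul_of_nonneg_right h6 (pow_pos hτ 3).le
  generalize ∑ t ∈ T, ((F t).card : ℝ) ^ 4 = S at h5 h8
  have h9 : (3 / 32 : ℝ) * (S * (T.card : ℝ) ^ 3 - 256 * (T.card : ℝ) ^ 4) ≤
      Ω.card * (T.card : ℝ) ^ 3 := le_trans (le_of_eq (by ring)) h8
  linarith [pow_nonneg (Nat.cast_nonneg (α := ℝ) X.card) 4]

theorem sum_Ioc_inv_mul_inv_sqrt_le (a M : ℕ) (ha : 1 ≤ a) :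
    ∑ g ∈ Ioc a M, (1 : ℝ) / (g * √g) ≤ 2 / √a := by
  have key : ∀ M, a ≤ M → ∑ g ∈ Ioc a M, (1 : ℝ) / (g * √g) ≤ 2 / √a - 2 / √M := by
    intro M hM
    induction M, hM using Nat.le_induction with
    | base => simp
    | succ m hm ih =>
      rw [sum_Ioc_succ_top hm]
      have hmpos : (0 : ℝ) < m := by exact_mod_cast (by omega : 0 < m)
      have hs : 0 < √(m : ℝ) := Real.sqrt_pos.2 hmpos
      have hs' : 0 < √((m + 1 : ℕ) : ℝ) := Real.sqrt_pos.2 (by positivity)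
      have e1 : √(m : ℝ) ^ 2 = m := Real.sq_sqrt hmpos.le
      have e2 : √((m + 1 : ℕ) : ℝ) ^ 2 = ((m + 1 : ℕ) : ℝ) := Real.sq_sqrt (by positivity)
      have hle : √(m : ℝ) ≤ √((m + 1 : ℕ) : ℝ) := Real.sqrt_le_sqrt (by push_cast; linarith)
      have : (1 : ℝ) / (((m + 1 : ℕ) : ℝ) * √((m + 1 : ℕ) : ℝ)) ≤
          2 / √(m : ℝ) - 2 / √((m + 1 : ℕ) : ℝ) := by
        generalize √((m + 1 : ℕ) : ℝ) = t at *
        rw [← e2]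
        have e3 : t ^ 2 = √(m : ℝ) ^ 2 + 1 := by rw [e2, e1]; push_cast; ring
        generalize √(m : ℝ) = s at *
        rw [div_sub_div _ _ hs.ne' hs'.ne', div_le_div_iff₀ (by positivity) (by positivity)]
        have : (t - s) * (t + s) = 1 := by nlinarith
        have h5 : 1 ≤ 2 * t * (t - s) := by nlinarith
        nlinarith [mul_pos hs hs', mul_pos (mul_pos hs hs') hs']
      linarith
  rcases le_or_gt a M with h | h
  · have := key M h
    have : (0 : ℝ) ≤ 2 / √M := by positivity
    linarith
  · rw [Ioc_eq_empty (by omega), sum_empty]; positivity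

theorem le_six_mul_card_filter_gcd_le {α : Type*} [DecidableEq α] (X : Finset α) (z : α → ℕ) (M : ℕ)
    (hX : X.Nonempty)
    (h : ∀ g : ℕ, 1 ≤ g → g ≤ M → (X.filter (fun x => g ∣ z x)).card ^ 2 * g ≤ X.card ^ 2) :
    M ≤ 6 * ((Icc 1 M).filter (fun m => 2 * M ≤ 3 * m ∧
      X.card ≤ 2 * (X.filter (fun x => (z x).gcd m ≤ 576)).card)).card := by
  set I := (Icc 1 M).filter (fun m => 2 * M ≤ 3 * m) with hI
  set D := (Icc 1 M).filter (fun m => X.card < 2 * (X.filter (fun x => 576 < (z x).gcd m)).card)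
    with hD
  have hIcard : M ≤ 3 * I.card := by
    have h1 : ((Icc 1 M).filter (fun m => ¬ 2 * M ≤ 3 * m)).card ≤ 2 * M / 3 := by
      calc _ ≤ (Icc 1 (2 * M / 3)).card := by
            apply card_le_card
            intro m hm
            simp only [mem_filter, mem_Icc] at hm ⊢
            omega
        _ = _ := by simp
    have h2 := card_filter_add_card_filter_not (s := Icc 1 M) (fun m => 2 * M ≤ 3 * m)
    rw [Nat.card_Icc, ← hI] at h2
    omega
  have hxpos : (0 : ℝ) < X.card := by exact_mod_cast hX.card_pos
  have hbad : ∑ m ∈ Icc 1 M, ((X.filter (fun x => 576 < (z x).gcd m)).card : ℝ) ≤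
      M * X.card / 12 := by
    have h1 : ∀ m ∈ Icc 1 M, ((X.filter (fun x => 576 < (z x).gcd m)).card : ℝ) ≤
        ∑ g ∈ Ioc 576 M, if g ∣ m then ((X.filter (fun x => g ∣ z x)).card : ℝ) else 0 := by
      intro m hm
      rw [mem_Icc] at hm
      rw [← sum_filter]
      have : X.filter (fun x => 576 < (z x).gcd m) ⊆
          ((Ioc 576 M).filter (fun g => g ∣ m)).biUnion (fun g => X.filter (fun x => g ∣ z x)) := by
        intro x hx
        rw [mem_filter] at hx
        rw [mem_biUnion]
        refine ⟨(z x).gcd m, ?_, ?_⟩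
        · rw [mem_filter, mem_Ioc]
          exact ⟨⟨hx.2, (Nat.le_of_dvd (by omega) (Nat.gcd_dvd_right _ _)).trans hm.2⟩,
            Nat.gcd_dvd_right _ _⟩
        · exact mem_filter.2 ⟨hx.1, Nat.gcd_dvd_left _ _⟩
      calc _ ≤ ((((Ioc 576 M).filter (fun g => g ∣ m)).biUnion
            (fun g => X.filter (fun x => g ∣ z x))).card : ℝ) := by
            exact Nat.cast_le.2 (card_le_card this)
        _ ≤ _ := by rw [← Nat.cast_sum]; exact Nat.cast_le.2 card_biUnion_le
    calc _ ≤ ∑ m ∈ Icc 1 M, ∑ g ∈ Ioc 576 M,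
          (if g ∣ m then ((X.filter (fun x => g ∣ z x)).card : ℝ) else 0) := sum_le_sum h1
      _ = ∑ g ∈ Ioc 576 M, ∑ m ∈ Icc 1 M,
          (if g ∣ m then ((X.filter (fun x => g ∣ z x)).card : ℝ) else 0) := sum_comm
      _ ≤ ∑ g ∈ Ioc 576 M, (M * X.card) * ((1 : ℝ) / (g * √g)) := by
          refine sum_le_sum fun g hg => ?_
          rw [mem_Ioc] at hg
          have hgpos : (0 : ℝ) < g := by exact_mod_cast (by omega : 0 < g)
          have hs : 0 < √(g : ℝ) := Real.sqrt_pos.2 hgpos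
          have e1 : √(g : ℝ) ^ 2 = g := Real.sq_sqrt hgpos.le
          rw [← sum_filter, sum_const, nsmul_eq_mul]
          have hc : (((Icc 1 M).filter (fun m => g ∣ m)).card : ℝ) ≤ M / g := by
            have : (Icc 1 M).filter (fun m => g ∣ m) = (Ioc 0 M).filter (fun m => g ∣ m) := by
              congr 1
            rw [this, Nat.Ioc_filter_dvd_card_eq_div]
            exact Nat.cast_div_le
          have hw : ((X.filter (fun x => g ∣ z x)).card : ℝ) ≤ X.card / √g := by
            rw [le_div_iff₀ hs]
            apply le_of_sq_le_sq _ hxpos.le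
            rw [mul_pow, e1]
            exact_mod_cast h g (by omega) hg.2
          calc _ ≤ ((M : ℝ) / g) * (X.card / √g) := by gcongr
            _ = _ := by field_simp
      _ = (M * X.card) * ∑ g ∈ Ioc 576 M, ((1 : ℝ) / (g * √g)) := (mul_sum _ _ _).symm
      _ ≤ (M * X.card) * (2 / √(576 : ℕ)) := by
          gcongr
          exact sum_Ioc_inv_mul_inv_sqrt_le 576 M (by norm_num)
      _ = _ := by
          have : √((576 : ℕ) : ℝ) = 24 := by
            rw [show ((576 : ℕ) : ℝ) = 24 ^ 2 by norm_num]
            exact Real.sqrt_sq (by norm_num)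
          rw [this]; ring
  have hDcard : (D.card : ℝ) * X.card ≤ M * X.card / 6 := by
    calc (D.card : ℝ) * X.card = ∑ m ∈ D, (X.card : ℝ) := by simp
      _ ≤ ∑ m ∈ D, 2 * ((X.filter (fun x => 576 < (z x).gcd m)).card : ℝ) := by
          refine sum_le_sum fun m hm => ?_
          exact_mod_cast (mem_filter.1 hm).2.le
      _ ≤ ∑ m ∈ Icc 1 M, 2 * ((X.filter (fun x => 576 < (z x).gcd m)).card : ℝ) :=
          sum_le_sum_of_subset_of_nonneg (filter_subset _ _) fun _ _ _ => by positivity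
      _ ≤ _ := by rw [← mul_sum]; linarith
  have hD6 : 6 * D.card ≤ M := by
    have : (D.card : ℝ) ≤ M / 6 := by
      rw [← mul_le_mul_iff_left₀ hxpos]; linarith
    have : (6 * D.card : ℝ) ≤ M := by linarith
    exact_mod_cast this
  have hsub : I \ D ⊆ (Icc 1 M).filter (fun m => 2 * M ≤ 3 * m ∧
      X.card ≤ 2 * (X.filter (fun x => (z x).gcd m ≤ 576)).card) := by
    intro m hm
    rw [mem_sdiff, mem_filter, mem_filter] at hm
    refine mem_filter.2 ⟨hm.1.1, hm.1.2, ?_⟩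
    have h1 : ¬ X.card < 2 * (X.filter (fun x => 576 < (z x).gcd m)).card :=
      fun h => hm.2 ⟨hm.1.1, h⟩
    have h2 := card_filter_add_card_filter_not (s := X) (fun x => (z x).gcd m ≤ 576)
    simp only [not_le] at h2
    omega
  have h1 := card_le_card hsub
  have h2 := le_card_sdiff D I
  omega

theorem sum_card_square_quadruples_le {C : ℕ} (hU : U2 C) (e M : ℕ) (he : 1 ≤ e)
    (S : Finset ℤ) (I : Finset ℕ) (hI : ∀ m ∈ I, 1 ≤ m ∧ m ≤ M ∧ 2 * M ≤ 3 * m)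
    (Ω : ℕ → Finset (Fin 4 → ℕ))
    (hinj : ∀ m ∈ I, ∀ t ∈ Ω m, Function.Injective t)
    (hS : ∀ m ∈ I, ∀ t ∈ Ω m, ∀ i, ∃ s ∈ S, (t i : ℤ) ^ 2 - (t 0 : ℤ) ^ 2 = (e * m : ℤ) ^ 2 * s)
    (hgcd : ∀ m ∈ I, ∀ t ∈ Ω m, e ∣ t 0 ∧ (t 0 / e).gcd m ≤ 576) :
    ∑ m ∈ I, (Ω m).card ≤ 864 * C * S.card ^ 3 := by
  set a : (Σ _ : ℕ, (Fin 4 → ℕ)) → (Fin 3 → ℤ) :=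
    fun p i => ((p.2 i.succ : ℤ) ^ 2 - (p.2 0 : ℤ) ^ 2) / (e * p.1 : ℤ) ^ 2 with ha
  have hpos : ∀ m ∈ I, (0 : ℤ) < (e * m : ℤ) := fun m hm => by
    have := (hI m hm).1
    positivity
  have ha_eq : ∀ p ∈ I.sigma Ω, ∀ i : Fin 3, a p i ∈ S ∧
      (p.2 i.succ : ℤ) ^ 2 = (p.2 0 : ℤ) ^ 2 + (e * p.1 : ℤ) ^ 2 * a p i := by
    rintro ⟨m, t⟩ hp i
    obtain ⟨hm, ht⟩ := mem_sigma.1 hp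
    obtain ⟨s, hs, hst⟩ := hS m hm t ht i.succ
    have hne : (e * m : ℤ) ^ 2 ≠ 0 := pow_ne_zero _ (hpos m hm).ne'
    have : a ⟨m, t⟩ i = s := by
      simp only [ha]
      rw [hst, Int.mul_ediv_cancel_left _ hne]
    rw [this]
    exact ⟨hs, by simp only; linarith⟩
  have hsq : ∀ x y : ℕ, (x : ℤ) ^ 2 = (y : ℤ) ^ 2 → x = y := fun x y h => by
    have h' : x ^ 2 = y ^ 2 := by exact_mod_cast h
    exact Nat.pow_left_injective two_ne_zero h'
  have h1 : (I.sigma Ω).card ≤ 864 * C * (Fintype.piFinset fun _ : Fin 3 => S).card := by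
    refine card_le_mul_card_image_of_maps_to (f := a)
      (fun p hp => Fintype.mem_piFinset.2 fun i => (ha_eq p hp i).1) _ fun α _ => ?_
    rcases ((I.sigma Ω).filter fun p => a p = α).eq_empty_or_nonempty with hF | ⟨p₀, hp₀⟩
    · rw [hF]; simp
    obtain ⟨hp₀, hpα⟩ := mem_filter.1 hp₀
    have hinj₀ : Function.Injective p₀.2 :=
      hinj p₀.1 (mem_sigma.1 hp₀).1 p₀.2 (mem_sigma.1 hp₀).2
    have hne0 : ∀ i, α i ≠ 0 := by
      intro i h0
      have := (ha_eq p₀ hp₀ i).2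
      rw [hpα, h0, mul_zero, add_zero] at this
      exact Fin.succ_ne_zero i (hinj₀ (hsq _ _ this))
    have hne : ∀ i j, i ≠ j → α i ≠ α j := by
      intro i j hij h0
      have h2 := (ha_eq p₀ hp₀ i).2
      have h3 := (ha_eq p₀ hp₀ j).2
      rw [hpα] at h2 h3
      rw [h0, ← h3] at h2
      exact hij (Fin.succ_injective _ (hinj₀ (hsq _ _ h2)))
    obtain ⟨hfin, hcard⟩ := hU (α 0) (α 1) (α 2) (hne0 0) (hne0 1) (hne0 2)
      (hne 0 1 (by decide)) (hne 0 2 (by decide)) (hne 1 2 (by decide))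
    have hR : (hfin.toFinset.image Prod.fst).card ≤ C := by
      refine card_image_le.trans ?_
      rwa [← Set.ncard_eq_toFinset_card _ hfin]
    set ρ : (Σ _ : ℕ, (Fin 4 → ℕ)) → ℚ := fun p => (p.2 0 : ℚ) / (e * p.1) with hρ
    have h2 : ((I.sigma Ω).filter fun p => a p = α).card ≤
        864 * (hfin.toFinset.image Prod.fst).card := by
      refine card_le_mul_card_image_of_maps_to (f := ρ) ?_ _ fun x _ => ?_
      · intro p hp
        obtain ⟨hp, hpa⟩ := mem_filter.1 hp
        have hq : ((e * p.1 : ℚ)) ≠ 0 := by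
          have := (hpos p.1 (mem_sigma.1 hp).1).ne'
          exact_mod_cast this
        have hi : ∀ i, (ρ p) ^ 2 + (α i : ℚ) = ((p.2 i.succ : ℚ) / (e * p.1)) ^ 2 := by
          intro i
          have h3 := (ha_eq p hp i).2
          rw [hpa] at h3
          have h3' : (p.2 i.succ : ℚ) ^ 2 = (p.2 0 : ℚ) ^ 2 + (e * p.1 : ℚ) ^ 2 * α i := by
            exact_mod_cast h3
          simp only [hρ]
          rw [div_pow, div_pow, h3', add_div, mul_div_cancel_left₀ _ (pow_ne_zero 2 hq)]
        refine mem_image.2 ⟨(ρ p, (p.2 1 : ℚ) / (e * p.1) * ((p.2 2 : ℚ) / (e * p.1)) *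
          ((p.2 3 : ℚ) / (e * p.1))), ?_, rfl⟩
        rw [Set.Finite.mem_toFinset, Set.mem_ofPred_eq]
        simp only
        rw [hi 0, hi 1, hi 2, mul_pow, mul_pow]
        rfl
      · rcases (((I.sigma Ω).filter fun p => a p = α).filter fun p => ρ p = x).eq_empty_or_nonempty
          with hF | ⟨p₁, hp₁⟩
        · rw [hF]; simp
        obtain ⟨hp₁, hx₁⟩ := mem_filter.1 hp₁
        obtain ⟨hm₁, ht₁⟩ := mem_sigma.1 (mem_filter.1 hp₁).1
        obtain ⟨m₁, t₁⟩ := p₁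
        simp only at hm₁ ht₁
        obtain ⟨hed₁, hg₁⟩ := hgcd m₁ hm₁ t₁ ht₁
        obtain ⟨z₁, hz₁⟩ := hed₁
        rw [hz₁, Nat.mul_div_cancel_left _ he] at hg₁
        obtain ⟨hm1, hmM, hM3⟩ := hI m₁ hm₁
        have hgpos : 0 < z₁.gcd m₁ := Nat.gcd_pos_of_pos_right _ hm1
        obtain ⟨u, v, huv, hu, hv⟩ := Nat.exists_coprime z₁ m₁
        have hv0 : 0 < v := Nat.pos_of_ne_zero fun h => by rw [h] at hv; omega
        have hcount : ((Ioc 0 M).filter fun m => v ∣ m).card ≤ 864 := by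
          rw [Nat.Ioc_filter_dvd_card_eq_div]
          have : v * z₁.gcd m₁ ≤ v * 576 := Nat.mul_le_mul_left _ hg₁
          exact Nat.div_le_of_le_mul (by omega)
        refine le_trans (card_le_card_of_injOn Sigma.fst ?_ ?_) hcount
        · rintro ⟨m, t⟩ hp
          obtain ⟨hp, hx⟩ := mem_filter.1 (mem_coe.1 hp)
          obtain ⟨hm, ht⟩ := mem_sigma.1 (mem_filter.1 hp).1
          simp only at hm ht
          obtain ⟨⟨z, hz⟩, -⟩ := hgcd m hm t ht
          rw [mem_coe, mem_filter, mem_Ioc]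
          refine ⟨⟨(hI m hm).1, (hI m hm).2.1⟩, ?_⟩
          have hρρ : ρ ⟨m, t⟩ = ρ ⟨m₁, t₁⟩ := hx.trans hx₁.symm
          simp only [hρ] at hρρ
          have q1 : ((e * m : ℚ)) ≠ 0 := by exact_mod_cast (hpos m hm).ne'
          have q2 : ((e * m₁ : ℚ)) ≠ 0 := by exact_mod_cast (hpos m₁ hm₁).ne'
          rw [div_eq_div_iff q1 q2] at hρρ
          have h4 : t 0 * (e * m₁) = t₁ 0 * (e * m) := by exact_mod_cast hρρ
          rw [hz, hz₁] at h4
          have h5 : (e * e * z₁.gcd m₁) * (z * v) = (e * e * z₁.gcd m₁) * (u * m) := by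
            calc _ = e * z * (e * (v * z₁.gcd m₁)) := by ring
              _ = e * z * (e * m₁) := by rw [← hv]
              _ = e * z₁ * (e * m) := h4
              _ = e * (u * z₁.gcd m₁) * (e * m) := by rw [← hu]
              _ = _ := by ring
          have h6 : z * v = u * m := Nat.eq_of_mul_eq_mul_left (by positivity) h5
          exact huv.symm.dvd_of_dvd_mul_left ⟨z, by rw [← h6, mul_comm]⟩
        · rintro ⟨m, t⟩ hp ⟨m', t'⟩ hp' hmm
          simp only at hmm
          subst hmm
          obtain ⟨hp, hx⟩ := mem_filter.1 (mem_coe.1 hp)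
          obtain ⟨hp', hx'⟩ := mem_filter.1 (mem_coe.1 hp')
          obtain ⟨hp, hpa⟩ := mem_filter.1 hp
          obtain ⟨hp', hpa'⟩ := mem_filter.1 hp'
          have q1 : ((e * m : ℚ)) ≠ 0 := by exact_mod_cast (hpos m (mem_sigma.1 hp).1).ne'
          have ht0 : t 0 = t' 0 := by
            have h3 := hx.trans hx'.symm
            simp only [hρ] at h3
            rw [div_left_inj' q1] at h3
            exact_mod_cast h3
          congr 1
          funext i
          refine Fin.cases ht0 (fun i => ?_) i
          have h3 := (ha_eq _ hp i).2
          have h4 := (ha_eq _ hp' i).2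
          rw [hpa] at h3
          rw [hpa'] at h4
          simp only at h3 h4
          rw [← ht0, ← h3] at h4
          exact (hsq _ _ h4).symm
    calc _ ≤ 864 * (hfin.toFinset.image Prod.fst).card := h2
      _ ≤ 864 * C := Nat.mul_le_mul_left _ hR
  rw [Fintype.card_piFinset, card_sigma] at h1
  simpa using h1

set_option maxHeartbeats 1000000 in
theorem card_pow_four_mul_le {C : ℕ} (hU : U2 C) {d : ℕ} (k₀ : ℤ) (k : Fin d → ℤ)
    (hk : ∀ q : ℕ, (q : ℤ) ∣ k₀ → (∀ j, (q : ℤ) ∣ k j) → Squarefree q)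
    (n : Fin d → ℕ) (X : Finset (Fin d → ℕ)) (hX : ∀ x ∈ X, ∀ j, x j < n j)
    (r : (Fin d → ℕ) → ℕ) (hr : ∀ x ∈ X, k₀ + ∑ j, k j * (x j : ℤ) = (r x : ℤ) ^ 2)
    (hrinj : Set.InjOn r X) (L : ℕ) (hL : 1 ≤ L) (hLn : ∀ j, L ≤ n j)
    (hLX : 16 * 2 ^ d * L ^ (2 * d) ≤ X.card) :
    (X.card : ℝ) ^ 4 * L ≤ 2654208 * C * 1331 ^ d * (∏ j, (n j : ℝ)) ^ 3 := by
  obtain ⟨e, heL, hmax⟩ := exists_max_image (Icc 1 L)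
    (fun e => (X.filter fun x => e ∣ r x).card ^ 2 * e) ⟨1, by simp [hL]⟩
  rw [mem_Icc] at heL
  obtain ⟨he, heL⟩ := heL
  set Xe := X.filter fun x => e ∣ r x with hXe
  have hXXe : X.card ^ 2 ≤ Xe.card ^ 2 * e := by
    have := hmax 1 (by simp [hL])
    simpa using this
  have hXpos : 0 < X.card := lt_of_lt_of_le (by positivity) hLX
  have hXene : Xe.Nonempty := by
    rw [← card_pos]
    by_contra h0
    have h1 : Xe.card = 0 := by omega
    rw [h1] at hXXe
    have := pow_pos hXpos 2
    omega
  set M := L / e with hM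
  have heM : e * M ≤ L := Nat.mul_div_le _ _
  have hM1 : 1 ≤ M := (Nat.one_le_div_iff he).2 heL
  have hLM : L ≤ 2 * (e * M) := by
    have h1 : L < e * M + e := by
      have := Nat.lt_mul_div_succ L he
      rw [← hM] at this
      linarith
    have h2 : e ≤ e * M := Nat.le_mul_of_pos_right _ hM1
    omega
  have hI := le_six_mul_card_filter_gcd_le Xe (fun x => r x / e) M hXene (by
    intro g hg hgM
    have h1 : Xe.filter (fun x => g ∣ r x / e) = X.filter (fun x => e * g ∣ r x) := by
      ext x
      simp only [hXe, mem_filter]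
      constructor
      · rintro ⟨⟨h1, h2⟩, h3⟩
        exact ⟨h1, (Nat.dvd_div_iff_mul_dvd h2).1 h3⟩
      · rintro ⟨h1, h2⟩
        have h3 := dvd_of_mul_right_dvd h2
        exact ⟨⟨h1, h3⟩, (Nat.dvd_div_iff_mul_dvd h3).2 h2⟩
    rw [h1]
    have h2 := hmax (e * g) (mem_Icc.2 ⟨Nat.mul_pos he hg, (Nat.mul_le_mul_left e hgM).trans heM⟩)
    rw [mul_comm e g, ← mul_assoc, mul_comm g e] at h2
    exact Nat.le_of_mul_le_mul_right h2 he)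
  set I := (Icc 1 M).filter (fun m => 2 * M ≤ 3 * m ∧
      Xe.card ≤ 2 * (Xe.filter (fun x => (r x / e).gcd m ≤ 576)).card) with hIdef
  set Y : ℕ → Finset (Fin d → ℕ) := fun m => Xe.filter (fun x => (r x / e).gcd m ≤ 576) with hY
  set c : ℕ → (Fin d → ℕ) → (Fin d → ℕ) := fun m x j => x j % (e * m) ^ 2 with hc
  set Ω : ℕ → Finset (Fin 4 → Fin d → ℕ) := fun m =>
    (Fintype.piFinset fun _ : Fin 4 => Y m).filter
        (fun q => Function.Injective q ∧ ∀ i, c m (q i) = c m (q 0)) with hΩ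
  set R : ℕ := ∏ j, min (n j) ((e * M) ^ 2) with hR
  have hIm : ∀ m ∈ I, 1 ≤ m ∧ m ≤ M ∧ 2 * M ≤ 3 * m := fun m hm => by
    rw [hIdef, mem_filter, mem_Icc] at hm
    exact ⟨hm.1.1, hm.1.2, hm.2.1⟩
  have hYX : ∀ m, Y m ⊆ X := fun m => (filter_subset _ _).trans (filter_subset _ _)
  have hlower : ∀ m ∈ I, (X.card : ℝ) ^ 4 * e ≤ 256 * 8 ^ d * (R : ℝ) ^ 3 * (Ω m).card := by
    intro m hm
    obtain ⟨hm1, hmM, -⟩ := hIm m hm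
    have hYm : Xe.card ≤ 2 * (Y m).card := (mem_filter.1 hm).2.2
    have hem : 1 ≤ e * m := Nat.mul_pos he hm1
    have hTe : ((Y m).image (c m)).card * e ≤ 2 ^ d * R := by
      refine (card_mul_le_of_sq_dvd k₀ k hk e he (fun j => min (n j) ((e * m) ^ 2))
        (fun j => ?_) _ fun t ht => ?_).trans (Nat.mul_le_mul_left _ ?_)
      · refine le_min (heL.trans (hLn j)) ?_
        calc e ≤ e * m := Nat.le_mul_of_pos_right _ hm1
          _ ≤ (e * m) ^ 2 := Nat.le_self_pow two_ne_zero _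
      · obtain ⟨x, hx, rfl⟩ := mem_image.1 ht
        have hxe := (mem_filter.1 (mem_filter.1 hx).1)
        refine ⟨fun j => lt_min ?_ ?_, ?_⟩
        · exact (Nat.mod_le _ _).trans_lt (hX x hxe.1 j)
        · exact Nat.mod_lt _ (by positivity)
        · have h1 : ((e ^ 2 : ℕ) : ℤ) ∣ k₀ + ∑ j, k j * (x j : ℤ) := by
            rw [hr x hxe.1]
            exact_mod_cast pow_dvd_pow_of_dvd hxe.2 2
          have h2 : ((e ^ 2 : ℕ) : ℤ) ∣ ∑ j, k j * (x j : ℤ) - ∑ j, k j * (c m x j : ℤ) := by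
            rw [← sum_sub_distrib]
            refine dvd_sum fun j _ => ?_
            rw [← mul_sub]
            refine Dvd.dvd.mul_left ?_ _
            have h3 : (((e * m) ^ 2 : ℕ) : ℤ) ∣ (x j : ℤ) - (c m x j : ℤ) := by
              simp only [hc, Int.natCast_mod]
              exact Int.dvd_self_sub_emod
            refine dvd_trans ?_ h3
            exact Int.natCast_dvd_natCast.2 (pow_dvd_pow_of_dvd (dvd_mul_right _ _) 2)
          have h3 := dvd_sub h1 h2
          have h4 : ∀ a b : ℤ, k₀ + a - (a - b) = k₀ + b := fun a b => by ring
          rwa [h4] at h3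
      · refine prod_le_prod' fun j _ => min_le_min le_rfl ?_
        gcongr
    have hRL : R ≤ L ^ (2 * d) := by
      calc R ≤ ∏ _j : Fin d, L ^ 2 := prod_le_prod' fun j _ => (min_le_right _ _).trans (by gcongr)
        _ = L ^ (2 * d) := by simp [pow_mul]
    have hXY : X.card ≤ 2 * ((Y m).card * e) := by
      have h1 : X.card ≤ Xe.card * e := by
        refine (Nat.pow_le_pow_iff_left two_ne_zero).1 (hXXe.trans ?_)
        rw [mul_pow]
        exact Nat.mul_le_mul_left _ (Nat.le_self_pow two_ne_zero _)
      have h2 := Nat.mul_le_mul_right e hYm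
      linarith
    have h8 : 8 * ((Y m).image (c m)).card ≤ (Y m).card := by
      refine Nat.le_of_mul_le_mul_right ?_ he
      have h3 : 2 ^ d * R ≤ 2 ^ d * L ^ (2 * d) := Nat.mul_le_mul_left _ hRL
      nlinarith
    have hmain := card_pow_four_le_card_injective_quadruples (Y m) (c m) ((Y m).image (c m))
      (fun x hx => mem_image_of_mem _ hx) h8
    have h4 : (X.card : ℝ) ^ 4 ≤ (Xe.card : ℝ) ^ 4 * (e : ℝ) ^ 2 := by
      have : (X.card : ℝ) ^ 2 ≤ (Xe.card : ℝ) ^ 2 * e := by exact_mod_cast hXXe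
      calc (X.card : ℝ) ^ 4 = ((X.card : ℝ) ^ 2) ^ 2 := by ring
        _ ≤ ((Xe.card : ℝ) ^ 2 * e) ^ 2 := by gcongr
        _ = _ := by ring
    have h5 : (Xe.card : ℝ) ^ 4 ≤ 16 * ((Y m).card : ℝ) ^ 4 := by
      have : (Xe.card : ℝ) ≤ 2 * (Y m).card := by exact_mod_cast hYm
      calc (Xe.card : ℝ) ^ 4 ≤ (2 * (Y m).card : ℝ) ^ 4 := by gcongr
        _ = _ := by ring
    have h6 : ((((Y m).image (c m)).card : ℝ) * e) ^ 3 ≤ (2 ^ d * R : ℝ) ^ 3 := by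
      have : (((Y m).image (c m)).card : ℝ) * e ≤ 2 ^ d * R := by exact_mod_cast hTe
      gcongr
    calc (X.card : ℝ) ^ 4 * e ≤ (16 * (16 * (((Y m).image (c m)).card : ℝ) ^ 3 *
          ((Ω m).card : ℝ))) * (e : ℝ) ^ 2 * e := by
          have h7 : (X.card : ℝ) ^ 4 ≤ (16 * (16 * (((Y m).image (c m)).card : ℝ) ^ 3 *
              ((Ω m).card : ℝ))) * (e : ℝ) ^ 2 :=
            h4.trans (mul_le_mul_of_nonneg_right (h5.trans (by linarith)) (by positivity))
          gcongr
      _ = 256 * ((((Y m).image (c m)).card : ℝ) * e) ^ 3 * (Ω m).card := by ring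
      _ ≤ 256 * (2 ^ d * R : ℝ) ^ 3 * (Ω m).card := by gcongr
      _ = _ := by
          rw [show (8 : ℝ) ^ d = (2 ^ d) ^ 3 by rw [← pow_mul, mul_comm, pow_mul]; norm_num]; ring
  set u : Fin d → ℕ := fun j => 9 * n j / (4 * (e * M) ^ 2) with hu
  set S : Finset ℤ := (Fintype.piFinset fun j => Icc (-(u j : ℤ)) (u j)).image
    (fun s => ∑ j, k j * s j) with hS
  have hScard : S.card ≤ ∏ j, (2 * u j + 1) := by
    refine card_image_le.trans ?_
    rw [Fintype.card_piFinset]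
    refine (prod_congr rfl fun j _ => ?_).le
    rw [Int.card_Icc]; omega
  have hupper : ∑ m ∈ I, (Ω m).card ≤ 864 * C * S.card ^ 3 := by
    have hq : ∀ m, ∀ q ∈ Ω m, (∀ i, q i ∈ Y m) ∧ Function.Injective q ∧
        ∀ i, c m (q i) = c m (q 0) := fun m q hq => by
      rw [hΩ, mem_filter, Fintype.mem_piFinset] at hq
      exact hq
    have himg : ∀ m, ((Ω m).image (fun q i => r (q i))).card = (Ω m).card := by
      intro m
      refine card_image_of_injOn fun q h q' h' heq => funext fun i => ?_
      exact hrinj (hYX m ((hq m q h).1 i)) (hYX m ((hq m q' h').1 i)) (congrFun heq i)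
    simp only [← himg]
    refine sum_card_square_quadruples_le hU e M he S I hIm _ ?_ ?_ ?_
    · intro m _ t ht i j hij
      obtain ⟨q, hqm, rfl⟩ := mem_image.1 ht
      obtain ⟨h1, h2, -⟩ := hq m q hqm
      exact h2 (hrinj (hYX m (h1 i)) (hYX m (h1 j)) hij)
    · intro m hm t ht i
      obtain ⟨q, hqm, rfl⟩ := mem_image.1 ht
      obtain ⟨h1, -, h3⟩ := hq m q hqm
      obtain ⟨hm1, hmM, hm3⟩ := hIm m hm
      have hem : 0 < (e * m) ^ 2 := by positivity
      have hdiv : ∀ j, ((((e * m) ^ 2 : ℕ) : ℤ)) ∣ (q i j : ℤ) - (q 0 j : ℤ) := by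
        intro j
        have h4 : q i j % (e * m) ^ 2 = q 0 j % (e * m) ^ 2 := congrFun (h3 i) j
        exact (Nat.modEq_iff_dvd.1 (show q 0 j ≡ q i j [MOD (e * m) ^ 2] from h4.symm))
      choose s hs using hdiv
      refine ⟨∑ j, k j * s j, mem_image.2 ⟨s, ?_, rfl⟩, ?_⟩
      · rw [Fintype.mem_piFinset]
        intro j
        rw [mem_Icc, ← abs_le]
        have h5 : (((e * m) ^ 2 : ℕ) : ℤ) * |s j| ≤ n j := by
          rw [← Nat.abs_cast ((e * m) ^ 2), ← abs_mul, ← hs j, abs_le]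
          have h6 := hX _ (hYX m (h1 i)) j
          have h7 := hX _ (hYX m (h1 0)) j
          omega
        have h6 : (s j).natAbs ≤ u j := by
          have h7 : (e * m) ^ 2 * (s j).natAbs ≤ n j := by
            have := h5
            rw [Int.abs_eq_natAbs] at this
            exact_mod_cast this
          rw [hu, Nat.le_div_iff_mul_le (by positivity)]
          have h8 : 4 * (e * M) ^ 2 ≤ 9 * (e * m) ^ 2 := by
            calc 4 * (e * M) ^ 2 = e ^ 2 * (2 * M) ^ 2 := by ring
              _ ≤ e ^ 2 * (3 * m) ^ 2 := by gcongr
              _ = _ := by ring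
          calc (s j).natAbs * (4 * (e * M) ^ 2) ≤ (s j).natAbs * (9 * (e * m) ^ 2) := by gcongr
            _ = 9 * ((e * m) ^ 2 * (s j).natAbs) := by ring
            _ ≤ 9 * n j := by gcongr
        rw [Int.abs_eq_natAbs]
        exact_mod_cast h6
      · simp only
        rw [← hr _ (hYX m (h1 i)), ← hr _ (hYX m (h1 0)), add_sub_add_left_eq_sub,
          ← sum_sub_distrib, mul_sum]
        refine sum_congr rfl fun j _ => ?_
        rw [← mul_sub, hs j]
        push_cast
        ring
    · intro m _ t ht
      obtain ⟨q, hqm, rfl⟩ := mem_image.1 ht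
      obtain ⟨h1, -, -⟩ := hq m q hqm
      have h2 := mem_filter.1 (h1 0)
      exact ⟨(mem_filter.1 h2.1).2, h2.2⟩
  have hRS : (R : ℝ) * S.card ≤ (11 / 2) ^ d * ∏ j, (n j : ℝ) := by
    have hMpos : 0 < (e * M) ^ 2 := by positivity
    calc (R : ℝ) * S.card ≤ (R : ℝ) * (∏ j, (2 * u j + 1) : ℕ) := by gcongr
      _ = ∏ j, ((min (n j) ((e * M) ^ 2) : ℕ) : ℝ) * (2 * (u j : ℝ) + 1) := by
          rw [hR, prod_mul_distrib]; push_cast; rfl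
      _ ≤ ∏ j, ((11 / 2 : ℝ) * n j) := by
          refine prod_le_prod (fun _ _ => by positivity) fun j _ => ?_
          have h1 : ((min (n j) ((e * M) ^ 2) : ℕ) : ℝ) ≤ n j := by
            exact_mod_cast min_le_left _ _
          have h2 : ((min (n j) ((e * M) ^ 2) : ℕ) : ℝ) ≤ (((e * M) ^ 2 : ℕ) : ℝ) := by
            exact_mod_cast min_le_right _ _
          have h3 : (((e * M) ^ 2 : ℕ) : ℝ) * (4 * u j) ≤ 9 * n j := by
            have : (4 * (e * M) ^ 2) * u j ≤ 9 * n j := Nat.mul_div_le _ _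
            have h : (e * M) ^ 2 * (4 * u j) ≤ 9 * n j := by linarith
            exact_mod_cast h
          have h4 := mul_le_mul_of_nonneg_right h2 (by positivity : (0 : ℝ) ≤ 4 * u j)
          linarith
      _ = _ := by rw [prod_mul_distrib, prod_const, card_univ, Fintype.card_fin]
  have hsum : (I.card : ℝ) * ((X.card : ℝ) ^ 4 * e) ≤
      256 * 8 ^ d * (R : ℝ) ^ 3 * (864 * C * (S.card : ℝ) ^ 3) := by
    calc _ = ∑ m ∈ I, (X.card : ℝ) ^ 4 * e := by simp
      _ ≤ ∑ m ∈ I, 256 * 8 ^ d * (R : ℝ) ^ 3 * ((Ω m).card : ℝ) := sum_le_sum hlower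
      _ = 256 * 8 ^ d * (R : ℝ) ^ 3 * ((∑ m ∈ I, (Ω m).card : ℕ) : ℝ) := by
          rw [← mul_sum]; push_cast; rfl
      _ ≤ 256 * 8 ^ d * (R : ℝ) ^ 3 * ((864 * C * S.card ^ 3 : ℕ) : ℝ) := by gcongr
      _ = _ := by push_cast; rfl
  have hLI : (L : ℝ) ≤ 12 * e * I.card := by
    have h1 : L ≤ 12 * e * I.card := by
      calc L ≤ 2 * (e * M) := hLM
        _ ≤ 2 * (e * (6 * I.card)) := by gcongr
        _ = _ := by ring
    exact_mod_cast h1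
  calc (X.card : ℝ) ^ 4 * L ≤ (X.card : ℝ) ^ 4 * (12 * e * I.card) := by gcongr
    _ = 12 * ((I.card : ℝ) * ((X.card : ℝ) ^ 4 * e)) := by ring
    _ ≤ 12 * (256 * 8 ^ d * (R : ℝ) ^ 3 * (864 * C * (S.card : ℝ) ^ 3)) := by gcongr
    _ = 2654208 * C * 8 ^ d * ((R : ℝ) * S.card) ^ 3 := by ring
    _ ≤ 2654208 * C * 8 ^ d * ((11 / 2) ^ d * ∏ j, (n j : ℝ)) ^ 3 := by gcongr
    _ = 2654208 * C * (8 * (11 / 2) ^ 3) ^ d * (∏ j, (n j : ℝ)) ^ 3 := by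
        rw [mul_pow, mul_pow, ← pow_mul, ← pow_mul, mul_comm d 3]; ring
    _ = _ := by norm_num

/-- Dividing by the largest common square factor leaves a squarefree content. -/
theorem exists_sq_mul_squarefree_content {d : ℕ} (k₀ : ℤ) (k : Fin d → ℤ)
    (h : ¬ (k₀ = 0 ∧ ∀ j, k j = 0)) :
    ∃ (t : ℕ) (l₀ : ℤ) (l : Fin d → ℤ), t ≠ 0 ∧ k₀ = (t : ℤ) ^ 2 * l₀ ∧
      (∀ j, k j = (t : ℤ) ^ 2 * l j) ∧
      ∀ q : ℕ, (q : ℤ) ∣ l₀ → (∀ j, (q : ℤ) ∣ l j) → Squarefree q := by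
  set g := Nat.gcd k₀.natAbs (univ.gcd fun j => (k j).natAbs) with hg
  have hg0 : g ≠ 0 := by
    intro h0
    obtain ⟨h1, h2⟩ := Nat.gcd_eq_zero_iff.1 h0
    refine h ⟨Int.natAbs_eq_zero.1 h1, fun j => Int.natAbs_eq_zero.1 ?_⟩
    exact Finset.gcd_eq_zero_iff.1 h2 j (mem_univ j)
  obtain ⟨a, t, hat, ha⟩ := Nat.sq_mul_squarefree g
  have ht : t ≠ 0 := by
    rintro rfl
    exact hg0 (by rw [← hat]; simp)
  have htg : t ^ 2 ∣ g := ⟨a, hat.symm⟩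
  have h0 : ((t : ℤ) ^ 2) ∣ k₀ := by
    rw [← Nat.cast_pow, Int.natCast_dvd]
    exact htg.trans (Nat.gcd_dvd_left _ _)
  have h1 : ∀ j, ((t : ℤ) ^ 2) ∣ k j := fun j => by
    rw [← Nat.cast_pow, Int.natCast_dvd]
    exact htg.trans ((Nat.gcd_dvd_right _ _).trans (Finset.gcd_dvd (mem_univ j)))
  obtain ⟨l₀, hl₀⟩ := h0
  choose l hl using h1
  refine ⟨t, l₀, l, ht, hl₀, hl, fun q hq hqj => ha.squarefree_of_dvd ?_⟩
  have hdvd : t ^ 2 * q ∣ g := by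
    refine Nat.dvd_gcd ?_ (Finset.dvd_gcd fun j _ => ?_)
    · rw [← Int.natCast_dvd, hl₀]
      push_cast
      exact mul_dvd_mul_left _ hq
    · rw [← Int.natCast_dvd, hl j]
      push_cast
      exact mul_dvd_mul_left _ (hqj j)
  rw [← hat] at hdvd
  exact Nat.dvd_of_mul_dvd_mul_left (by positivity) hdvd

/-- The real-variable optimisation: a choice of the length `L` turns the quartic bound into a
power saving. -/
theorem le_rpow_of_pow_four_mul_le {d : ℕ} (hd : 1 ≤ d) {x N K : ℝ} {C : ℕ} (hx : 0 ≤ x)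
    (hN : 1 ≤ N) (hC : 1 ≤ C) (hK : K = 5308416 * C)
    (h : ∀ L : ℕ, 1 ≤ L → (L : ℝ) ≤ N ^ ((3 : ℝ) / (4 * d + 2)) →
      16 * 2 ^ d * (L : ℝ) ^ (2 * d) ≤ x →
      x ^ 4 * L ≤ 2654208 * C * 1331 ^ d * N ^ 3) :
    x ≤ K * 8 ^ d * N ^ ((3 : ℝ) / 4 - 3 / (32 * d + 4)) := by
  have hd' : (1 : ℝ) ≤ d := by exact_mod_cast hd
  have hC' : (1 : ℝ) ≤ C := by exact_mod_cast hC
  have hN0 : 0 < N := by linarith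
  set y := N ^ ((3 : ℝ) / (8 * d + 1)) with hy
  have hy1 : 1 ≤ y := Real.one_le_rpow hN (by positivity)
  set L := ⌊y⌋₊ with hL
  have hL1 : 1 ≤ L := Nat.le_floor (by simpa using hy1)
  have hLy : (L : ℝ) ≤ y := Nat.floor_le (by linarith)
  have hyL : y ≤ 2 * L := by
    have h1 : y < L + 1 := Nat.lt_floor_add_one y
    have h2 : (1 : ℝ) ≤ L := by exact_mod_cast hL1
    linarith
  have hyn : y ≤ N ^ ((3 : ℝ) / (4 * d + 2)) := by
    refine Real.rpow_le_rpow_of_exponent_le hN ?_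
    gcongr 3 / ?_
    linarith
  set z := N ^ ((3 : ℝ) / 4 - 3 / (32 * d + 4)) with hz
  have hz0 : 0 < z := by positivity
  have hyz : y ^ (2 * d) = z := by
    rw [hy, hz, ← Real.rpow_natCast, ← Real.rpow_mul hN0.le]
    congr 1
    push_cast
    field_simp
    ring
  have hz4 : z ^ 4 * y = N ^ 3 := by
    rw [hy, hz, ← Real.rpow_natCast, ← Real.rpow_mul hN0.le, ← Real.rpow_add hN0,
      ← Real.rpow_natCast N 3]
    congr 1
    push_cast
    field_simp
    ring
  rcases le_total (16 * 2 ^ d * (L : ℝ) ^ (2 * d)) x with hc | hc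
  · have h1 := h L hL1 (hLy.trans hyn) hc
    have hK1 : 1 ≤ K := by rw [hK]; linarith
    have h2 : x ^ 4 * y ≤ (K * 8 ^ d * z) ^ 4 * y := by
      calc x ^ 4 * y ≤ 2 * (x ^ 4 * L) := by
            have := mul_le_mul_of_nonneg_left hyL (pow_nonneg hx 4)
            linarith
        _ ≤ 2 * (2654208 * C * 1331 ^ d * N ^ 3) := by linarith
        _ = K * 1331 ^ d * N ^ 3 := by rw [hK]; ring
        _ ≤ K ^ 4 * 4096 ^ d * N ^ 3 := by
            gcongr
            · exact le_self_pow₀ hK1 (by norm_num)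
            · norm_num
        _ = (K * 8 ^ d * z) ^ 4 * y := by
            rw [← hz4, mul_pow, mul_pow, ← pow_mul, mul_comm d 4, pow_mul]
            norm_num
            ring
    have h3 : x ^ 4 ≤ (K * 8 ^ d * z) ^ 4 := le_of_mul_le_mul_right h2 (by linarith)
    exact le_of_pow_le_pow_left₀ (by norm_num) (by positivity) h3
  · calc x ≤ 16 * 2 ^ d * (L : ℝ) ^ (2 * d) := hc
      _ ≤ K * 8 ^ d * y ^ (2 * d) := by
          have hK16 : 16 ≤ K := by rw [hK]; linarith
          gcongr
          norm_num
      _ = K * 8 ^ d * z := by rw [hyz]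

/-- conditional bound on the intersection of a set of squares with a proper
generalized arithmetic progression whose sides are all long. -/
theorem squares_cap_GAP (C : ℕ) (hC : 1 ≤ C) (hU : U2 C) :
    ∃ K : ℝ, 1 ≤ K ∧
      ∀ (A : Finset ℤ), (∀ a ∈ A, ∃ m : ℤ, a = m ^ 2) →
      ∀ (d : ℕ), 1 ≤ d →
      ∀ (k₀ : ℤ) (k : Fin d → ℤ) (n : Fin d → ℕ), (∀ j, 1 ≤ n j) →
      ∀ (H : Finset ℤ),
        H = (Finset.univ : Finset (∀ j : Fin d, Fin (n j))).image
              (fun x => k₀ + ∑ j, k j * ((x j : ℕ) : ℤ)) →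
        H.card = ∏ j, n j →
        (∀ j, (H.card : ℝ) ^ ((3 : ℝ) / (4 * d + 2)) ≤ (n j : ℝ)) →
        ((A ∩ H).card : ℝ) ≤
          K * 8 ^ d * (H.card : ℝ) ^ ((3 : ℝ) / 4 - 3 / (32 * d + 4)) := by
  have hC' : (1 : ℝ) ≤ C := by exact_mod_cast hC
  refine ⟨5308416 * C, by linarith, ?_⟩
  intro A hA d hd k₀ k n hn H hH hHcard hside
  have hN1 : 1 ≤ H.card := by
    rw [hHcard]
    exact Nat.one_le_iff_ne_zero.2 (prod_ne_zero_iff.2 fun j _ => Nat.one_le_iff_ne_zero.1 (hn j))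
  have hN1' : (1 : ℝ) ≤ H.card := by exact_mod_cast hN1
  by_cases h0 : k₀ = 0 ∧ ∀ j, k j = 0
  · have hH1 : H.card ≤ 1 := by
      refine card_le_one.2 fun a ha b hb => ?_
      rw [hH, mem_image] at ha hb
      obtain ⟨x, -, rfl⟩ := ha
      obtain ⟨y, -, rfl⟩ := hb
      simp [h0.2]
    refine le_rpow_of_pow_four_mul_le hd (Nat.cast_nonneg _) hN1' hC rfl fun L hL _ hLA => ?_
    exfalso
    have h1 : ((A ∩ H).card : ℝ) ≤ 1 := by
      exact_mod_cast (card_le_card inter_subset_right).trans hH1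
    have h2 : (1 : ℝ) ≤ L := by exact_mod_cast hL
    have h3 : (1 : ℝ) ≤ (L : ℝ) ^ (2 * d) := one_le_pow₀ h2
    have h4 : (1 : ℝ) ≤ 2 ^ d := one_le_pow₀ (by norm_num)
    nlinarith
  obtain ⟨t, l₀, l, ht, hl₀, hl, hsf⟩ := exists_sq_mul_squarefree_content k₀ k h0
  have hfl : ∀ x : Fin d → ℕ,
      k₀ + ∑ j, k j * (x j : ℤ) = (t : ℤ) ^ 2 * (l₀ + ∑ j, l j * (x j : ℤ)) := by
    intro x
    rw [hl₀, mul_add, mul_sum]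
    congr 1
    exact sum_congr rfl fun j _ => by rw [hl j]; ring
  set X := (Fintype.piFinset fun j => range (n j)).filter
    (fun x => k₀ + ∑ j, k j * (x j : ℤ) ∈ A) with hX
  have hXn : ∀ x ∈ X, ∀ j, x j < n j := fun x hx j => by
    simpa using Fintype.mem_piFinset.1 (mem_filter.1 hx).1 j
  have hsq : ∀ x ∈ X, ∃ m : ℕ, l₀ + ∑ j, l j * (x j : ℤ) = (m : ℤ) ^ 2 := by
    intro x hx
    obtain ⟨m, hm⟩ := hA _ (mem_filter.1 hx).2
    have hm' := hm
    rw [hfl x] at hm'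
    have htm : (t : ℤ) ∣ m := by
      rw [← Int.pow_dvd_pow_iff (two_ne_zero)]
      exact ⟨_, hm'.symm⟩
    obtain ⟨s, rfl⟩ := htm
    refine ⟨s.natAbs, ?_⟩
    rw [Int.natAbs_sq]
    have ht' : ((t : ℤ) ^ 2) ≠ 0 := by positivity
    refine mul_left_cancel₀ ht' ?_
    rw [hm', mul_pow]
  have hsq' : ∀ x : Fin d → ℕ, ∃ m : ℕ, x ∈ X → l₀ + ∑ j, l j * (x j : ℤ) = (m : ℤ) ^ 2 := by
    intro x
    by_cases hx : x ∈ X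
    · obtain ⟨m, hm⟩ := hsq x hx
      exact ⟨m, fun _ => hm⟩
    · exact ⟨0, fun h => absurd h hx⟩
  choose r hr using hsq'
  have hinj : Set.InjOn (fun x : ∀ j : Fin d, Fin (n j) => k₀ + ∑ j, k j * ((x j : ℕ) : ℤ))
      (univ : Finset (∀ j : Fin d, Fin (n j))) := by
    rw [← card_image_iff, ← hH, hHcard]
    simp
  have hrinj : Set.InjOn r X := by
    intro x hx y hy hxy
    have hx' := hXn x hx
    have hy' := hXn y hy
    have h1 : (fun j => (⟨x j, hx' j⟩ : Fin (n j))) = fun j => ⟨y j, hy' j⟩ := by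
      refine hinj (mem_univ _) (mem_univ _) ?_
      change k₀ + ∑ j, k j * (x j : ℤ) = k₀ + ∑ j, k j * (y j : ℤ)
      rw [hfl, hfl, hr x hx, hr y hy, hxy]
    funext j
    simpa using congrFun h1 j
  have hAX : (A ∩ H).card ≤ X.card := by
    refine (card_le_card ?_).trans (card_image_le (f := fun x => k₀ + ∑ j, k j * (x j : ℤ)))
    intro a ha
    obtain ⟨haA, haH⟩ := mem_inter.1 ha
    rw [hH, mem_image] at haH
    obtain ⟨x, -, rfl⟩ := haH
    refine mem_image.2 ⟨fun j => x j, mem_filter.2 ⟨?_, haA⟩, rfl⟩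
    exact Fintype.mem_piFinset.2 fun j => mem_range.2 (x j).2
  refine (Nat.cast_le.2 hAX).trans ?_
  refine le_rpow_of_pow_four_mul_le hd (Nat.cast_nonneg _) hN1' hC rfl fun L hL hLN hLX => ?_
  have := card_pow_four_mul_le hU l₀ l hsf n X hXn r hr hrinj L hL
    (fun j => by exact_mod_cast hLN.trans (hside j)) (by exact_mod_cast hLX)
  rw [hHcard]
  exact_mod_cast this
end

section
/- Assume Hypothesis (U2). Then there exists a constant K ≥ 1 (depending only on the constant C from (U2)) such that the following holds. Let A be a set of squares, let H = P₁ + ⋯ + P_d be a proper generalized arithmetic progression of dimension d with side lengths n₁, …, n_d, let 1 ≤ m ≤ d, and suppose there is a subset J ⊆ {1, …, d} with |J| = m and n_j ≥ |H|^{3/(4m+2)} for every j ∈ J. Let R = ∏_{j∉J} n_j (with R = 1 if J = {1, …, d}). Then |A ∩ H| ≤ K · 8^d · |H|^{3/4} · (R^{2m+1} / |H|^{3/4})^{1/(8m+1)}. -/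
open Finset

lemma eq_of_mul_sq_eq_mul_sq {b b' : ℤ} {v v' : ℕ} (hv : 0 < v)
    (hb : IsCoprime b (v : ℤ)) (hb' : IsCoprime b' (v' : ℤ))
    (h : b * (v' : ℤ) ^ 2 = b' * (v : ℤ) ^ 2) : b = b' ∧ v = v' := by
  have h1 : (v : ℤ) ^ 2 ∣ (v' : ℤ) ^ 2 :=
    (hb.symm.pow_left (m := 2)).dvd_of_dvd_mul_left ⟨b', by rw [h]; ring⟩
  have h2 : (v' : ℤ) ^ 2 ∣ (v : ℤ) ^ 2 :=
    (hb'.symm.pow_left (m := 2)).dvd_of_dvd_mul_left ⟨b, by rw [← h]; ring⟩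
  have h3 : v ∣ v' := by
    have := (Int.pow_dvd_pow_iff two_ne_zero).1 h1
    exact_mod_cast this
  have h4 : v' ∣ v := by
    have := (Int.pow_dvd_pow_iff two_ne_zero).1 h2
    exact_mod_cast this
  have hvv : v = v' := Nat.dvd_antisymm h3 h4
  subst hvv
  refine ⟨?_, rfl⟩
  have : (v : ℤ) ^ 2 ≠ 0 := by positivity
  exact mul_right_cancel₀ this h

/-- Under `U2`, a triple of shifts admits few pairs `(a, v)`, reduced relative to a common
divisor `w` of the `a`'s, for which `a` and its shifts dilated by `v ^ 2` are all squares. -/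
lemma U2.card_le {C : ℕ} (hU : U2 C) {α β γ : ℤ} (hα : α ≠ 0) (hβ : β ≠ 0) (hγ : γ ≠ 0)
    (hαβ : α ≠ β) (hαγ : α ≠ γ) (hβγ : β ≠ γ) (w : ℤ) (s : Finset (ℤ × ℕ))
    (hs : ∀ p ∈ s, p.1 ≠ 0 ∧ 0 < p.2 ∧ w ∣ p.1 ∧ IsCoprime (p.1 / w) (p.2 : ℤ) ∧
      IsSquare p.1 ∧ IsSquare (p.1 + (p.2 : ℤ) ^ 2 * α) ∧
      IsSquare (p.1 + (p.2 : ℤ) ^ 2 * β) ∧ IsSquare (p.1 + (p.2 : ℤ) ^ 2 * γ)) :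
    s.card ≤ C := by
  obtain ⟨hfin, hcard⟩ := hU α β γ hα hβ hγ hαβ hαγ hβγ
  set S := {p : ℚ × ℚ |
        p.2 ^ 2 = (p.1 ^ 2 + (α : ℚ)) * (p.1 ^ 2 + (β : ℚ)) * (p.1 ^ 2 + (γ : ℚ))} with hS
  have key : ∀ p ∈ s, ∃ P : ℚ × ℚ, P ∈ S ∧ P.1 ^ 2 * (p.2 : ℚ) ^ 2 = p.1 := by
    intro p hp
    obtain ⟨-, hv, -, -, ⟨u, hu⟩, ⟨a, ha⟩, ⟨b, hb⟩, ⟨c, hc⟩⟩ := hs p hp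
    have hv' : (p.2 : ℚ) ≠ 0 := by positivity
    have hu' : (p.1 : ℚ) = u * u := by exact_mod_cast hu
    have ha' : (p.1 : ℚ) + (p.2 : ℚ) ^ 2 * α = a * a := by exact_mod_cast ha
    have hb' : (p.1 : ℚ) + (p.2 : ℚ) ^ 2 * β = b * b := by exact_mod_cast hb
    have hc' : (p.1 : ℚ) + (p.2 : ℚ) ^ 2 * γ = c * c := by exact_mod_cast hc
    refine ⟨((u : ℚ) / p.2, (a * b * c : ℚ) / p.2 ^ 3), ?_, ?_⟩
    · have e : ∀ δ : ℚ, ((u : ℚ) / p.2) ^ 2 + δ = (p.1 + (p.2 : ℚ) ^ 2 * δ) / p.2 ^ 2 := by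
        intro δ
        rw [hu']
        field_simp
      simp only [hS, Set.mem_ofPred_eq, e, ha', hb', hc']
      field_simp
    · simp only [hu']
      field_simp
  choose! f hfS hf using key
  have hinj : Set.InjOn f (s : Set (ℤ × ℕ)) := by
    intro p hp p' hp' hpp
    obtain ⟨hp0, hv, ⟨b, hb⟩, hcop, -⟩ := hs p hp
    obtain ⟨-, hv', ⟨b', hb'⟩, hcop', -⟩ := hs p' hp'
    have hw : w ≠ 0 := by
      rintro rfl
      simp [hb] at hp0
    have h1 := hf p hp
    have h2 := hf p' hp'
    rw [← hpp] at h2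
    have h3 : (p.1 : ℚ) * (p'.2 : ℚ) ^ 2 = p'.1 * (p.2 : ℚ) ^ 2 := by
      rw [← h1, ← h2]; ring
    have h4 : p.1 * (p'.2 : ℤ) ^ 2 = p'.1 * (p.2 : ℤ) ^ 2 := by exact_mod_cast h3
    rw [hb, Int.mul_ediv_cancel_left _ hw] at hcop
    rw [hb', Int.mul_ediv_cancel_left _ hw] at hcop'
    rw [hb, hb', mul_assoc, mul_assoc] at h4
    obtain ⟨e1, e2⟩ := eq_of_mul_sq_eq_mul_sq hv hcop hcop' (mul_left_cancel₀ hw h4)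
    exact Prod.ext (by rw [hb, hb', e1]) e2
  have := Set.ncard_le_ncard_of_injOn f (s := (s : Set (ℤ × ℕ))) (t := S) hfS hinj hfin
  rw [Set.ncard_coe_finset] at this
  exact this.trans hcard

/-- A surjection from `ℤ ^ ι` onto `ZMod q` takes each value on at most a proportion `3 ^ |ι| / q`
of a box all of whose sides are at least `q`. -/
lemma card_box_fiber_le {ι : Type*} [Fintype ι] [DecidableEq ι] {q : ℕ} [NeZero q]
    (ψ : (ι → ℤ) →+ ZMod q) (hψ : Function.Surjective ψ) (n : ι → ℕ) (hn : ∀ j, q ≤ n j)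
    (e : ZMod q) :
    q * ((Fintype.piFinset fun j => Finset.Ico (-(n j : ℤ)) (n j)).filter
      fun x => ψ x = e).card ≤ 3 ^ Fintype.card ι * ∏ j, n j := by
  have hq : (0 : ℤ) < q := by exact_mod_cast Nat.pos_of_ne_zero (NeZero.ne q)
  have rep : ∀ c : ZMod q, ∃ t : ι → ℤ, ψ t = c ∧ ∀ j, 0 ≤ t j ∧ t j < q := by
    intro c
    obtain ⟨g, hg⟩ := hψ c
    refine ⟨fun j => g j % q, ?_, fun j => ⟨Int.emod_nonneg _ hq.ne', Int.emod_lt_of_pos _ hq⟩⟩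
    have h1 : g = (fun j => g j % q) + q • (fun j => g j / q) := by
      funext j
      simp [Int.emod_add_mul_ediv]
    have h2 : ψ (q • (fun j => g j / q)) = 0 := by
      rw [map_nsmul]; simp
    rw [← hg]
    conv_rhs => rw [h1]
    rw [map_add, h2, add_zero]
  choose t ht htb using rep
  set X := (Fintype.piFinset fun j => Finset.Ico (-(n j : ℤ)) (n j)).filter fun x => ψ x = e
  have hcard : (X ×ˢ (Finset.univ : Finset (ZMod q))).card ≤
      (Fintype.piFinset fun j => Finset.Ico (-(n j : ℤ)) (2 * n j)).card := by
    refine Finset.card_le_card_of_injOn (fun p => p.1 + t p.2) ?_ ?_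
    · rintro ⟨x, c⟩ hp
      have hx := (Finset.mem_filter.1 (Finset.mem_product.1 hp).1).1
      rw [Fintype.mem_piFinset] at hx
      rw [Finset.mem_coe, Fintype.mem_piFinset]
      intro j
      have h1 := Finset.mem_Ico.1 (hx j)
      have h2 := htb c j
      have h3 : (q : ℤ) ≤ n j := by exact_mod_cast hn j
      simp only [Finset.mem_Ico, Pi.add_apply]
      constructor <;> linarith [h1.1, h1.2, h2.1, h2.2]
    · rintro ⟨x, c⟩ hp ⟨x', c'⟩ hp' hxx
      have hx := (Finset.mem_filter.1 (Finset.mem_product.1 hp).1).2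
      have hx' := (Finset.mem_filter.1 (Finset.mem_product.1 hp').1).2
      have hc : c = c' := by
        have := congrArg ψ hxx
        simp only [map_add, ht] at this
        simp only at hx hx'
        rw [hx, hx'] at this
        exact add_left_cancel this
      subst hc
      simpa using hxx
  rw [Finset.card_product, Finset.card_univ, ZMod.card, Fintype.card_piFinset] at hcard
  have h3 : ∏ j, (Finset.Ico (-(n j : ℤ)) (2 * n j)).card = 3 ^ Fintype.card ι * ∏ j, n j := by
    have : ∀ j, (Finset.Ico (-(n j : ℤ)) (2 * n j)).card = 3 * n j := by
      intro j
      rw [Int.card_Ico]; omega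
    simp only [this, Finset.prod_mul_distrib, Finset.prod_const, Finset.card_univ]
  rw [h3] at hcard
  linarith [mul_comm q X.card]

lemma exists_box_fiber_ge {ι : Type*} [Fintype ι] [DecidableEq ι] {q : ℕ} [NeZero q]
    (ψ : (ι → ℤ) → ZMod q) (s : ι → ℕ) :
    ∃ c, ∏ j, s j ≤ q * ((Fintype.piFinset fun j => Finset.Ico (0 : ℤ) (s j)).filter
      fun x => ψ x = c).card := by
  by_contra! h
  have h1 := Finset.card_eq_sum_card_fiberwise (f := ψ)
    (s := Fintype.piFinset fun j => Finset.Ico (0 : ℤ) (s j)) (t := Finset.univ)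
    (fun _ _ => Finset.mem_coe.2 (Finset.mem_univ _))
  have h2 : (Fintype.piFinset fun j => Finset.Ico (0 : ℤ) (s j)).card = ∏ j, s j := by
    simp [Fintype.card_piFinset]
  have h3 : ∑ c : ZMod q, q * ((Fintype.piFinset fun j => Finset.Ico (0 : ℤ) (s j)).filter
      fun x => ψ x = c).card < ∑ c : ZMod q, ∏ j, s j :=
    Finset.sum_lt_sum_of_nonempty Finset.univ_nonempty fun c _ => h c
  rw [← Finset.mul_sum, ← h1, h2] at h3
  simp [ZMod.card] at h3

/-- Lower bound for the number of injective quadruples from `T`. -/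
lemma pow_four_le_card_injective {α : Type*} [DecidableEq α] (S T : Finset α) (hT : T ⊆ S) :
    (T.card - 3) ^ 4 ≤ ((Fintype.piFinset fun _ : Fin 4 => S).filter
      fun f => Function.Injective f ∧ ∀ i, f i ∈ T).card := by
  have h := Nat.pow_sub_le_descFactorial T.card 4
  have h1 : Fintype.card (Fin 4 ↪ T) = T.card.descFactorial 4 := by
    rw [Fintype.card_embedding_eq]; simp
  rw [← h1] at h
  refine (le_trans (le_of_eq (by congr 1)) h).trans ?_
  rw [← Finset.card_univ]
  refine Finset.card_le_card_of_injOn (fun g i => (g i : α)) ?_ ?_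
  · intro g _
    simp only [Finset.coe_filter, Fintype.mem_piFinset, Set.mem_ofPred_eq]
    refine ⟨fun i => hT (g i).2, fun i j hij => g.injective (Subtype.ext hij), fun i => (g i).2⟩
  · intro g _ g' _ hgg
    ext i
    exact congrFun hgg i

lemma sum_odd_rpow_le (k : ℕ) :
    ∑ i ∈ Finset.range k, 1 / ((2 * i + 17 : ℝ) * √(2 * i + 17)) ≤
      1 / 4 - 1 / √(2 * k + 16) := by
  induction k with
  | zero =>
    have : √(16 : ℝ) = 4 := by
      rw [show (16 : ℝ) = 4 ^ 2 by norm_num]; exact Real.sqrt_sq (by norm_num)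
    simp [this]
  | succ k ih =>
    rw [Finset.sum_range_succ]
    have hstep : ∀ x : ℝ, 1 < x → 1 / (x * √x) ≤ 1 / √(x - 1) - 1 / √(x + 1) := by
      intro x hx
      have ha : 0 < √(x - 1) := Real.sqrt_pos.2 (by linarith)
      have hb : 0 < √(x + 1) := Real.sqrt_pos.2 (by linarith)
      have hc : 0 < √x := Real.sqrt_pos.2 (by linarith)
      have ha2 := Real.sq_sqrt (show 0 ≤ x - 1 by linarith)
      have hb2 := Real.sq_sqrt (show 0 ≤ x + 1 by linarith)
      have hc2 := Real.sq_sqrt (show 0 ≤ x by linarith)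
      set a := √(x - 1)
      set b := √(x + 1)
      set c := √x
      have hx' : x = c ^ 2 := hc2.symm
      have hab : a * b ≤ c ^ 2 := by nlinarith [sq_nonneg (a - b)]
      have hs : a + b ≤ 2 * c := by
        refine le_of_sq_le_sq ?_ (by positivity)
        nlinarith
      rw [div_sub_div _ _ ha.ne' hb.ne', div_le_div_iff₀ (by positivity) (by positivity)]
      have h2 : (b - a) * (a + b) = 2 := by nlinarith
      have h3 : 1 ≤ (b - a) * c := by
        have : 0 ≤ b - a := by
          by_contra hneg
          nlinarith
        nlinarith
      rw [hx']
      nlinarith [mul_nonneg (sq_nonneg c) (sub_nonneg.2 h3)]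
    have := hstep (2 * k + 17) (by
      have : (0 : ℝ) ≤ k := by positivity
      linarith)
    have e1 : (2 * (k : ℝ) + 17 - 1) = 2 * k + 16 := by ring
    have e2 : (2 * (k : ℝ) + 17 + 1) = 2 * ((k + 1 : ℕ) : ℝ) + 16 := by push_cast; ring
    rw [e1, e2] at this
    linarith

lemma sum_prime_rpow_le (s : Finset ℕ) (hs : ∀ p ∈ s, p.Prime) :
    ∑ p ∈ s, 1 / ((p : ℝ) * √p) ≤ 99 / 100 := by
  classical
  obtain ⟨k, hk⟩ : ∃ k : ℕ, ∀ p ∈ s, p < k := ⟨s.sup id + 1, fun p hp =>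
    Nat.lt_succ_of_le (Finset.le_sup (f := id) hp)⟩
  have hsub : s ⊆ {2, 3, 5, 7, 11, 13} ∪ ((Finset.range k).image (fun i => 2 * i + 17) : Finset ℕ) := by
    intro p hp
    have hpp := hs p hp
    rw [Finset.mem_union]
    by_cases h : p < 17
    · left
      interval_cases p <;> first | decide | (exfalso; revert hpp; decide)
    · right
      obtain ⟨i, hi⟩ := hpp.odd_of_ne_two (by omega)
      rw [Finset.mem_image]
      exact ⟨i - 8, Finset.mem_range.2 (by have := hk p hp; omega), by omega⟩
  have hnn : ∀ p : ℕ, (0 : ℝ) ≤ 1 / ((p : ℝ) * √p) := fun p => by positivity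
  refine (Finset.sum_le_sum_of_subset_of_nonneg hsub fun p _ _ => hnn p).trans ?_
  have hunion := Finset.sum_union_inter (s₁ := ({2, 3, 5, 7, 11, 13} : Finset ℕ))
    (s₂ := ((Finset.range k).image (fun i => 2 * i + 17) : Finset ℕ)) (f := fun p : ℕ => 1 / ((p : ℝ) * √p))
  have hinter : 0 ≤ ∑ p ∈ ({2, 3, 5, 7, 11, 13} : Finset ℕ) ∩
      ((Finset.range k).image (fun i => 2 * i + 17) : Finset ℕ), 1 / ((p : ℝ) * √p) :=
    Finset.sum_nonneg fun p _ => hnn p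
  have htail : ∑ p ∈ ((Finset.range k).image (fun i => 2 * i + 17) : Finset ℕ), 1 / ((p : ℝ) * √p) ≤ 1 / 4 := by
    rw [Finset.sum_image (fun a _ b _ h => by omega)]
    have h := sum_odd_rpow_le k
    have : 0 ≤ 1 / √(2 * (k : ℝ) + 16) := by positivity
    push_cast
    linarith
  have hbd : ∀ (p : ℕ) (r : ℝ), 0 < p → 0 < r → r ^ 2 ≤ p →
      1 / ((p : ℝ) * √p) ≤ 1 / (p * r) := by
    intro p r hp hr h
    have hp' : (0 : ℝ) < p := by exact_mod_cast hp
    have : r ≤ √p := Real.le_sqrt_of_sq_le h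
    gcongr
  have hhead : ∑ p ∈ ({2, 3, 5, 7, 11, 13} : Finset ℕ), 1 / ((p : ℝ) * √p) ≤ 74 / 100 := by
    have h2 := hbd 2 1.414 (by norm_num) (by norm_num) (by norm_num)
    have h3 := hbd 3 1.732 (by norm_num) (by norm_num) (by norm_num)
    have h5 := hbd 5 2.236 (by norm_num) (by norm_num) (by norm_num)
    have h7 := hbd 7 2.645 (by norm_num) (by norm_num) (by norm_num)
    have h11 := hbd 11 3.316 (by norm_num) (by norm_num) (by norm_num)
    have h13 := hbd 13 3.605 (by norm_num) (by norm_num) (by norm_num)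
    rw [Finset.sum_insert (by decide), Finset.sum_insert (by decide), Finset.sum_insert (by decide),
      Finset.sum_insert (by decide), Finset.sum_insert (by decide), Finset.sum_singleton]
    refine (add_le_add h2 (add_le_add h3 (add_le_add h5 (add_le_add h7
      (add_le_add h11 h13))))).trans ?_
    norm_num
  linarith

/-- The affine form `x ↦ k₀ + ∑ j, k j * x j` parametrizing a generalized progression. -/
def affineForm {ι : Type*} [Fintype ι] (k₀ : ℤ) (k : ι → ℤ) (x : ι → ℤ) : ℤ :=
  k₀ + ∑ j, k j * x j

lemma affineForm_add_smul {ι : Type*} [Fintype ι] (k₀ : ℤ) (k x y z : ι → ℤ) (c : ℤ) :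
    affineForm k₀ k (x + c • y) =
      affineForm k₀ k (x + c • z) + c * (∑ j, k j * y j - ∑ j, k j * z j) := by
  simp only [affineForm, Pi.add_apply, Pi.smul_apply, smul_eq_mul, mul_add, mul_sub,
    Finset.sum_add_distrib, Finset.mul_sum]
  have : ∀ y : ι → ℤ, ∑ j, k j * (c * y j) = ∑ j, c * (k j * y j) := fun y =>
    Finset.sum_congr rfl fun j _ => by ring
  rw [this y, this z]
  ring

/-- For a fixed quadruple of translations, `U2` bounds the number of pairs `(v, x)` whose
translates by the `v ^ 2`-dilated quadruple all lie in a set of indices of squares. -/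
lemma card_dilated_quadruple_le {C : ℕ} (hU : U2 C) {ι : Type*} [Fintype ι] [DecidableEq ι]
    (k₀ : ℤ) (k : ι → ℤ) (I : Finset (ι → ℤ)) (hinj : Set.InjOn (affineForm k₀ k) I)
    (hsq : ∀ x ∈ I, affineForm k₀ k x ≠ 0 ∧ IsSquare (affineForm k₀ k x))
    (w : ℤ) (hw : ∀ x ∈ I, w ∣ affineForm k₀ k x) (l : Fin 4 → ι → ℤ) (hl : Function.Injective l)
    (P : Finset (Σ _ : ℕ, ι → ℤ))
    (hP : ∀ p ∈ P, 0 < p.1 ∧ ∀ i, p.2 + (p.1 : ℤ) ^ 2 • l i ∈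
      I.filter fun x => IsCoprime (affineForm k₀ k x / w) (p.1 : ℤ)) :
    P.card ≤ C := by
  rcases P.eq_empty_or_nonempty with rfl | ⟨p₀, hp₀⟩
  · simp
  have hmem : ∀ p ∈ P, ∀ i, p.2 + (p.1 : ℤ) ^ 2 • l i ∈ I := fun p hp i =>
    (Finset.mem_filter.1 ((hP p hp).2 i)).1
  have hne : ∀ i i', i ≠ i' → ∑ j, k j * l i j ≠ ∑ j, k j * l i' j := by
    intro i i' hii heq
    have h1 := affineForm_add_smul k₀ k p₀.2 (l i) (l i') ((p₀.1 : ℤ) ^ 2)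
    rw [heq, sub_self, mul_zero, add_zero] at h1
    have h2 := add_left_cancel (hinj (hmem p₀ hp₀ i) (hmem p₀ hp₀ i') h1)
    have h3 : (p₀.1 : ℤ) ^ 2 ≠ 0 := by
      have := (hP p₀ hp₀).1
      positivity
    exact hii (hl (smul_right_injective _ h3 h2))
  set L : Fin 4 → ℤ := fun i => ∑ j, k j * l i j with hL
  have hPinj : Set.InjOn (fun p : (Σ _ : ℕ, ι → ℤ) =>
      (affineForm k₀ k (p.2 + (p.1 : ℤ) ^ 2 • l 0), p.1)) (P : Set (Σ _ : ℕ, ι → ℤ)) := by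
    rintro ⟨v, x⟩ hp ⟨v', x'⟩ hp' h
    obtain ⟨h1, h2⟩ := Prod.mk.inj h
    simp only at h2
    subst h2
    have h3 := hinj (hmem _ hp 0) (hmem _ hp' 0) h1
    simp only at h3
    rw [add_right_cancel h3]
  rw [← Finset.card_image_of_injOn hPinj]
  refine hU.card_le (α := L 1 - L 0) (β := L 2 - L 0) (γ := L 3 - L 0)
    (sub_ne_zero.2 (hne _ _ (by decide))) (sub_ne_zero.2 (hne _ _ (by decide)))
    (sub_ne_zero.2 (hne _ _ (by decide)))
    (fun h => hne 1 2 (by decide) (sub_left_injective h))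
    (fun h => hne 1 3 (by decide) (sub_left_injective h))
    (fun h => hne 2 3 (by decide) (sub_left_injective h)) w _ ?_
  intro z hz
  obtain ⟨p, hp, rfl⟩ := Finset.mem_image.1 hz
  have hi := fun i => (hsq _ (hmem p hp i)).2
  simp only [hL]
  refine ⟨(hsq _ (hmem p hp 0)).1, (hP p hp).1, hw _ (hmem p hp 0),
    (Finset.mem_filter.1 ((hP p hp).2 0)).2, hi 0, ?_, ?_, ?_⟩
  · rw [← affineForm_add_smul]; exact hi 1
  · rw [← affineForm_add_smul]; exact hi 2
  · rw [← affineForm_add_smul]; exact hi 3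

lemma card_pow_four_mul_le_s1 {C : ℕ} (hU : U2 C) {ι : Type*} [Fintype ι] [DecidableEq ι]
    (k₀ : ℤ) (k : ι → ℤ) (n s : ι → ℕ) (I : Finset (ι → ℤ))
    (hI : ∀ x ∈ I, ∀ j, 0 ≤ x j ∧ x j < n j) (hinj : Set.InjOn (affineForm k₀ k) I)
    (hsq : ∀ x ∈ I, affineForm k₀ k x ≠ 0 ∧ IsSquare (affineForm k₀ k x))
    (w : ℤ) (hw : ∀ x ∈ I, w ∣ affineForm k₀ k x) {q : ℕ} [NeZero q] (hqn : ∀ j, q ≤ n j)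
    (ψ : (ι → ℤ) →+ ZMod q) (hψ : Function.Surjective ψ) (e : ZMod q) (hψI : ∀ x ∈ I, ψ x = e)
    (Y : ℕ) (hY : 0 < Y) (hs : ∀ j, 1 ≤ s j) (hsn : ∀ j, Y ^ 2 * (s j - 1) ≤ n j)
    (havg : (Y : ℝ) * I.card ≤ 100 * ∑ v ∈ Finset.Icc 1 Y,
      ((I.filter fun x => IsCoprime (affineForm k₀ k x / w) (v : ℤ)).card : ℝ))
    (hbig : 600 * (3 ^ Fintype.card ι * ∏ j, (n j : ℝ)) ≤ I.card * ∏ j, (s j : ℝ)) :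
    (I.card : ℝ) ^ 4 * Y * q ^ 3 ≤ 200 ^ 4 * C * (3 ^ Fintype.card ι * ∏ j, (n j : ℝ)) ^ 3 := by
  classical
  obtain ⟨c, hc⟩ := exists_box_fiber_ge ψ s
  set S := (Fintype.piFinset fun j => Finset.Ico (0 : ℤ) (s j)).filter fun x => ψ x = c with hS
  set I' : ℕ → Finset (ι → ℤ) := fun v =>
    I.filter fun x => IsCoprime (affineForm k₀ k x / w) (v : ℤ) with hI'
  set X : ℕ → Finset (ι → ℤ) := fun v =>
    (Fintype.piFinset fun j => Finset.Ico (-(n j : ℤ)) (n j)).filter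
      fun x => ψ x = e - (v : ℤ) ^ 2 • c with hX
  set P : Finset (Σ _ : ℕ, ι → ℤ) := (Finset.Icc 1 Y).sigma X with hPdef
  set T : (Σ _ : ℕ, ι → ℤ) → Finset (ι → ℤ) := fun p =>
    S.filter fun l => p.2 + (p.1 : ℤ) ^ 2 • l ∈ I' p.1 with hT
  set E : ℝ := 3 ^ Fintype.card ι * ∏ j, (n j : ℝ) with hE
  have hq : (0 : ℝ) < q := by exact_mod_cast Nat.pos_of_ne_zero (NeZero.ne q)
  have hY' : (0 : ℝ) < Y := by exact_mod_cast hY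
  have hXcard : ∀ v, (q : ℝ) * (X v).card ≤ E := by
    intro v
    have : q * (X v).card ≤ 3 ^ Fintype.card ι * ∏ j, n j :=
      card_box_fiber_le ψ hψ n hqn (e - (v : ℤ) ^ 2 • c)
    rw [hE]
    exact_mod_cast this
  have hPcard : (q : ℝ) * P.card ≤ Y * E := by
    rw [hPdef, Finset.card_sigma]
    push_cast
    rw [Finset.mul_sum]
    refine (Finset.sum_le_sum fun v _ => hXcard v).trans ?_
    simp
  have hsprod : (1 : ℝ) ≤ ∏ j, (s j : ℝ) := by
    have : ∏ j, (1 : ℝ) ≤ ∏ j, (s j : ℝ) :=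
      Finset.prod_le_prod (fun _ _ => zero_le_one) fun j _ => by exact_mod_cast hs j
    simpa using this
  have hcR : ∏ j, (s j : ℝ) ≤ q * S.card := by exact_mod_cast hc
  have hSpos : (0 : ℝ) < S.card := by
    by_contra h
    have : (S.card : ℝ) = 0 := le_antisymm (not_lt.1 h) (by positivity)
    rw [this, mul_zero] at hcR
    linarith
  have hsum : ∀ v ∈ Finset.Icc 1 Y, (I' v).card * S.card ≤ ∑ x ∈ X v, (T ⟨v, x⟩).card := by
    intro v hv
    rw [← Finset.card_product, ← Finset.card_sigma]
    refine Finset.card_le_card_of_injOn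
      (fun p => (⟨p.1 - (v : ℤ) ^ 2 • p.2, p.2⟩ : Σ _ : ι → ℤ, ι → ℤ)) ?_ ?_
    · rintro ⟨z, l⟩ hp
      obtain ⟨hz, hl⟩ := Finset.mem_product.1 hp
      simp only at hz hl
      obtain ⟨hl1, hl2⟩ := Finset.mem_filter.1 hl
      have hzI := (Finset.mem_filter.1 hz).1
      rw [Finset.mem_coe, Finset.mem_sigma]
      refine ⟨?_, ?_⟩
      · simp only [hX, Finset.mem_filter, Fintype.mem_piFinset, Finset.mem_Ico]
        refine ⟨fun j => ?_, ?_⟩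
        · have h1 := hI z hzI j
          have h2 := Finset.mem_Ico.1 (Fintype.mem_piFinset.1 hl1 j)
          have h3 : ((v : ℤ) ^ 2) * l j ≤ (n j : ℤ) := by
            have h4 : v ^ 2 ≤ Y ^ 2 := Nat.pow_le_pow_left (Finset.mem_Icc.1 hv).2 2
            have h5 : l j ≤ ((s j - 1 : ℕ) : ℤ) := by
              have := hs j
              omega
            calc ((v : ℤ) ^ 2) * l j ≤ (Y : ℤ) ^ 2 * ((s j - 1 : ℕ) : ℤ) := by
                  apply mul_le_mul _ h5 h2.1 (by positivity)
                  exact_mod_cast h4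
              _ ≤ (n j : ℤ) := by exact_mod_cast hsn j
          have h6 : 0 ≤ ((v : ℤ) ^ 2) * l j := mul_nonneg (by positivity) h2.1
          simp only [Pi.sub_apply, Pi.smul_apply, smul_eq_mul]
          constructor <;> linarith [h1.1, h1.2]
        · rw [map_sub, map_zsmul, hl2, hψI z hzI]
      · simp only [hT, Finset.mem_filter]
        exact ⟨hl, by simpa using hz⟩
    · rintro ⟨z, l⟩ _ ⟨z', l'⟩ _ h
      simp only [Sigma.mk.injEq, heq_eq_eq] at h
      obtain ⟨h1, rfl⟩ := h
      rw [sub_left_injective h1]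
  have hsumT : (Y : ℝ) * I.card * S.card ≤ 100 * ∑ p ∈ P, ((T p).card : ℝ) := by
    rw [hPdef, Finset.sum_sigma]
    calc (Y : ℝ) * I.card * S.card ≤ (100 * ∑ v ∈ Finset.Icc 1 Y, ((I' v).card : ℝ)) * S.card := by
          gcongr
      _ = 100 * ∑ v ∈ Finset.Icc 1 Y, ((I' v).card : ℝ) * S.card := by
          rw [mul_assoc, Finset.sum_mul]
      _ ≤ _ := by
          gcongr with v hv
          exact_mod_cast hsum v hv
  -- count injective quadruples in two ways
  have hquad : ∑ p ∈ P, ((T p).card - 3) ^ 4 ≤ C * S.card ^ 4 := by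
    set Q := Fintype.piFinset fun _ : Fin 4 => S
    set r : (Σ _ : ℕ, ι → ℤ) → (Fin 4 → ι → ℤ) → Prop := fun p l =>
      Function.Injective l ∧ ∀ i, l i ∈ T p
    calc ∑ p ∈ P, ((T p).card - 3) ^ 4 ≤ ∑ p ∈ P, (Finset.bipartiteAbove r Q p).card :=
          Finset.sum_le_sum fun p _ =>
            pow_four_le_card_injective S (T p) (Finset.filter_subset _ _)
      _ = ∑ l ∈ Q, (Finset.bipartiteBelow r P l).card :=
          Finset.sum_card_bipartiteAbove_eq_sum_card_bipartiteBelow r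
      _ ≤ ∑ l ∈ Q, C := by
          refine Finset.sum_le_sum fun l _ => ?_
          by_cases hl : Function.Injective l
          · refine card_dilated_quadruple_le hU k₀ k I hinj hsq w hw l hl _ ?_
            intro p hp
            obtain ⟨hp1, -, hp2⟩ := Finset.mem_filter.1 hp
            exact ⟨(Finset.mem_Icc.1 (Finset.mem_sigma.1 hp1).1).1,
              fun i => (Finset.mem_filter.1 (hp2 i)).2⟩
          · have : Finset.bipartiteBelow r P l = ∅ :=
              Finset.filter_eq_empty_iff.2 fun p _ h => hl h.1
            simp [this]
      _ = C * S.card ^ 4 := by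
          simp [Q, Fintype.card_piFinset, mul_comm]
  set D : ℝ := ∑ p ∈ P, (((T p).card - 3 : ℕ) : ℝ) with hD
  have hDge : (Y : ℝ) * I.card * S.card ≤ 200 * D := by
    have h1 : ∑ p ∈ P, ((T p).card : ℝ) ≤ D + 3 * P.card := by
      have : ∀ p ∈ P, ((T p).card : ℝ) ≤ (((T p).card - 3 : ℕ) : ℝ) + 3 := by
        intro p _
        have : (T p).card ≤ ((T p).card - 3) + 3 := by omega
        exact_mod_cast this
      refine (Finset.sum_le_sum this).trans ?_
      rw [Finset.sum_add_distrib, Finset.sum_const, nsmul_eq_mul, mul_comm (3 : ℝ)]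
    have h2 : 600 * (P.card : ℝ) ≤ Y * I.card * S.card := by
      have h3 : (q : ℝ) * (600 * P.card) ≤ q * (Y * I.card * S.card) := by
        calc (q : ℝ) * (600 * P.card) = 600 * (q * P.card) := by ring
          _ ≤ 600 * (Y * E) := by gcongr
          _ = Y * (600 * E) := by ring
          _ ≤ Y * (I.card * ∏ j, (s j : ℝ)) := by gcongr
          _ ≤ Y * (I.card * (q * S.card)) := by gcongr
          _ = _ := by ring
      exact le_of_mul_le_mul_left h3 hq
    linarith
  have hDpow : D ^ 4 ≤ P.card ^ 3 * (C * S.card ^ 4) := by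
    have h1 := pow_sum_div_card_le_sum_pow (s := P)
      (f := fun p => (((T p).card - 3 : ℕ) : ℝ)) (fun _ _ => by positivity) 3
    have h2 : ∑ p ∈ P, (((T p).card - 3 : ℕ) : ℝ) ^ (3 + 1) ≤ C * (S.card : ℝ) ^ 4 := by
      exact_mod_cast hquad
    rcases P.eq_empty_or_nonempty with hP0 | hP0
    · simp [hD, hP0]
    · have h3 : (0 : ℝ) < (P.card : ℝ) ^ 3 := by
        have := hP0.card_pos
        positivity
      rw [div_le_iff₀ h3] at h1
      calc D ^ 4 ≤ _ := h1
        _ ≤ (C * (S.card : ℝ) ^ 4) * P.card ^ 3 := by gcongr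
        _ = _ := by ring
  have hfinal : ((I.card : ℝ) ^ 4 * Y * q ^ 3) * (Y ^ 3 * S.card ^ 4) ≤
      (200 ^ 4 * C * E ^ 3) * (Y ^ 3 * S.card ^ 4) := by
    calc ((I.card : ℝ) ^ 4 * Y * q ^ 3) * (Y ^ 3 * S.card ^ 4)
        = q ^ 3 * (Y * I.card * S.card) ^ 4 := by ring
      _ ≤ q ^ 3 * (200 * D) ^ 4 := by gcongr
      _ = 200 ^ 4 * q ^ 3 * D ^ 4 := by ring
      _ ≤ 200 ^ 4 * q ^ 3 * (P.card ^ 3 * (C * S.card ^ 4)) := by gcongr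
      _ = 200 ^ 4 * (C * S.card ^ 4) * (q * P.card) ^ 3 := by ring
      _ ≤ 200 ^ 4 * (C * S.card ^ 4) * (Y * E) ^ 3 := by gcongr
      _ = _ := by ring
  exact le_of_mul_le_mul_right hfinal (by positivity)

/-- Reduction of a linear form modulo `w`, normalized so as to be surjective. -/
lemma exists_surjective_hom {ι : Type*} [Fintype ι] (k : ι → ℤ) (κ : ℕ)
    (hκ : ∀ j, (κ : ℤ) ∣ k j) (b : ι → ℤ) (hb : ∑ j, b j * k j = κ) (w : ℕ) (hw : 0 < w) :
    ∃ ψ : (ι → ℤ) →+ ZMod (w / w.gcd κ), Function.Surjective ψ ∧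
      ∀ x y : ι → ℤ, (w : ℤ) ∣ ∑ j, k j * x j - ∑ j, k j * y j → ψ x = ψ y := by
  have hd : 0 < w.gcd κ := Nat.gcd_pos_of_pos_left _ hw
  obtain ⟨q, hq⟩ := Nat.gcd_dvd_left w κ
  obtain ⟨κ', hκ'⟩ := Nat.gcd_dvd_right w κ
  have hcop : (w / w.gcd κ).Coprime (κ / w.gcd κ) := Nat.coprime_div_gcd_div_gcd hd
  set d := w.gcd κ with hd_def
  have hq' : w / d = q := by rw [hq, Nat.mul_div_cancel_left _ hd]
  have hκq : κ / d = κ' := by rw [hκ', Nat.mul_div_cancel_left _ hd]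
  rw [hq', hκq] at hcop
  rw [hq']
  have hdvd : ∀ j, ∃ a : ℤ, k j = d * a := fun j =>
    (Int.natCast_dvd_natCast.2 ⟨κ', hκ'⟩).trans (hκ j)
  choose k' hk' using hdvd
  have hd0 : (d : ℤ) ≠ 0 := by positivity
  have hsum : ∀ x : ι → ℤ, ∑ j, k j * x j = d * ∑ j, k' j * x j := by
    intro x
    rw [Finset.mul_sum]
    exact Finset.sum_congr rfl fun j _ => by rw [hk' j]; ring
  have hb' : ∑ j, k' j * b j = κ' := by
    have h1 : (d : ℤ) * ∑ j, k' j * b j = d * κ' := by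
      rw [← hsum]
      have : (κ : ℤ) = d * κ' := by exact_mod_cast hκ'
      rw [← this, ← hb]
      exact Finset.sum_congr rfl fun j _ => mul_comm _ _
    exact mul_left_cancel₀ hd0 h1
  refine ⟨AddMonoidHom.mk' (fun x => ((∑ j, k' j * x j : ℤ) : ZMod q)) ?_, ?_, ?_⟩
  · intro x y
    simp [mul_add, Finset.sum_add_distrib]
  · intro e
    obtain ⟨z, hz⟩ := ZMod.intCast_surjective 
      (e * (((ZMod.unitOfCoprime κ' hcop.symm)⁻¹ : (ZMod q)ˣ) : ZMod q))
    refine ⟨fun j => z * b j, ?_⟩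
    have h1 : ∑ j, k' j * (z * b j) = z * κ' := by
      rw [← hb', Finset.mul_sum]
      exact Finset.sum_congr rfl fun j _ => by ring
    simp only [AddMonoidHom.mk'_apply, h1]
    push_cast
    have hu := Units.inv_mul (ZMod.unitOfCoprime κ' hcop.symm)
    rw [ZMod.coe_unitOfCoprime] at hu
    rw [hz, mul_assoc, hu, mul_one]
  · intro x y hxy
    simp only [AddMonoidHom.mk'_apply]
    rw [ZMod.intCast_eq_intCast_iff_dvd_sub]
    rw [hsum, hsum, ← mul_sub, hq] at hxy
    push_cast at hxy
    rw [← neg_sub, dvd_neg]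
    exact Int.dvd_of_mul_dvd_mul_left hd0 hxy

lemma gcd_mul_prime (w κ : ℕ) (hw : 0 < w) {p : ℕ} (hp : p.Prime) :
    (w * p).gcd κ = w.gcd κ ∨ w.gcd κ * p ∣ κ ∧ (w * p).gcd κ = w.gcd κ * p := by
  have hd : 0 < w.gcd κ := Nat.gcd_pos_of_pos_left _ hw
  obtain ⟨t, ht⟩ : w.gcd κ ∣ (w * p).gcd κ :=
    Nat.gcd_dvd_gcd_of_dvd_left _ (dvd_mul_right w p)
  have h1 : (w * p).gcd κ ∣ w.gcd κ * p := by
    rw [← Nat.gcd_mul_right]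
    exact Nat.dvd_gcd (Nat.gcd_dvd_left _ _)
      ((Nat.gcd_dvd_right _ _).trans (dvd_mul_right _ _))
  rw [ht] at h1
  rcases (Nat.dvd_prime hp).1 (Nat.dvd_of_mul_dvd_mul_left hd h1) with rfl | rfl
  · left; simpa using ht
  · right; exact ⟨ht ▸ Nat.gcd_dvd_right _ _, ht⟩

/-- Choice of a common divisor `w` beyond which passing to multiples of a further prime is
costly. -/
lemma exists_scale {α : Type*} (I : Finset α) (hne : I.Nonempty) (F : α → ℤ)
    (hF : ∀ x ∈ I, 0 < F x) (κ : ℕ) (hκ : ∀ x ∈ I, ∀ y ∈ I, (κ : ℤ) ∣ F x - F y)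
    (Q : ℕ) (hQ : 1 ≤ Q) :
    ∃ w : ℕ, 0 < w ∧ w / w.gcd κ ≤ Q ∧
      I.card ^ 2 ≤ (I.filter fun x => (w : ℤ) ∣ F x).card ^ 2 * (w / w.gcd κ) ∧
      ∀ p : ℕ, p.Prime → p * (w / w.gcd κ) ≤ Q →
        p * (I.filter fun x => ((w * p : ℕ) : ℤ) ∣ F x).card ^ 2 ≤
          (I.filter fun x => (w : ℤ) ∣ F x).card ^ 2 := by
  classical
  set B := I.sup fun x => (F x).toNat with hB
  have hFB : ∀ x ∈ I, F x ≤ B := by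
    intro x hx
    have : (F x).toNat ≤ B := Finset.le_sup (f := fun x => (F x).toNat) hx
    omega
  have hB1 : 1 ≤ B := by
    obtain ⟨x, hx⟩ := hne
    have := hF x hx
    have := hFB x hx
    omega
  set J : ℕ → Finset α := fun w => I.filter fun x => (w : ℤ) ∣ F x with hJ
  set f : ℕ → ℕ := fun w => (J w).card ^ 2 * (w / w.gcd κ) * (B + 1) + w with hf
  have h1mem : 1 ∈ (Finset.Icc 1 B).filter fun w => w / w.gcd κ ≤ Q := by
    simp [hB1, hQ]
  obtain ⟨w, hw, hmax⟩ := Finset.exists_max_image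
    ((Finset.Icc 1 B).filter fun w => w / w.gcd κ ≤ Q) f ⟨1, h1mem⟩
  obtain ⟨hwB, hwQ⟩ := Finset.mem_filter.1 hw
  obtain ⟨hw1, hwB⟩ := Finset.mem_Icc.1 hwB
  have hd : 0 < w.gcd κ := Nat.gcd_pos_of_pos_left _ hw1
  refine ⟨w, hw1, hwQ, ?_, ?_⟩
  · have h1 := hmax 1 h1mem
    have hJ1 : J 1 = I := by simp [hJ]
    simp only [hf, hJ1, Nat.gcd_one_left, Nat.div_one, mul_one] at h1
    by_contra! hlt
    have : ((J w).card ^ 2 * (w / w.gcd κ) + 1) * (B + 1) ≤ I.card ^ 2 * (B + 1) :=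
      Nat.mul_le_mul_right _ hlt
    nlinarith
  · intro p hp hpQ
    change p * (J (w * p)).card ^ 2 ≤ (J w).card ^ 2
    by_cases hempty : J (w * p) = ∅
    · simp [hempty]
    obtain ⟨y, hy⟩ := Finset.nonempty_iff_ne_empty.2 hempty
    obtain ⟨hyI, hyd⟩ := Finset.mem_filter.1 hy
    have hwpB : w * p ≤ B := by
      have h1 := Int.le_of_dvd (hF y hyI) hyd
      have h2 := hFB y hyI
      exact_mod_cast h1.trans h2
    have hlt : w < w * p := lt_mul_of_one_lt_right hw1 hp.one_lt
    have hmem : (w * p) / (w * p).gcd κ ≤ Q →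
        (J (w * p)).card ^ 2 * ((w * p) / (w * p).gcd κ) < (J w).card ^ 2 * (w / w.gcd κ) := by
      intro hle
      have h1 := hmax (w * p) (Finset.mem_filter.2
        ⟨Finset.mem_Icc.2 ⟨Nat.mul_pos hw1 hp.pos, hwpB⟩, hle⟩)
      simp only [hf] at h1
      exact lt_of_mul_lt_mul_right (a := B + 1) (by omega) (Nat.zero_le _)
    rcases gcd_mul_prime w κ hw1 hp with h | ⟨hdvd, h⟩
    · have hqe : (w * p) / (w * p).gcd κ = p * (w / w.gcd κ) := by
        rw [h, mul_comm w p, Nat.mul_div_assoc _ (Nat.gcd_dvd_left _ _)]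
      rw [hqe] at hmem
      have h1 := hmem hpQ
      have hq0 : 0 < w / w.gcd κ := Nat.div_pos (Nat.gcd_le_left _ hw1) hd
      have : p * (J (w * p)).card ^ 2 * (w / w.gcd κ) < (J w).card ^ 2 * (w / w.gcd κ) := by
        linarith
      exact (lt_of_mul_lt_mul_right this (Nat.zero_le _)).le
    · exfalso
      have hqe : (w * p) / (w * p).gcd κ = w / w.gcd κ := by
        rw [h, Nat.mul_div_mul_right _ _ hp.pos]
      have hJe : J w ⊆ J (w * p) := by
        intro x hx
        obtain ⟨hxI, hxd⟩ := Finset.mem_filter.1 hx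
        refine Finset.mem_filter.2 ⟨hxI, ?_⟩
        have hlcm : w * p ∣ w.lcm κ := by
          obtain ⟨κ', hκ'⟩ := hdvd
          have h1 := Nat.gcd_mul_lcm w κ
          refine ⟨κ', Nat.eq_of_mul_eq_mul_left hd ?_⟩
          rw [h1]
          conv_lhs => rw [hκ']
          ring
        have h1 : (w : ℤ) ∣ F x - F y :=
          dvd_sub hxd ((Int.natCast_dvd_natCast.2 (dvd_mul_right w p)).trans hyd)
        have h2 : w.lcm κ ∣ (F x - F y).natAbs :=
          Nat.lcm_dvd (Int.natCast_dvd.1 h1) (Int.natCast_dvd.1 (hκ x hxI y hyI))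
        have h3 : ((w * p : ℕ) : ℤ) ∣ F x - F y := Int.natCast_dvd.2 (hlcm.trans h2)
        have := dvd_add h3 hyd
        rwa [sub_add_cancel] at this
      have h1 := hmem (hqe ▸ hwQ)
      rw [hqe] at h1
      have h2 : (J w).card ^ 2 * (w / w.gcd κ) ≤ (J (w * p)).card ^ 2 * (w / w.gcd κ) := by
        gcongr
      omega

lemma card_le_sum_card_coprime {α : Type*} (I : Finset α) (F : α → ℤ) (w : ℕ)
    (hdvd : ∀ x ∈ I, (w : ℤ) ∣ F x) (Y : ℕ)
    (hp : ∀ p : ℕ, p.Prime → p ≤ Y →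
      p * (I.filter fun x => ((w * p : ℕ) : ℤ) ∣ F x).card ^ 2 ≤ I.card ^ 2) :
    (Y : ℝ) * I.card ≤ 100 * ∑ v ∈ Finset.Icc 1 Y,
      ((I.filter fun x => IsCoprime (F x / (w : ℤ)) (v : ℤ)).card : ℝ) := by
  classical
  set J : ℕ → Finset α := fun p => I.filter fun x => ((w * p : ℕ) : ℤ) ∣ F x with hJ
  set primes : Finset ℕ := (Finset.Icc 1 Y).filter Nat.Prime with hprimes
  have hstep : ∀ v ∈ Finset.Icc 1 Y, I.card ≤
      (I.filter fun x => IsCoprime (F x / (w : ℤ)) (v : ℤ)).card +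
        ∑ p ∈ primes, if p ∣ v then (J p).card else 0 := by
    intro v hv
    obtain ⟨hv1, hvY⟩ := Finset.mem_Icc.1 hv
    rw [← Finset.card_filter_add_card_filter_not (s := I)
      (fun x => IsCoprime (F x / (w : ℤ)) (v : ℤ)), ← Finset.sum_filter]
    gcongr
    refine le_trans (Finset.card_le_card ?_) Finset.card_biUnion_le
    intro x hx
    obtain ⟨hxI, hxn⟩ := Finset.mem_filter.1 hx
    rw [Int.isCoprime_iff_gcd_eq_one, Int.gcd, ← Nat.coprime_iff_gcd_eq_one,
      Nat.Prime.not_coprime_iff_dvd] at hxn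
    obtain ⟨p, hpp, hp1, hp2⟩ := hxn
    rw [Int.natAbs_natCast] at hp2
    refine Finset.mem_biUnion.2 ⟨p, Finset.mem_filter.2 ⟨Finset.mem_filter.2
      ⟨Finset.mem_Icc.2 ⟨hpp.one_le, (Nat.le_of_dvd hv1 hp2).trans hvY⟩, hpp⟩, hp2⟩,
      Finset.mem_filter.2 ⟨hxI, ?_⟩⟩
    have h1 : (p : ℤ) ∣ F x / w := Int.natCast_dvd.2 hp1
    rw [← Int.mul_ediv_cancel' (hdvd x hxI)]
    push_cast
    exact mul_dvd_mul_left _ h1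
  have hsum : (Y : ℝ) * I.card ≤ ∑ v ∈ Finset.Icc 1 Y,
      ((I.filter fun x => IsCoprime (F x / (w : ℤ)) (v : ℤ)).card : ℝ) +
        ∑ p ∈ primes, ((Y / p : ℕ) : ℝ) * (J p).card := by
    have h1 := Finset.sum_le_sum hstep
    rw [Finset.sum_const, Nat.card_Icc, Nat.add_sub_cancel, smul_eq_mul,
      Finset.sum_add_distrib, Finset.sum_comm] at h1
    have h2 : ∀ p ∈ primes, ∑ v ∈ Finset.Icc 1 Y, (if p ∣ v then (J p).card else 0) =
        (Y / p) * (J p).card := by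
      intro p _
      rw [← Finset.sum_filter, Finset.sum_const, smul_eq_mul]
      congr 1
      exact Nat.Ioc_filter_dvd_card_eq_div Y p
    rw [Finset.sum_congr rfl h2] at h1
    exact_mod_cast h1
  have hbad : ∑ p ∈ primes, ((Y / p : ℕ) : ℝ) * (J p).card ≤ 99 / 100 * (Y * I.card) := by
    calc ∑ p ∈ primes, ((Y / p : ℕ) : ℝ) * (J p).card
        ≤ ∑ p ∈ primes, 1 / ((p : ℝ) * √p) * (Y * I.card) := by
          refine Finset.sum_le_sum fun p hpm => ?_
          obtain ⟨hpY, hpp⟩ := Finset.mem_filter.1 hpm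
          have hp0 : (0 : ℝ) < p := by exact_mod_cast hpp.pos
          have h1 : ((Y / p : ℕ) : ℝ) ≤ Y / p := Nat.cast_div_le
          have h2 : √p * (J p).card ≤ (I.card : ℝ) := by
            refine le_of_sq_le_sq ?_ (by positivity)
            rw [mul_pow, Real.sq_sqrt hp0.le]
            exact_mod_cast hp p hpp (Finset.mem_Icc.1 hpY).2
          have h3 : 0 < √(p : ℝ) := Real.sqrt_pos.2 hp0
          calc ((Y / p : ℕ) : ℝ) * (J p).card ≤ Y / p * (I.card / √p) := by
                gcongr
                rwa [le_div_iff₀ h3, mul_comm]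
            _ = _ := by field_simp
      _ = (∑ p ∈ primes, 1 / ((p : ℝ) * √p)) * (Y * I.card) := by rw [Finset.sum_mul]
      _ ≤ 99 / 100 * (Y * I.card) := by
          gcongr
          exact sum_prime_rpow_le _ fun p hp => (Finset.mem_filter.1 hp).2
  linarith

lemma exists_gcd_bezout {ι : Type*} [Fintype ι] (k : ι → ℤ) :
    ∃ (κ : ℕ) (b : ι → ℤ), (∀ j, (κ : ℤ) ∣ k j) ∧ ∑ j, b j * k j = κ := by
  obtain ⟨g, hg⟩ := (IsPrincipalIdealRing.principal (Ideal.span (Set.range k))).principal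
  have h1 : Ideal.span (Set.range k) = Ideal.span {((g.natAbs : ℕ) : ℤ)} := by
    rw [Int.span_natAbs]; exact hg
  have h2 : ((g.natAbs : ℕ) : ℤ) ∈ Ideal.span (Set.range k) := by
    rw [h1]; exact Ideal.mem_span_singleton_self _
  obtain ⟨b, hb⟩ := Ideal.mem_span_range_iff_exists_fun.1 h2
  refine ⟨g.natAbs, b, fun j => ?_, hb⟩
  rw [← Ideal.mem_span_singleton, ← h1]
  exact Ideal.subset_span ⟨j, rfl⟩

/-- The main counting inequality, with a free integer parameter `Q`. -/
theorem card_pow_four_mul_scale_le {C : ℕ} (hU : U2 C) {ι : Type*} [Fintype ι] [DecidableEq ι]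
    [Nonempty ι] (k₀ : ℤ) (k : ι → ℤ) (n : ι → ℕ) (I : Finset (ι → ℤ))
    (hI : ∀ x ∈ I, ∀ j, 0 ≤ x j ∧ x j < n j) (hinj : Set.InjOn (affineForm k₀ k) I)
    (hsq : ∀ x ∈ I, affineForm k₀ k x ≠ 0 ∧ IsSquare (affineForm k₀ k x))
    (Q : ℕ) (hQ : 1 ≤ Q) (hQn : ∀ j, Q ≤ n j)
    (hbig : 600 * 6 ^ Fintype.card ι * Q ^ (2 * Fintype.card ι) ≤ I.card) :
    (I.card : ℝ) ^ 4 * Q ≤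
      2 * 200 ^ 4 * C * (3 ^ Fintype.card ι * ∏ j, (n j : ℝ)) ^ 3 := by
  classical
  set m := Fintype.card ι with hm
  have hm1 : 1 ≤ m := Fintype.card_pos
  have hne : I.Nonempty := by
    rw [← Finset.card_pos]
    exact lt_of_lt_of_le (by positivity) hbig
  have hpos : ∀ x ∈ I, 0 < affineForm k₀ k x := fun x hx =>
    lt_of_le_of_ne (hsq x hx).2.nonneg (hsq x hx).1.symm
  have hdiff : ∀ x y : ι → ℤ, affineForm k₀ k x - affineForm k₀ k y =
      ∑ j, k j * x j - ∑ j, k j * y j := fun x y => by simp [affineForm]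
  obtain ⟨κ, b, hκ, hb⟩ := exists_gcd_bezout k
  obtain ⟨w, hw, hqQ, hIw, hprime⟩ := exists_scale I hne (affineForm k₀ k) hpos κ
    (fun x _ y _ => by
      rw [hdiff]
      exact dvd_sub (Finset.dvd_sum fun j _ => (hκ j).mul_right _)
        (Finset.dvd_sum fun j _ => (hκ j).mul_right _)) Q hQ
  have hq0 : 0 < w / w.gcd κ :=
    Nat.div_pos (Nat.gcd_le_left _ hw) (Nat.gcd_pos_of_pos_left _ hw)
  have hψ := exists_surjective_hom k κ hκ b hb w hw
  set q := w / w.gcd κ with hq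
  obtain ⟨ψ, hψ, hψc⟩ := hψ
  have : NeZero q := ⟨hq0.ne'⟩
  set I' := I.filter fun x => (w : ℤ) ∣ affineForm k₀ k x with hI'
  have hsub : I' ⊆ I := Finset.filter_subset _ _
  have hI'd : ∀ x ∈ I', (w : ℤ) ∣ affineForm k₀ k x := fun x hx => (Finset.mem_filter.1 hx).2
  have hI'ne : I'.Nonempty := by
    rw [Finset.nonempty_iff_ne_empty]
    intro h
    rw [h] at hIw
    have := hne.card_pos
    simp only [Finset.card_empty] at hIw
    have : 0 < I.card ^ 2 := by positivity
    omega
  obtain ⟨x₀, hx₀⟩ := hI'ne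
  set Y := Q / q with hY
  have hY0 : 0 < Y := Nat.div_pos hqQ hq0
  have hYq : Y * q ≤ Q := Nat.div_mul_le_self Q q
  have hQY : Q ≤ 2 * (Y * q) := by
    have h1 : Q < Y * q + q := Nat.lt_div_mul_add hq0
    have h2 : q ≤ Y * q := Nat.le_mul_of_pos_left q hY0
    omega
  have hbig' : 600 * 6 ^ m * Y ^ (2 * m) ≤ I'.card := by
    have h1 : (600 * 6 ^ m * Y ^ (2 * m)) ^ 2 * q ≤ I'.card ^ 2 * q := by
      refine le_trans ?_ hIw
      calc (600 * 6 ^ m * Y ^ (2 * m)) ^ 2 * q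
          ≤ (600 * 6 ^ m * Y ^ (2 * m)) ^ 2 * (q ^ (2 * m)) ^ 2 := by
            gcongr
            rw [← pow_mul]
            exact Nat.le_self_pow (by omega) q
        _ = (600 * 6 ^ m * (Y * q) ^ (2 * m)) ^ 2 := by rw [mul_pow Y q]; ring
        _ ≤ (600 * 6 ^ m * Q ^ (2 * m)) ^ 2 := by gcongr
        _ ≤ I.card ^ 2 := by gcongr
    exact (Nat.pow_le_pow_iff_left two_ne_zero).1 (le_of_mul_le_mul_right h1 hq0)
  set s : ι → ℕ := fun j => max 1 (n j / Y ^ 2) with hs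
  have hsn : ∀ j, n j ≤ s j * (2 * Y ^ 2) := by
    intro j
    have hY2 : 0 < Y ^ 2 := by positivity
    have h1 : n j < n j / Y ^ 2 * Y ^ 2 + Y ^ 2 := Nat.lt_div_mul_add hY2
    have h2 : n j / Y ^ 2 * Y ^ 2 ≤ s j * Y ^ 2 := Nat.mul_le_mul_right _ (le_max_right _ _)
    have h3 : 1 * Y ^ 2 ≤ s j * Y ^ 2 := Nat.mul_le_mul_right _ (le_max_left _ _)
    linarith
  have hmain := card_pow_four_mul_le_s1 hU k₀ k n s I' (fun x hx => hI x (hsub hx))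
    (hinj.mono (by exact_mod_cast hsub)) (fun x hx => hsq x (hsub hx)) (w : ℤ) hI'd
    (fun j => hqQ.trans (hQn j)) ψ hψ (ψ x₀)
    (fun x hx => hψc _ _ (by rw [← hdiff]; exact dvd_sub (hI'd x hx) (hI'd x₀ hx₀)))
    Y hY0 (fun j => le_max_left _ _)
    (fun j => by
      rcases le_total (n j / Y ^ 2) 1 with h | h
      · simp [hs, max_eq_left h]
      · simp only [hs, max_eq_right h]
        exact (Nat.mul_le_mul_left _ (Nat.sub_le _ _)).trans (Nat.mul_div_le _ _))
    (card_le_sum_card_coprime I' (affineForm k₀ k) w hI'd Y fun p hp hpY => by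
      have h1 := hprime p hp ((Nat.mul_le_mul_right q hpY).trans hYq)
      refine le_trans ?_ h1
      gcongr)
    (by
      have h1 : ∏ j, n j ≤ (∏ j, s j) * (2 * Y ^ 2) ^ m := by
        calc ∏ j, n j ≤ ∏ j, s j * (2 * Y ^ 2) := Finset.prod_le_prod' fun j _ => hsn j
          _ = _ := by rw [Finset.prod_mul_distrib, Finset.prod_const, Finset.card_univ]
      have h2 : 600 * (3 ^ m * ∏ j, n j) ≤ I'.card * ∏ j, s j := by
        calc 600 * (3 ^ m * ∏ j, n j) ≤ 600 * (3 ^ m * ((∏ j, s j) * (2 * Y ^ 2) ^ m)) := by gcongr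
          _ = (600 * 6 ^ m * Y ^ (2 * m)) * ∏ j, s j := by
            rw [show (6 : ℕ) = 3 * 2 by norm_num, mul_pow 3 2, mul_pow 2 (Y ^ 2), ← pow_mul]; ring
          _ ≤ _ := by gcongr
      exact_mod_cast h2)
  have hI4 : (I.card : ℝ) ^ 4 ≤ (I'.card : ℝ) ^ 4 * q ^ 2 := by
    have h1 : (I.card : ℝ) ^ 2 ≤ (I'.card : ℝ) ^ 2 * q := by exact_mod_cast hIw
    calc (I.card : ℝ) ^ 4 = ((I.card : ℝ) ^ 2) ^ 2 := by ring
      _ ≤ ((I'.card : ℝ) ^ 2 * q) ^ 2 := by gcongr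
      _ = _ := by ring
  have hQYR : (Q : ℝ) ≤ 2 * (Y * q) := by exact_mod_cast hQY
  calc (I.card : ℝ) ^ 4 * Q ≤ ((I'.card : ℝ) ^ 4 * q ^ 2) * (2 * (Y * q)) := by gcongr
    _ = 2 * ((I'.card : ℝ) ^ 4 * Y * q ^ 3) := by ring
    _ ≤ 2 * (200 ^ 4 * C * (3 ^ m * ∏ j, (n j : ℝ)) ^ 3) := by gcongr
    _ = _ := by ring

/-- The number of square values at points of a box all of whose sides are long. -/
theorem card_le_rpow_of_long_sides {C : ℕ} (hC : 1 ≤ C) (hU : U2 C) {ι : Type*} [Fintype ι]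
    [DecidableEq ι] [Nonempty ι] (k₀ : ℤ) (k : ι → ℤ) (n : ι → ℕ) (hn : ∀ j, 1 ≤ n j)
    (I : Finset (ι → ℤ)) (hI : ∀ x ∈ I, ∀ j, 0 ≤ x j ∧ x j < n j)
    (hinj : Set.InjOn (affineForm k₀ k) I)
    (hsq : ∀ x ∈ I, affineForm k₀ k x ≠ 0 ∧ IsSquare (affineForm k₀ k x))
    (hV : ∀ j, (∏ j, (n j : ℝ)) ^ ((3 : ℝ) / (8 * Fintype.card ι + 1)) ≤ n j) :
    (I.card : ℝ) ≤ (800 * C + 600) * 8 ^ Fintype.card ι *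
      (∏ j, (n j : ℝ)) ^ ((6 * Fintype.card ι : ℝ) / (8 * Fintype.card ι + 1)) := by
  set m := Fintype.card ι with hm
  set N : ℝ := ∏ j, (n j : ℝ) with hN
  have hC' : (1 : ℝ) ≤ C := by exact_mod_cast hC
  have hN1 : 1 ≤ N := by
    have : 1 ≤ ∏ j, n j := Finset.one_le_prod' fun j _ => hn j
    rw [hN]
    exact_mod_cast this
  have hN0 : 0 < N := by linarith
  set V : ℝ := N ^ ((3 : ℝ) / (8 * m + 1)) with hVdef
  set W : ℝ := N ^ ((6 * m : ℝ) / (8 * m + 1)) with hW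
  have hV1 : 1 ≤ V := Real.one_le_rpow hN1 (by positivity)
  have hW0 : 0 < W := Real.rpow_pos_of_pos hN0 _
  have hVW : V ^ (2 * m) = W := by
    rw [hVdef, hW, ← Real.rpow_mul_natCast hN0.le]
    congr 1
    push_cast
    ring
  have hWV : W ^ 4 * V = N ^ 3 := by
    rw [hVdef, hW, ← Real.rpow_mul_natCast hN0.le, ← Real.rpow_add hN0, ← Real.rpow_natCast]
    congr 1
    push_cast
    field_simp
    ring
  set Q := ⌊V⌋₊ with hQ
  have hQ1 : 1 ≤ Q := Nat.le_floor (by exact_mod_cast hV1)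
  have hQV : (Q : ℝ) ≤ V := Nat.floor_le (by linarith)
  have hVQ : V ≤ 2 * Q := by
    have h1 : V < Q + 1 := Nat.lt_floor_add_one V
    have h2 : (1 : ℝ) ≤ Q := by exact_mod_cast hQ1
    linarith
  have h8 : (0 : ℝ) < 8 ^ m * W := by positivity
  by_cases hbig : 600 * 6 ^ m * Q ^ (2 * m) ≤ I.card
  · have hmain := card_pow_four_mul_scale_le hU k₀ k n I hI hinj hsq Q hQ1
      (fun j => by exact_mod_cast hQV.trans (hV j)) hbig
    have h1 : (I.card : ℝ) ^ 4 * V ≤ (800 * C * (8 ^ m * W)) ^ 4 * V := by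
      calc (I.card : ℝ) ^ 4 * V ≤ (I.card : ℝ) ^ 4 * (2 * Q) := by gcongr
        _ = 2 * ((I.card : ℝ) ^ 4 * Q) := by ring
        _ ≤ 2 * (2 * 200 ^ 4 * C * (3 ^ m * N) ^ 3) := by gcongr
        _ = 4 * 200 ^ 4 * C * (27 ^ m * (W ^ 4 * V)) := by
          rw [hWV, mul_pow, ← pow_mul, mul_comm m 3, pow_mul]; norm_num; ring
        _ ≤ 4 ^ 4 * 200 ^ 4 * C ^ 4 * ((8 ^ 4) ^ m * (W ^ 4 * V)) := by
          gcongr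
          · norm_num
          · exact le_self_pow₀ hC' (by norm_num)
          · norm_num
        _ = _ := by rw [← pow_mul, mul_comm 4 m, pow_mul]; ring
    have h2 : (I.card : ℝ) ≤ 800 * C * (8 ^ m * W) :=
      le_of_pow_le_pow_left₀ four_ne_zero (by positivity)
        (le_of_mul_le_mul_right h1 (by linarith))
    linarith
  · push Not at hbig
    have h1 : (I.card : ℝ) ≤ 600 * 6 ^ m * (Q : ℝ) ^ (2 * m) := by exact_mod_cast hbig.le
    have h2 : 600 * 6 ^ m * (Q : ℝ) ^ (2 * m) ≤ 600 * 8 ^ m * W := by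
      rw [← hVW]
      gcongr
      norm_num
    have h3 : 0 ≤ 800 * (C : ℝ) * (8 ^ m * W) := by positivity
    linarith

/-- The bound of `card_le_rpow_of_long_sides` on a slice of a proper progression in which the
coordinates outside `J` are fixed. -/
lemma card_slice_le {C : ℕ} (hC : 1 ≤ C) (hU : U2 C) {d : ℕ} (k₀ : ℤ) (k : Fin d → ℤ)
    (n : Fin d → ℕ) (hn : ∀ j, 1 ≤ n j) (J : Finset (Fin d)) (hJ : J.Nonempty)
    (G : Finset (∀ j : Fin d, Fin (n j)))
    (hinj : Set.InjOn (fun x : ∀ j : Fin d, Fin (n j) => k₀ + ∑ j, k j * ((x j : ℕ) : ℤ)) G)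
    (hsq : ∀ x ∈ G, IsSquare (k₀ + ∑ j, k j * ((x j : ℕ) : ℤ)))
    (t : ∀ j : {j // j ∉ J}, Fin (n j)) (ht : ∀ x ∈ G, (fun j : {j // j ∉ J} => x j) = t)
    (hV : ∀ j ∈ J, (∏ j ∈ J, (n j : ℝ)) ^ ((3 : ℝ) / (8 * J.card + 1)) ≤ n j) :
    (G.card : ℝ) ≤ (800 * C + 601) * 8 ^ J.card *
      (∏ j ∈ J, (n j : ℝ)) ^ ((6 * J.card : ℝ) / (8 * J.card + 1)) := by
  classical
  set f : (∀ j : Fin d, Fin (n j)) → ℤ := fun x => k₀ + ∑ j, k j * ((x j : ℕ) : ℤ) with hf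
  set G' := G.filter fun x => f x ≠ 0 with hG'
  have hG'G : G' ⊆ G := Finset.filter_subset _ _
  have hcard : G.card ≤ G'.card + 1 := by
    rw [← Finset.card_filter_add_card_filter_not (s := G) (fun x => f x ≠ 0)]
    gcongr
    refine Finset.card_le_one.2 fun x hx y hy => ?_
    simp only [Finset.mem_filter, not_not] at hx hy
    exact hinj hx.1 hy.1 (hx.2.trans hy.2.symm)
  set g : (∀ j : Fin d, Fin (n j)) → J → ℤ := fun x j => ((x j : ℕ) : ℤ) with hg
  set k₀' : ℤ := k₀ + ∑ j : {j // j ∉ J}, k j * ((t j : ℕ) : ℤ) with hk₀'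
  have hfg : ∀ x ∈ G, affineForm k₀' (fun j : J => k j) (g x) = f x := by
    intro x hx
    have h1 : ∑ j : J, k j * ((x j : ℕ) : ℤ) + ∑ j : {j // j ∉ J}, k j * ((x j : ℕ) : ℤ) =
        ∑ j, k j * ((x j : ℕ) : ℤ) := by
      rw [← Fintype.sum_subtype_add_sum_subtype (fun j => j ∈ J)]
      congr!
    simp only [affineForm, hk₀', hf, hg, ← h1, ← ht x hx]
    ring
  have hginj : Set.InjOn g G' := fun x hx y hy hxy =>
    hinj (hG'G hx) (hG'G hy) (by
      rw [← hfg x (hG'G hx), ← hfg y (hG'G hy), hxy])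
  have hJne : Nonempty J := hJ.to_subtype
  have hprod : ∏ j : J, (n j : ℝ) = ∏ j ∈ J, (n j : ℝ) :=
    Finset.prod_coe_sort J fun j => (n j : ℝ)
  have hJc : Fintype.card J = J.card := Fintype.card_coe J
  have hmain := card_le_rpow_of_long_sides hC hU k₀' (fun j : J => k j) (fun j : J => n j)
    (fun j => hn j) (G'.image g)
    (by
      intro y hy j
      obtain ⟨x, -, rfl⟩ := Finset.mem_image.1 hy
      have := (x j).isLt
      simp only [hg]
      omega)
    (by
      intro y hy z hz hyz
      obtain ⟨x, hx, rfl⟩ := Finset.mem_image.1 (Finset.mem_coe.1 hy)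
      obtain ⟨x', hx', rfl⟩ := Finset.mem_image.1 (Finset.mem_coe.1 hz)
      rw [hfg x (hG'G hx), hfg x' (hG'G hx')] at hyz
      rw [hinj (hG'G hx) (hG'G hx') hyz])
    (by
      intro y hy
      obtain ⟨x, hx, rfl⟩ := Finset.mem_image.1 hy
      rw [hfg x (hG'G hx)]
      exact ⟨(Finset.mem_filter.1 hx).2, hsq x (hG'G hx)⟩)
    (by
      rw [hprod, hJc]
      exact fun j => hV j j.2)
  rw [Finset.card_image_of_injOn hginj, hprod, hJc] at hmain
  have hN1 : 1 ≤ ∏ j ∈ J, (n j : ℝ) := by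
    have : 1 ≤ ∏ j ∈ J, n j := Finset.one_le_prod' fun j _ => hn j
    exact_mod_cast this
  have h1 : 1 ≤ (8 : ℝ) ^ J.card *
      (∏ j ∈ J, (n j : ℝ)) ^ ((6 * J.card : ℝ) / (8 * J.card + 1)) :=
    one_le_mul_of_one_le_of_one_le (one_le_pow₀ (by norm_num))
      (Real.one_le_rpow hN1 (by positivity))
  have h2 : (G.card : ℝ) ≤ G'.card + 1 := by exact_mod_cast hcard
  linarith

lemma mul_rpow_eq_rpow_three_quarters {N R : ℝ} (hN : 0 < N) (hR : 0 < R) (m : ℕ) :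
    R * N ^ ((6 * m : ℝ) / (8 * m + 1)) =
      (N * R) ^ ((3 : ℝ) / 4) *
        (R ^ (2 * m + 1) / (N * R) ^ ((3 : ℝ) / 4)) ^ ((1 : ℝ) / (8 * m + 1)) := by
  obtain ⟨a, rfl⟩ : ∃ a, N = Real.exp a := ⟨_, (Real.exp_log hN).symm⟩
  obtain ⟨b, rfl⟩ : ∃ b, R = Real.exp b := ⟨_, (Real.exp_log hR).symm⟩
  rw [← Real.exp_add, ← Real.exp_nat_mul]
  simp only [← Real.exp_mul, ← Real.exp_add, ← Real.exp_sub]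
  congr 1
  push_cast
  field_simp
  ring

/-- conditional bound on the intersection of a set of squares with a proper
generalized arithmetic progression, in terms of the product `R` of the short side lengths. -/
theorem squares_cap_GAP_general (C : ℕ) (hC : 1 ≤ C) (hU : U2 C) :
    ∃ K : ℝ, 1 ≤ K ∧
      ∀ (A : Finset ℤ), (∀ a ∈ A, ∃ m : ℤ, a = m ^ 2) →
      ∀ (d : ℕ) (k₀ : ℤ) (k : Fin d → ℤ) (n : Fin d → ℕ), (∀ j, 1 ≤ n j) →
      ∀ (H : Finset ℤ),
        H = (Finset.univ : Finset (∀ j : Fin d, Fin (n j))).image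
              (fun x => k₀ + ∑ j, k j * ((x j : ℕ) : ℤ)) →
        H.card = ∏ j, n j →
      ∀ (m : ℕ), 1 ≤ m → m ≤ d →
      ∀ (J : Finset (Fin d)), J.card = m →
        (∀ j ∈ J, (H.card : ℝ) ^ ((3 : ℝ) / (4 * m + 2)) ≤ (n j : ℝ)) →
      ∀ (R : ℕ), R = ∏ j ∈ Jᶜ, n j →
        ((A ∩ H).card : ℝ) ≤
          K * 8 ^ d * (H.card : ℝ) ^ ((3 : ℝ) / 4) *
            (((R : ℝ) ^ (2 * m + 1) / (H.card : ℝ) ^ ((3 : ℝ) / 4)) ^ ((1 : ℝ) / (8 * m + 1))) := by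
  classical
  have hC' : (1 : ℝ) ≤ C := by exact_mod_cast hC
  refine ⟨800 * C + 601, by linarith, ?_⟩
  intro A hA d k₀ k n hn H hH hproper m hm1 hmd J hJ hV R hR
  set f : (∀ j : Fin d, Fin (n j)) → ℤ := fun x => k₀ + ∑ j, k j * ((x j : ℕ) : ℤ) with hf
  have hinj : Function.Injective f := by
    rw [← Set.injOn_univ, ← Finset.coe_univ, ← Finset.card_image_iff, ← hH, hproper]
    simp
  set F := Finset.univ.filter fun x => f x ∈ A with hF
  have hAF : (A ∩ H).card ≤ F.card := by
    refine le_trans (Finset.card_le_card ?_) (Finset.card_image_le (f := f) (s := F))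
    intro a ha
    obtain ⟨haA, haH⟩ := Finset.mem_inter.1 ha
    rw [hH] at haH
    obtain ⟨x, -, rfl⟩ := Finset.mem_image.1 haH
    exact Finset.mem_image.2 ⟨x, Finset.mem_filter.2 ⟨Finset.mem_univ x, haA⟩, rfl⟩
  set N : ℝ := ∏ j ∈ J, (n j : ℝ) with hN
  have hN1 : 1 ≤ N := by
    have : 1 ≤ ∏ j ∈ J, n j := Finset.one_le_prod' fun j _ => hn j
    rw [hN]
    exact_mod_cast this
  have hR1 : (1 : ℝ) ≤ R := by
    have : 1 ≤ R := hR ▸ Finset.one_le_prod' fun j _ => hn j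
    exact_mod_cast this
  have hHNR : (H.card : ℝ) = N * R := by
    rw [hproper, hN, hR]
    push_cast
    exact (Finset.prod_mul_prod_compl J _).symm
  have hNH : N ≤ H.card := by
    rw [hHNR]
    exact le_mul_of_one_le_right (by linarith) hR1
  have hVJ : ∀ j ∈ J, N ^ ((3 : ℝ) / (8 * J.card + 1)) ≤ n j := by
    intro j hj
    refine le_trans ?_ (hV j hj)
    rw [hJ]
    calc N ^ ((3 : ℝ) / (8 * m + 1)) ≤ (H.card : ℝ) ^ ((3 : ℝ) / (8 * m + 1)) := by gcongr
      _ ≤ _ := Real.rpow_le_rpow_of_exponent_le (hN1.trans hNH) (by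
          have : (1 : ℝ) ≤ m := by exact_mod_cast hm1
          rw [div_le_div_iff₀ (by positivity) (by positivity)]
          linarith)
  set B : ℝ := (800 * C + 601) * 8 ^ m * N ^ ((6 * m : ℝ) / (8 * m + 1)) with hB
  have hslice : ∀ t : ∀ j : {j // j ∉ J}, Fin (n j),
      ((F.filter fun x => (fun j : {j // j ∉ J} => x j) = t).card : ℝ) ≤ B := by
    intro t
    have h1 := card_slice_le hC hU k₀ k n hn J (Finset.card_pos.1 (by omega))
      (F.filter fun x => (fun j : {j // j ∉ J} => x j) = t) hinj.injOn
      (by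
        intro x hx
        obtain ⟨a, ha⟩ := hA _ (Finset.mem_filter.1 (Finset.mem_filter.1 hx).1).2
        exact ⟨a, by rw [← sq]; exact ha⟩)
      t (fun x hx => (Finset.mem_filter.1 hx).2) hVJ
    rwa [hJ] at h1
  have hcardR : (Fintype.card (∀ j : {j // j ∉ J}, Fin (n j))) = R := by
    simp only [Fintype.card_pi, Fintype.card_fin]
    exact hR ▸ (Finset.prod_subtype Jᶜ (fun x => Finset.mem_compl) n).symm
  have hFB : (F.card : ℝ) ≤ R * B := by
    have h1 := Finset.card_eq_sum_card_fiberwise (s := F)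
      (f := fun x => (fun j : {j // j ∉ J} => x j)) (t := Finset.univ)
      (fun x _ => Finset.mem_coe.2 (Finset.mem_univ _))
    rw [h1]
    push_cast
    calc _ ≤ ∑ t : ∀ j : {j // j ∉ J}, Fin (n j), B := Finset.sum_le_sum fun t _ => hslice t
      _ = R * B := by rw [Finset.sum_const, Finset.card_univ, hcardR, nsmul_eq_mul]
  have h8 : (8 : ℝ) ^ m ≤ 8 ^ d := by gcongr; norm_num
  calc ((A ∩ H).card : ℝ) ≤ F.card := by exact_mod_cast hAF
    _ ≤ R * B := hFB
    _ = (800 * C + 601) * 8 ^ m * (R * N ^ ((6 * m : ℝ) / (8 * m + 1))) := by rw [hB]; ring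
    _ ≤ (800 * C + 601) * 8 ^ d * (R * N ^ ((6 * m : ℝ) / (8 * m + 1))) := by gcongr
    _ = _ := by
      rw [mul_rpow_eq_rpow_three_quarters (by linarith) (by linarith) m, hHNR]
      ring
end

section
/- Assume Hypothesis (U2). Then there exists a constant K ≥ 1 (depending only on the constant C from (U2)) such that for every set of squares A and every finite arithmetic progression P = {p + r·j : 0 ≤ j < N} of integers, one has |A ∩ P| ≤ K · |P|^{2/3}. -/
open Finset

/-- The indices `j < N` for which the term `p + r * j` is a perfect square. -/
def squareIndices (p r : ℤ) (N : ℕ) : Finset ℕ :=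
  (Finset.range N).filter fun j => IsSquare (p + r * (j : ℤ))

theorem mem_squareIndices {p r : ℤ} {N j : ℕ} :
    j ∈ squareIndices p r N ↔ j < N ∧ IsSquare (p + r * (j : ℤ)) := by
  simp [squareIndices]

/-- All but `3 * q` elements of a finite set of naturals share their residue modulo `q` with three
further elements. -/
theorem card_le_card_filter_crowded (J : Finset ℕ) {q : ℕ} (hq : 0 < q) :
    J.card ≤ (J.filter fun j => 4 ≤ (J.filter fun i => i % q = j % q).card).card + 3 * q := by
  rw [← Finset.card_filter_add_card_filter_not
    (fun j => 4 ≤ (J.filter fun i => i % q = j % q).card)]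
  gcongr
  refine (Finset.card_le_mul_card_image_of_maps_to (f := fun j => j % q) (t := Finset.range q)
    (fun j _ => Finset.mem_range.2 (Nat.mod_lt _ hq)) 3 fun b _ => ?_).trans (by simp)
  rcases Finset.eq_empty_or_nonempty ((J.filter fun j =>
    ¬ 4 ≤ (J.filter fun i => i % q = j % q).card).filter fun j => j % q = b) with h | ⟨j, hj⟩
  · rw [h]
    simp
  · simp only [Finset.mem_filter, not_le] at hj
    refine (Finset.card_le_card fun i hi => ?_).trans (Nat.lt_succ_iff.1 hj.1.2)
    simp only [Finset.mem_filter] at hi ⊢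
    exact ⟨hi.1.1, hi.2.trans hj.2.symm⟩

/-- An element sharing its residue with three others has three distinct nonzero quotient
differences to elements of the set. -/
theorem exists_quotient_differences {J : Finset ℕ} {q j : ℕ} (hj : j ∈ J)
    (h : 4 ≤ (J.filter fun i => i % q = j % q).card) :
    ∃ a b c : ℤ, (a ≠ 0 ∧ b ≠ 0 ∧ c ≠ 0 ∧ a ≠ b ∧ a ≠ c ∧ b ≠ c) ∧
      ∀ e ∈ ({a, b, c} : Finset ℤ), ∃ i ∈ J, (i : ℤ) = j + q * e := by
  have h' : 2 < ((J.filter fun i => i % q = j % q).erase j).card := by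
    rw [Finset.card_erase_of_mem (by simp [hj])]
    omega
  obtain ⟨x, y, z, hx, hy, hz, hxy, hxz, hyz⟩ := Finset.two_lt_card_iff.1 h'
  have key : ∀ i ∈ (J.filter fun i => i % q = j % q).erase j,
      i ∈ J ∧ ∃ e : ℤ, e ≠ 0 ∧ (i : ℤ) = j + q * e := by
    intro i hi
    simp only [Finset.mem_erase, Finset.mem_filter] at hi
    refine ⟨hi.2.1, ?_⟩
    obtain ⟨e, he⟩ := (Nat.modEq_iff_dvd.1 (show j ≡ i [MOD q] from hi.2.2.symm))
    refine ⟨e, ?_, by linarith⟩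
    rintro rfl
    exact hi.1 (by exact_mod_cast (by linarith : (i : ℤ) = j))
  obtain ⟨hxJ, a, ha, hxa⟩ := key x hx
  obtain ⟨hyJ, b, hb, hyb⟩ := key y hy
  obtain ⟨hzJ, c, hc, hzc⟩ := key z hz
  refine ⟨a, b, c, ⟨ha, hb, hc, ?_, ?_, ?_⟩, ?_⟩
  · rintro rfl; exact hxy (by exact_mod_cast hxa.trans hyb.symm)
  · rintro rfl; exact hxz (by exact_mod_cast hxa.trans hzc.symm)
  · rintro rfl; exact hyz (by exact_mod_cast hyb.trans hzc.symm)
  · intro e he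
    simp only [Finset.mem_insert, Finset.mem_singleton] at he
    rcases he with rfl | rfl | rfl
    exacts [⟨x, hxJ, hxa⟩, ⟨y, hyJ, hyb⟩, ⟨z, hzJ, hzc⟩]

/-- Counting pairs `(k, j)`, where `f j / k` is in lowest terms and the residue class of `j`
modulo `k ^ 2` contains at least four elements of `J`, through rational points on curves. -/
theorem card_pairs_le {C : ℕ} (hU : U2 C) {p r : ℤ} (hr : r ≠ 0) {N : ℕ} {J : Finset ℕ}
    (hJN : ∀ j ∈ J, j < N) {f : ℕ → ℕ} (hf : ∀ j ∈ J, (f j : ℤ) ^ 2 = p + r * j)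
    {T : ℕ} (hT : 0 < T) (G : Finset (ℕ × ℕ))
    (hG : ∀ g ∈ G, T < g.1 ∧ g.2 ∈ J ∧ (f g.2).Coprime g.1 ∧
      4 ≤ (J.filter fun i => i % g.1 ^ 2 = g.2 % g.1 ^ 2).card) :
    G.card ≤ C * (2 * (N / T ^ 2) + 1) ^ 3 := by
  have key : ∀ g ∈ G, ∃ e : ℤ × ℤ × ℤ,
      e ∈ (Finset.Icc (-((N / T ^ 2 : ℕ) : ℤ)) (N / T ^ 2 : ℕ) ×ˢ
        Finset.Icc (-((N / T ^ 2 : ℕ) : ℤ)) (N / T ^ 2 : ℕ) ×ˢ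
        Finset.Icc (-((N / T ^ 2 : ℕ) : ℤ)) (N / T ^ 2 : ℕ)) ∧
      (e.1 ≠ 0 ∧ e.2.1 ≠ 0 ∧ e.2.2 ≠ 0 ∧ e.1 ≠ e.2.1 ∧ e.1 ≠ e.2.2 ∧ e.2.1 ≠ e.2.2) ∧
      ∃ y : ℚ, y ^ 2 = (((f g.2 : ℚ) / g.1) ^ 2 + ((r * e.1 : ℤ) : ℚ)) *
        (((f g.2 : ℚ) / g.1) ^ 2 + ((r * e.2.1 : ℤ) : ℚ)) *
        (((f g.2 : ℚ) / g.1) ^ 2 + ((r * e.2.2 : ℤ) : ℚ)) := by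
    rintro ⟨k, j⟩ hg
    obtain ⟨hTk, hj, -, h4⟩ := hG _ hg
    dsimp only at hTk hj h4 ⊢
    have hk : 0 < k := hT.trans hTk
    obtain ⟨a, b, c, hne, habc⟩ := exists_quotient_differences hj h4
    have hbound : ∀ e ∈ ({a, b, c} : Finset ℤ),
        e ∈ Finset.Icc (-((N / T ^ 2 : ℕ) : ℤ)) (N / T ^ 2 : ℕ) := by
      intro e he
      obtain ⟨i, hi, hie⟩ := habc e he
      have hiN := hJN i hi
      have hjN := hJN j hj
      have h1 : |(k ^ 2 : ℕ) * e| ≤ N := by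
        rw [abs_le]; constructor <;> linarith
      have h2 : e.natAbs ≤ N / T ^ 2 := by
        rw [Nat.le_div_iff_mul_le (by positivity)]
        zify
        calc |e| * (T : ℤ) ^ 2 ≤ |e| * (k : ℤ) ^ 2 := by gcongr
          _ = |(k ^ 2 : ℕ) * e| := by
            rw [abs_mul, abs_of_nonneg (by positivity : (0 : ℤ) ≤ (k ^ 2 : ℕ))]
            push_cast; ring
          _ ≤ N := h1
      rw [Finset.mem_Icc]
      omega
    have hsq : ∀ e ∈ ({a, b, c} : Finset ℤ),
        ∃ y : ℚ, y ^ 2 = ((f j : ℚ) / k) ^ 2 + ((r * e : ℤ) : ℚ) := by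
      intro e he
      obtain ⟨i, hi, hie⟩ := habc e he
      have hkQ : (k : ℚ) ≠ 0 := by positivity
      have h1 : ((f i : ℤ) : ℚ) ^ 2 = p + r * (i : ℤ) := by exact_mod_cast hf i hi
      have h2 : ((f j : ℤ) : ℚ) ^ 2 = p + r * (j : ℤ) := by exact_mod_cast hf j hj
      have h3 : ((i : ℤ) : ℚ) = (j : ℤ) + (k : ℚ) ^ 2 * e := by rw [hie]; push_cast; ring
      refine ⟨(f i : ℚ) / k, ?_⟩
      push_cast at h1 h2 h3 ⊢
      rw [div_pow, div_pow, h1, h2, h3]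
      field_simp
      ring
    obtain ⟨u, hu⟩ := hsq a (by simp)
    obtain ⟨v, hv⟩ := hsq b (by simp)
    obtain ⟨w, hw⟩ := hsq c (by simp)
    refine ⟨(a, b, c), ?_, hne, u * v * w, ?_⟩
    · simp only [Finset.mem_product]
      exact ⟨hbound a (by simp), hbound b (by simp), hbound c (by simp)⟩
    · rw [mul_pow, mul_pow, hu, hv, hw]
  choose! e he hne y hy using key
  refine (Finset.card_le_mul_card_image_of_maps_to (f := e) he C fun t _ => ?_).trans
    (Nat.mul_le_mul_left _ ?_)
  · rcases (G.filter fun g => e g = t).eq_empty_or_nonempty with h | ⟨g₀, hg₀⟩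
    · simp [h]
    rw [Finset.mem_filter] at hg₀
    obtain ⟨h1, h2, h3, h12, h13, h23⟩ := hne g₀ hg₀.1
    rw [hg₀.2] at h1 h2 h3 h12 h13 h23
    have hinj : ∀ {a b : ℤ}, a ≠ b → r * a ≠ r * b := fun h h' => h (mul_left_cancel₀ hr h')
    obtain ⟨hfin, hcard⟩ := hU (r * t.1) (r * t.2.1) (r * t.2.2) (mul_ne_zero hr h1)
      (mul_ne_zero hr h2) (mul_ne_zero hr h3) (hinj h12) (hinj h13) (hinj h23)
    refine le_trans ?_ hcard
    rw [← Set.ncard_coe_finset]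
    refine Set.ncard_le_ncard_of_injOn (fun g => ((f g.2 : ℚ) / g.1, y g)) ?_ ?_ hfin
    · intro g hg
      rw [Finset.mem_coe, Finset.mem_filter] at hg
      have := hy g hg.1
      rw [hg.2] at this
      exact this
    · intro g hg g' hg' heq
      simp only [Finset.coe_filter, Set.mem_ofPred_eq] at hg hg'
      obtain ⟨hk, hj, hc, -⟩ := hG g hg.1
      obtain ⟨hk', hj', hc', -⟩ := hG g' hg'.1
      have hx : ((f g.2 : ℤ) : ℚ) / (g.1 : ℤ) = ((f g'.2 : ℤ) : ℚ) / (g'.1 : ℤ) := by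
        simpa only [Int.cast_natCast] using (Prod.ext_iff.1 heq).1
      obtain ⟨hm, hkk⟩ := Rat.div_int_inj (by omega) (by omega) (by simpa using hc)
        (by simpa using hc') hx
      have hjj : r * (g.2 : ℤ) = r * (g'.2 : ℤ) := by
        have h1 := hf _ hj
        have h2 := hf _ hj'
        rw [hm] at h1
        linarith
      exact Prod.ext (by exact_mod_cast hkk) (by exact_mod_cast mul_left_cancel₀ hr hjj)
  · simp only [Finset.card_product, Int.card_Icc]
    apply le_of_eq
    have : (((N / T ^ 2 : ℕ) : ℤ) + 1 - -((N / T ^ 2 : ℕ) : ℤ)).toNat = 2 * (N / T ^ 2) + 1 := by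
      omega
    rw [this]
    ring

theorem sum_inv_sq_Icc_two_le (K : ℕ) : ∑ d ∈ Finset.Icc 2 K, (1 : ℚ) / d ^ 2 ≤ 3 / 4 := by
  have h : ∀ K : ℕ, ∑ d ∈ Finset.Icc 2 (K + 2), (1 : ℚ) / d ^ 2 ≤ 3 / 4 - 1 / (K + 2) := by
    intro K
    induction K with
    | zero => norm_num
    | succ K ih =>
      rw [show K + 1 + 2 = (K + 2) + 1 by ring, Finset.sum_Icc_succ_top (by omega)]
      have : (1 : ℚ) / ((K + 2 + 1 : ℕ) : ℚ) ^ 2 ≤ 1 / (K + 2) - 1 / ((K + 1 : ℕ) + 2) := by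
        push_cast
        rw [div_sub_div _ _ (by positivity) (by positivity),
          div_le_div_iff₀ (by positivity) (by positivity)]
        nlinarith [(Nat.cast_nonneg K : (0 : ℚ) ≤ K)]
      linarith
  rcases le_or_gt 2 K with hK | hK
  · obtain ⟨K, rfl⟩ := Nat.exists_eq_add_of_le' hK
    exact (h K).trans (sub_le_self _ (by positivity))
  · rw [Finset.Icc_eq_empty (by omega : ¬ 2 ≤ K), Finset.sum_empty]
    norm_num

/-- If multiples of `d` are not too frequent among the values of `f`, then an eighth of all pairs
`(k, j)` have `f j` coprime to `k`. -/
theorem card_mul_card_le_sum_card_coprime {J : Finset ℕ} {f : ℕ → ℕ} {K : ℕ}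
    (hd : ∀ d, 2 ≤ d → d ≤ K → 6 * d * (J.filter fun j => d ∣ f j).card ≤ 7 * J.card) :
    K * J.card ≤ 8 * ∑ k ∈ Finset.Icc 1 K, (J.filter fun j => (f j).Coprime k).card := by
  have h1 : ∀ k ∈ Finset.Icc 1 K, J.card ≤ (J.filter fun j => (f j).Coprime k).card +
      ∑ d ∈ Finset.Icc 2 K, if d ∣ k then (J.filter fun j => d ∣ f j).card else 0 := by
    intro k hk
    rw [Finset.mem_Icc] at hk
    rw [← Finset.card_filter_add_card_filter_not (fun j => (f j).Coprime k)]
    gcongr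
    rw [← Finset.sum_filter]
    refine (Finset.card_le_card fun j hj => ?_).trans Finset.card_biUnion_le
    rw [Finset.mem_filter] at hj
    simp only [Finset.mem_biUnion, Finset.mem_filter, Finset.mem_Icc]
    have hpos := Nat.gcd_pos_of_pos_right (f j) hk.1
    have hle := Nat.le_of_dvd hk.1 (Nat.gcd_dvd_right (f j) k)
    have hne : (f j).gcd k ≠ 1 := hj.2
    exact ⟨(f j).gcd k, ⟨⟨by omega, by omega⟩, Nat.gcd_dvd_right _ _⟩, hj.1,
      Nat.gcd_dvd_left _ _⟩
  have h2 := Finset.sum_le_sum h1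
  rw [Finset.sum_add_distrib, Finset.sum_comm] at h2
  simp only [Finset.sum_const, Nat.card_Icc, smul_eq_mul, Nat.add_sub_cancel] at h2
  have h3 : ∀ d ∈ Finset.Icc 2 K,
      ((∑ k ∈ Finset.Icc 1 K, if d ∣ k then (J.filter fun j => d ∣ f j).card else 0 : ℕ) : ℚ) ≤
        7 / 6 * K * J.card * (1 / d ^ 2) := by
    intro d hd'
    rw [Finset.mem_Icc] at hd'
    rw [← Finset.sum_filter, Finset.sum_const, smul_eq_mul,
      show Finset.Icc 1 K = Finset.Ioc 0 K from rfl, Nat.Ioc_filter_dvd_card_eq_div]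
    have hd0 : (0 : ℚ) < d := by exact_mod_cast (by omega : 0 < d)
    have h4 : ((K / d : ℕ) : ℚ) ≤ K / d := Nat.cast_div_le
    have h5 : (6 * d * ((J.filter fun j => d ∣ f j).card : ℚ)) ≤ 7 * J.card := by
      exact_mod_cast hd d hd'.1 hd'.2
    have h6 : ((J.filter fun j => d ∣ f j).card : ℚ) ≤ 7 * J.card / (6 * d) := by
      rw [le_div_iff₀ (by positivity)]; linarith
    push_cast
    calc _ ≤ (K / d : ℚ) * (7 * J.card / (6 * d)) := by gcongr
      _ = _ := by field_simp
  have h4 := Finset.sum_le_sum h3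
  rw [← Finset.mul_sum] at h4
  have h5 := mul_le_mul_of_nonneg_left (sum_inv_sq_Icc_two_le K)
    (by positivity : (0 : ℚ) ≤ 7 / 6 * K * J.card)
  rw [← Nat.cast_sum] at h4
  have h6 : ((K * J.card : ℕ) : ℚ) ≤ _ := Nat.cast_le.2 h2
  rw [Nat.cast_add] at h6
  push_cast at h4 h5 h6
  have h7 : (K : ℚ) * J.card ≤
      8 * ∑ k ∈ Finset.Icc 1 K, ((J.filter fun j => (f j).Coprime k).card : ℚ) := by
    linarith
  exact_mod_cast h7

theorem pow_seven_mul_card_le {C : ℕ} (hU : U2 C) {p r : ℤ} (hr : r ≠ 0) {N : ℕ} {J : Finset ℕ}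
    (hJN : ∀ j ∈ J, j < N) {f : ℕ → ℕ} (hf : ∀ j ∈ J, (f j : ℤ) ^ 2 = p + r * j)
    {T : ℕ} (hT : 0 < T) (hTJ : 24576 * T ^ 2 ≤ J.card) (hJ : J.card ≤ N)
    (hd : ∀ d, 2 ≤ d → d ≤ 16 * T → 6 * d * (J.filter fun j => d ∣ f j).card ≤ 7 * J.card) :
    T ^ 7 * J.card ≤ 54 * C * N ^ 3 := by
  let S : ℕ → Finset ℕ := fun k => J.filter fun j => (f j).Coprime k
  let R : ℕ → Finset ℕ := fun k => (J.filter fun j => (f j).Coprime k ∧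
    4 ≤ (J.filter fun i => i % k ^ 2 = j % k ^ 2).card)
  have hSR : ∀ k ∈ Finset.Ioc T (16 * T), (S k).card ≤ (R k).card + 768 * T ^ 2 := by
    intro k hk
    rw [Finset.mem_Ioc] at hk
    have hk2 : k ^ 2 ≤ 256 * T ^ 2 := by nlinarith
    refine (card_le_card_filter_crowded (S k) (pow_pos (hT.trans hk.1) 2)).trans ?_
    refine add_le_add (Finset.card_le_card fun j hj => ?_) (by omega)
    simp only [S, R, Finset.mem_filter] at hj ⊢
    refine ⟨hj.1.1, hj.1.2, hj.2.trans (Finset.card_le_card fun i hi => ?_)⟩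
    simp only [Finset.mem_filter] at hi ⊢
    exact ⟨hi.1.1, hi.2⟩
  have h1 := card_mul_card_le_sum_card_coprime hd
  have hsplit : ∑ k ∈ Finset.Icc 1 (16 * T), (S k).card =
      ∑ k ∈ Finset.Ioc 0 T, (S k).card + ∑ k ∈ Finset.Ioc T (16 * T), (S k).card :=
    (Finset.sum_Ioc_consecutive _ (Nat.zero_le T) (by omega : T ≤ 16 * T)).symm
  have h2 : ∑ k ∈ Finset.Ioc 0 T, (S k).card ≤ T * J.card := by
    refine (Finset.sum_le_card_nsmul _ _ J.card fun k _ => Finset.card_filter_le _ _).trans ?_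
    simp
  have h3 : ∑ k ∈ Finset.Ioc T (16 * T), (S k).card ≤
      ∑ k ∈ Finset.Ioc T (16 * T), (R k).card + 15 * T * (768 * T ^ 2) := by
    refine (Finset.sum_le_sum hSR).trans ?_
    rw [Finset.sum_add_distrib]
    simp only [Finset.sum_const, Nat.card_Ioc, smul_eq_mul]
    gcongr
    omega
  have h4 : ∑ k ∈ Finset.Ioc T (16 * T), (R k).card ≤ C * (2 * (N / T ^ 2) + 1) ^ 3 := by
    let G : Finset (ℕ × ℕ) := ((Finset.Ioc T (16 * T)).sigma R).map
      (Equiv.sigmaEquivProd ℕ ℕ).toEmbedding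
    have hGc : G.card = ∑ k ∈ Finset.Ioc T (16 * T), (R k).card := by
      simp [G]
    rw [← hGc]
    refine card_pairs_le hU hr hJN hf hT G fun g hg => ?_
    simp only [G, R, Finset.mem_map, Finset.mem_sigma, Finset.mem_Ioc, Finset.mem_filter] at hg
    obtain ⟨⟨k, j⟩, ⟨hk, hj⟩, rfl⟩ := hg
    exact ⟨hk.1, hj.1, hj.2.1, hj.2.2⟩
  have hmain : 16 * T * J.card ≤ 8 * (T * J.card + (C * (2 * (N / T ^ 2) + 1) ^ 3 +
      15 * T * (768 * T ^ 2))) := by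
    refine h1.trans (Nat.mul_le_mul_left _ ?_)
    change ∑ k ∈ Finset.Icc 1 (16 * T), (S k).card ≤ _
    omega
  have h5 : T * (24576 * T ^ 2) ≤ T * J.card := Nat.mul_le_mul_left _ hTJ
  have h6 : T * J.card ≤ 2 * (C * (2 * (N / T ^ 2) + 1) ^ 3) := by nlinarith
  have h7 : (2 * (N / T ^ 2) + 1) * T ^ 2 ≤ 3 * N := by
    have := Nat.div_mul_le_self N (T ^ 2)
    nlinarith [pow_pos hT 2]
  calc T ^ 7 * J.card = (T ^ 2) ^ 3 * (T * J.card) := by ring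
    _ ≤ (T ^ 2) ^ 3 * (2 * (C * (2 * (N / T ^ 2) + 1) ^ 3)) := by gcongr
    _ = 2 * C * ((2 * (N / T ^ 2) + 1) * T ^ 2) ^ 3 := by ring
    _ ≤ 2 * C * (3 * N) ^ 3 := by gcongr
    _ = 54 * C * N ^ 3 := by ring

/-- The constant in the cubed bound for the number of squares in a progression. -/
def squareBound (C : ℕ) : ℕ := 98304 ^ 7 * 2916 * C ^ 2

/-- Square terms divisible by `d ^ 2` lie in a progression with the same step and roughly
`N / d ^ 2` terms. -/
theorem exists_card_filter_dvd_le {p r : ℤ} (hpr : IsCoprime p r) {N d : ℕ} (hd : 0 < d)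
    {f : ℕ → ℕ} (hf : ∀ j ∈ squareIndices p r N, (f j : ℤ) ^ 2 = p + r * j) :
    ∃ p' : ℤ, IsCoprime p' r ∧ ((squareIndices p r N).filter fun j => d ∣ f j).card ≤
      (squareIndices p' r (N / d ^ 2 + 1)).card := by
  rcases ((squareIndices p r N).filter fun j => d ∣ f j).eq_empty_or_nonempty with h | ⟨i, hi⟩
  · exact ⟨1, isCoprime_one_left, by simp [h]⟩
  have hdvd : ∀ j ∈ (squareIndices p r N).filter fun j => d ∣ f j,
      (d : ℤ) ^ 2 ∣ p + r * j := by
    intro j hj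
    rw [Finset.mem_filter] at hj
    rw [← hf j hj.1]
    exact pow_dvd_pow_of_dvd (by exact_mod_cast hj.2) 2
  have hdr : IsCoprime ((d : ℤ) ^ 2) r :=
    IsCoprime.of_isCoprime_of_dvd_left (IsCoprime.add_mul_left_left hpr i) (hdvd i hi)
  have hmod : ∀ j ∈ (squareIndices p r N).filter fun j => d ∣ f j,
      j % d ^ 2 = i % d ^ 2 := by
    intro j hj
    have h1 : (d : ℤ) ^ 2 ∣ r * ((i : ℤ) - j) := by
      rw [show r * ((i : ℤ) - j) = (p + r * i) - (p + r * j) by ring]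
      exact dvd_sub (hdvd i hi) (hdvd j hj)
    have h2 := hdr.dvd_of_dvd_mul_left h1
    exact Nat.modEq_iff_dvd.2 (by exact_mod_cast h2)
  have hdecomp : ∀ j ∈ (squareIndices p r N).filter fun j => d ∣ f j,
      (j : ℤ) = (i % d ^ 2 : ℕ) + d ^ 2 * (j / d ^ 2 : ℕ) := by
    intro j hj
    rw [← hmod j hj]
    exact_mod_cast (Nat.mod_add_div j (d ^ 2)).symm
  obtain ⟨p', hp'⟩ : (d : ℤ) ^ 2 ∣ p + r * (i % d ^ 2 : ℕ) := by
    have h1 := hdvd i hi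
    rw [hdecomp i hi] at h1
    have h2 : (d : ℤ) ^ 2 ∣ r * (d ^ 2 * (i / d ^ 2 : ℕ)) := ⟨r * (i / d ^ 2 : ℕ), by ring⟩
    rw [mul_add, ← add_assoc] at h1
    exact (dvd_add_left h2).1 h1
  refine ⟨p', IsCoprime.of_isCoprime_of_dvd_left
    (IsCoprime.add_mul_left_left hpr ((i % d ^ 2 : ℕ) : ℤ)) ⟨d ^ 2, by rw [hp']; ring⟩, ?_⟩
  refine Finset.card_le_card_of_injOn (fun j => j / d ^ 2) ?_ ?_
  · intro j hj
    rw [Finset.mem_coe] at hj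
    have hj' := Finset.mem_filter.1 hj
    rw [Finset.mem_coe, mem_squareIndices]
    refine ⟨Nat.lt_succ_of_le (Nat.div_le_div_right (mem_squareIndices.1 hj'.1).1.le), ?_⟩
    obtain ⟨u, hu⟩ := hj'.2
    refine ⟨u, ?_⟩
    have h1 := hf j hj'.1
    have hd0 : (d : ℤ) ^ 2 ≠ 0 := by positivity
    refine mul_left_cancel₀ hd0 ?_
    rw [hdecomp j hj, hu] at h1
    push_cast at h1 hp' ⊢
    linarith
  · intro j hj j' hj' h
    dsimp only at h
    have h1 := hdecomp j hj
    rw [h, ← hdecomp j' hj'] at h1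
    exact_mod_cast h1

theorem card_squareIndices_pow_three_le_of_isCoprime {C : ℕ} (hC : 1 ≤ C) (hU : U2 C) (N : ℕ) :
    ∀ p r : ℤ, r ≠ 0 → IsCoprime p r →
      (squareIndices p r N).card ^ 3 ≤ squareBound C * N ^ 2 := by
  induction N using Nat.strong_induction_on with
  | _ N ih =>
  intro p r hr hpr
  by_contra! hlt
  set J := squareIndices p r N with hJ
  have hJN : J.card ≤ N := by
    simpa [hJ, squareIndices] using Finset.card_filter_le (Finset.range N) _
  have hC2 : 1 ≤ C ^ 2 := Nat.one_le_pow _ _ hC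
  have hN : 1 ≤ N := by
    by_contra! h
    obtain rfl : N = 0 := by omega
    have : J.card = 0 := by omega
    simp [this] at hlt
  have hN2 : 1 ≤ N ^ 2 := Nat.one_le_pow _ _ hN
  have hbig : 24576 ≤ J.card := by
    by_contra! h
    have h1 : J.card ^ 3 ≤ 24576 ^ 3 := Nat.pow_le_pow_left h.le 3
    have h2 : squareBound C * 1 ≤ squareBound C * N ^ 2 := Nat.mul_le_mul_left _ hN2
    have h3 : 24576 ^ 3 ≤ squareBound C := by unfold squareBound; omega
    omega
  have hfex : ∀ j ∈ J, ∃ m : ℕ, (m : ℤ) ^ 2 = p + r * j := by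
    intro j hj
    obtain ⟨m, hm⟩ := (mem_squareIndices.1 hj).2
    exact ⟨m.natAbs, by rw [hm, Int.natCast_natAbs, sq_abs, sq]⟩
  choose! f hf using hfex
  set T := Nat.sqrt (J.card / 24576) with hTdef
  have hT : 0 < T := Nat.sqrt_pos.2 (Nat.div_pos hbig (by norm_num))
  have hTle : 24576 * T ^ 2 ≤ J.card := by
    have := Nat.sqrt_le' (J.card / 24576)
    rw [← hTdef] at this
    omega
  have hTge : J.card ≤ 98304 * T ^ 2 := by
    have := Nat.lt_succ_sqrt' (J.card / 24576)
    rw [← hTdef, Nat.succ_eq_add_one] at this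
    have h2 : (T + 1) ^ 2 ≤ 4 * T ^ 2 := by nlinarith
    omega
  have hd : ∀ d, 2 ≤ d → d ≤ 16 * T →
      6 * d * (J.filter fun j => d ∣ f j).card ≤ 7 * J.card := by
    intro d hd2 hdT
    obtain ⟨p', hp', hle⟩ := exists_card_filter_dvd_le hpr (by omega : 0 < d) hf
    rw [← hJ] at hle
    set c := (J.filter fun j => d ∣ f j).card with hc
    set M := N / d ^ 2 + 1 with hM
    have hd4 : 4 ≤ d ^ 2 := by nlinarith
    have hdN : 4 * d ^ 2 ≤ N := by nlinarith
    have hMle : 4 * (d ^ 2 * M) ≤ 5 * N := by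
      have := Nat.div_mul_le_self N (d ^ 2)
      rw [hM]
      nlinarith
    have hMN : M < N := by nlinarith
    have hcM : c ^ 3 ≤ squareBound C * M ^ 2 :=
      (Nat.pow_le_pow_left hle 3).trans (ih M hMN p' r hr hp')
    refine le_of_pow_le_pow_left₀ (n := 3) (by norm_num) (Nat.zero_le _) ?_
    have hc4 : 16 * (d ^ 4 * c ^ 3) ≤ 25 * J.card ^ 3 := by
      calc 16 * (d ^ 4 * c ^ 3) ≤ 16 * (d ^ 4 * (squareBound C * M ^ 2)) := by gcongr
        _ = squareBound C * (4 * (d ^ 2 * M)) ^ 2 := by ring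
        _ ≤ squareBound C * (5 * N) ^ 2 := by gcongr
        _ = 25 * (squareBound C * N ^ 2) := by ring
        _ ≤ 25 * J.card ^ 3 := by gcongr
    have hd34 : d ^ 3 * c ^ 3 ≤ d ^ 4 * c ^ 3 :=
      Nat.mul_le_mul_right _ (Nat.pow_le_pow_right (by omega) (by norm_num))
    rw [mul_pow, mul_pow, mul_pow]
    nlinarith
  have hmain := pow_seven_mul_card_le hU hr (fun j hj => (mem_squareIndices.1 hj).1) hf hT hTle
    hJN hd
  have h9 : J.card ^ 9 ≤ squareBound C * N ^ 6 := by
    calc J.card ^ 9 = J.card ^ 7 * J.card ^ 2 := by ring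
      _ ≤ (98304 * T ^ 2) ^ 7 * J.card ^ 2 := by gcongr
      _ = 98304 ^ 7 * (T ^ 7 * J.card) ^ 2 := by ring
      _ ≤ 98304 ^ 7 * (54 * C * N ^ 3) ^ 2 := by gcongr
      _ = squareBound C * N ^ 6 := by unfold squareBound; ring
  have h10 : (squareBound C * N ^ 2) ^ 3 < (J.card ^ 3) ^ 3 :=
    Nat.pow_lt_pow_left hlt (by norm_num)
  have h11 : squareBound C ≤ squareBound C ^ 3 := Nat.le_self_pow (by norm_num) _
  have h12 : squareBound C * N ^ 6 ≤ squareBound C ^ 3 * N ^ 6 := Nat.mul_le_mul_right _ h11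
  have h13 : (squareBound C * N ^ 2) ^ 3 = squareBound C ^ 3 * N ^ 6 := by ring
  have h14 : (J.card ^ 3) ^ 3 = J.card ^ 9 := by ring
  omega

theorem sq_dvd_of_isSquare {l : ℤ} (hl : Prime l) {a : ℤ} (ha : IsSquare a) (h : l ∣ a) :
    l ^ 2 ∣ a := by
  obtain ⟨m, rfl⟩ := ha
  have : l ∣ m := (hl.dvd_mul.1 h).elim id id
  rw [sq]
  exact mul_dvd_mul this this

theorem isSquare_of_sq_mul {l a : ℤ} (hl : Prime l) (h : IsSquare (l ^ 2 * a)) : IsSquare a := by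
  obtain ⟨m, hm⟩ := h
  obtain ⟨u, rfl⟩ : l ∣ m :=
    (hl.dvd_mul.1 (hm ▸ ((dvd_pow_self l two_ne_zero).mul_right a))).elim id id
  exact ⟨u, mul_left_cancel₀ (pow_ne_zero 2 hl.ne_zero) (by rw [hm]; ring)⟩

/-- A common prime factor of the first term and the step can be removed, shrinking the step. -/
theorem exists_smaller_step {p r l : ℤ} (hr : r ≠ 0) (hl : Prime l) (hlp : l ∣ p) (hlr : l ∣ r)
    (N : ℕ) : ∃ p' r' : ℤ, r' ≠ 0 ∧ r'.natAbs < r.natAbs ∧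
      (squareIndices p r N).card ≤ (squareIndices p' r' N).card := by
  have hl2 : 2 ≤ l.natAbs := (Int.prime_iff_natAbs_prime.1 hl).two_le
  have hsq : ∀ j ∈ squareIndices p r N, l ^ 2 ∣ p + r * j := fun j hj =>
    sq_dvd_of_isSquare hl (mem_squareIndices.1 hj).2 (dvd_add hlp (hlr.mul_right _))
  rcases (squareIndices p r N).eq_empty_or_nonempty with h | ⟨i, hi⟩
  · obtain ⟨s, rfl⟩ := hlr
    refine ⟨0, s, right_ne_zero_of_mul hr, ?_, by simp [h]⟩
    rw [Int.natAbs_mul]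
    have : 0 < s.natAbs := Int.natAbs_pos.2 (right_ne_zero_of_mul hr)
    nlinarith
  by_cases hr2 : l ^ 2 ∣ r
  · obtain ⟨q, rfl⟩ : l ^ 2 ∣ p := (dvd_add_left (hr2.mul_right _)).1 (hsq i hi)
    obtain ⟨s, rfl⟩ := hr2
    refine ⟨q, s, right_ne_zero_of_mul hr, ?_, Finset.card_le_card fun j hj => ?_⟩
    · rw [Int.natAbs_mul, Int.natAbs_pow]
      exact lt_mul_of_one_lt_left (Int.natAbs_pos.2 (right_ne_zero_of_mul hr))
        (Nat.one_lt_pow two_ne_zero hl2)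
    · rw [mem_squareIndices] at hj ⊢
      refine ⟨hj.1, isSquare_of_sq_mul hl ?_⟩
      rw [mul_add, ← mul_assoc]
      exact hj.2
  · obtain ⟨s, rfl⟩ := hlr
    have hs : ¬ l ∣ s := fun h => hr2 (by rw [sq]; exact mul_dvd_mul_left l h)
    have hs0 := right_ne_zero_of_mul hr
    set n := l.natAbs with hn
    have hmod : ∀ j ∈ squareIndices p (l * s) N, j % n = i % n := by
      intro j hj
      have h1 : l * l ∣ l * (s * ((i : ℤ) - j)) := by
        rw [← sq, show l * (s * ((i : ℤ) - j)) = (p + l * s * i) - (p + l * s * j) by ring]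
        exact dvd_sub (hsq i hi) (hsq j hj)
      have h2 := (hl.dvd_mul.1 (Int.dvd_of_mul_dvd_mul_left hl.ne_zero h1)).resolve_left hs
      exact Nat.modEq_iff_dvd.2 (Int.natAbs_dvd.2 h2)
    obtain ⟨ε, hε⟩ : ∃ ε : ℤ, (n : ℤ) = l * ε := Int.dvd_natAbs_self
    have hε0 : ε.natAbs = 1 := by
      have := congrArg Int.natAbs hε
      rw [Int.natAbs_mul, Int.natAbs_natCast, ← hn] at this
      exact Nat.eq_of_mul_eq_mul_left (by omega : 0 < n) (this.symm.trans (mul_one n).symm)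
    have hdecomp : ∀ j ∈ squareIndices p (l * s) N,
        (j : ℤ) = (i % n : ℕ) + l * ε * (j / n : ℕ) := by
      intro j hj
      rw [← hmod j hj, ← hε]
      exact_mod_cast (Nat.mod_add_div j n).symm
    obtain ⟨q, hq⟩ : l ^ 2 ∣ p + l * s * (i % n : ℕ) := by
      have h1 := hsq i hi
      rw [hdecomp i hi] at h1
      have h2 : l ^ 2 ∣ l * s * (l * ε * (i / n : ℕ)) := ⟨s * ε * (i / n : ℕ), by ring⟩
      rw [mul_add, ← add_assoc] at h1
      exact (dvd_add_left h2).1 h1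
    refine ⟨q, s * ε, mul_ne_zero hs0 (by rintro rfl; simp at hε0), ?_,
      Finset.card_le_card_of_injOn (fun j => j / n) ?_ ?_⟩
    · rw [Int.natAbs_mul, Int.natAbs_mul, hε0, ← hn]
      have : 0 < s.natAbs := Int.natAbs_pos.2 hs0
      nlinarith
    · intro j hj
      rw [Finset.mem_coe] at hj
      have hj' := mem_squareIndices.1 hj
      rw [Finset.mem_coe, mem_squareIndices]
      refine ⟨(Nat.div_le_self _ _).trans_lt hj'.1, isSquare_of_sq_mul hl ?_⟩
      have h1 := hj'.2
      rw [hdecomp j hj] at h1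
      convert h1 using 1
      linear_combination -hq
    · intro j hj j' hj' h
      dsimp only at h
      have h1 := hdecomp j hj
      rw [h, ← hdecomp j' hj'] at h1
      exact_mod_cast h1

theorem card_squareIndices_pow_three_le {C : ℕ} (hC : 1 ≤ C) (hU : U2 C) (N : ℕ) {p r : ℤ}
    (hr : r ≠ 0) : (squareIndices p r N).card ^ 3 ≤ squareBound C * N ^ 2 := by
  induction h : r.natAbs using Nat.strong_induction_on generalizing p r with
  | _ n ih =>
  by_cases hpr : IsCoprime p r
  · exact card_squareIndices_pow_three_le_of_isCoprime hC hU N p r hr hpr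
  · obtain ⟨l, hl, hlp, hlr⟩ : ∃ l : ℤ, Prime l ∧ l ∣ p ∧ l ∣ r := by
      by_contra! hcon
      exact hpr (isCoprime_of_prime_dvd (fun h0 => hr h0.2) fun z hz hzp => hcon z hz hzp)
    obtain ⟨p', r', hr', hlt, hle⟩ := exists_smaller_step hr hl hlp hlr N
    exact (Nat.pow_le_pow_left hle 3).trans (ih _ (h ▸ hlt) hr' rfl)

/-- conditionally, the intersection of a set of squares with any arithmetic
progression `P` has size `O(|P|^{2/3})`. -/
theorem squares_cap_AP (C : ℕ) (hC : 1 ≤ C) (hU : U2 C) :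
    ∃ K : ℝ, 1 ≤ K ∧
      ∀ (A : Finset ℤ), (∀ a ∈ A, ∃ m : ℤ, a = m ^ 2) →
      ∀ (p r : ℤ) (N : ℕ) (P : Finset ℤ),
        P = (Finset.range N).image (fun j : ℕ => p + r * (j : ℤ)) →
        ((A ∩ P).card : ℝ) ≤ K * (P.card : ℝ) ^ ((2 : ℝ) / 3) := by
  have hB : 1 ≤ squareBound C := by
    have : 1 ≤ C ^ 2 := Nat.one_le_pow _ _ hC
    unfold squareBound
    omega
  have hB' : (1 : ℝ) ≤ squareBound C := by exact_mod_cast hB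
  refine ⟨squareBound C, hB', ?_⟩
  rintro A hA p r N P rfl
  rcases eq_or_ne r 0 with rfl | hr
  · rcases Nat.eq_zero_or_pos N with rfl | hN
    · simp
    · have hP : (Finset.range N).image (fun j : ℕ => p + 0 * (j : ℤ)) = {p} := by
        simp only [zero_mul, add_zero]
        exact Finset.image_const (by simpa using hN.ne') p
      rw [hP]
      have : (A ∩ {p}).card ≤ 1 := by
        simpa using Finset.card_le_card (Finset.inter_subset_right : A ∩ {p} ⊆ {p})
      simp only [Finset.card_singleton, Nat.cast_one, Real.one_rpow, mul_one]
      exact le_trans (by exact_mod_cast this) hB'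
  · have hinj : Function.Injective (fun j : ℕ => p + r * (j : ℤ)) := by
      intro a b h
      exact_mod_cast mul_left_cancel₀ hr (add_left_cancel h)
    rw [Finset.card_image_of_injective _ hinj, Finset.card_range]
    have hle : (A ∩ (Finset.range N).image (fun j : ℕ => p + r * (j : ℤ))).card ≤
        (squareIndices p r N).card := by
      rw [← Finset.card_image_of_injective (squareIndices p r N) hinj]
      refine Finset.card_le_card fun a ha => ?_
      obtain ⟨haA, haP⟩ := Finset.mem_inter.1 ha
      obtain ⟨j, hj, rfl⟩ := Finset.mem_image.1 haP
      obtain ⟨m, hm⟩ := hA _ haA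
      exact Finset.mem_image_of_mem _
        (mem_squareIndices.2 ⟨Finset.mem_range.1 hj, m, hm.trans (sq m)⟩)
    have h3 := (Nat.pow_le_pow_left hle 3).trans (card_squareIndices_pow_three_le hC hU N hr)
    refine le_of_pow_le_pow_left₀ (n := 3) (by norm_num) (by positivity) ?_
    have hN : ((N : ℝ) ^ ((2 : ℝ) / 3)) ^ 3 = (N : ℝ) ^ 2 := by
      rw [← Real.rpow_natCast, ← Real.rpow_mul (Nat.cast_nonneg N), ← Real.rpow_natCast]
      norm_num
    rw [mul_pow, hN]
    calc _ ≤ (squareBound C : ℝ) * (N : ℝ) ^ 2 := by exact_mod_cast h3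
      _ ≤ _ := by
        gcongr
        exact le_self_pow₀ hB' (by norm_num)
end

section
/- Assume Hypothesis (U2) with constant C. Let A be a set of squares and let α, β, γ be pairwise distinct nonzero integers. Then |A ∩ (A + α) ∩ (A + β) ∩ (A + γ)| ≤ C, where A + α = {a + α : a ∈ A}. -/
open Finset

/-- for a set of squares `A` and pairwise distinct nonzero shifts `α, β, γ`,
the intersection `A ∩ (A+α) ∩ (A+β) ∩ (A+γ)` has at most `C` elements. -/
theorem squares_four_shifts (C : ℕ) (hC : 1 ≤ C) (hU : U2 C)
    (A : Finset ℤ) (hA : ∀ a ∈ A, ∃ m : ℤ, a = m ^ 2)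
    (α β γ : ℤ) (hα : α ≠ 0) (hβ : β ≠ 0) (hγ : γ ≠ 0)
    (hαβ : α ≠ β) (hαγ : α ≠ γ) (hβγ : β ≠ γ) :
    (A ∩ A.image (· + α) ∩ A.image (· + β) ∩ A.image (· + γ)).card ≤ C := by
  obtain ⟨hfin, hcard⟩ := hU (-α) (-β) (-γ) (neg_ne_zero.2 hα) (neg_ne_zero.2 hβ)
    (neg_ne_zero.2 hγ) (neg_injective.ne hαβ) (neg_injective.ne hαγ) (neg_injective.ne hβγ)
  set S := A ∩ A.image (· + α) ∩ A.image (· + β) ∩ A.image (· + γ) with hS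
  have key : ∀ a ∈ S, ∃ p : ℚ × ℚ, p.1 ^ 2 = a ∧
      p.2 ^ 2 = (p.1 ^ 2 + ((-α : ℤ) : ℚ)) * (p.1 ^ 2 + ((-β : ℤ) : ℚ)) *
        (p.1 ^ 2 + ((-γ : ℤ) : ℚ)) := by
    intro a ha
    simp only [hS, mem_inter, mem_image] at ha
    obtain ⟨⟨⟨ha, b, hb, hba⟩, c, hc, hca⟩, d, hd, hda⟩ := ha
    obtain ⟨m, hm⟩ := hA a ha
    obtain ⟨s, rfl⟩ := hA b hb
    obtain ⟨t, rfl⟩ := hA c hc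
    obtain ⟨u, rfl⟩ := hA d hd
    refine ⟨((m : ℚ), ((s * t * u : ℤ) : ℚ)),
      by simpa using congrArg (Int.cast (R := ℚ)) hm.symm, ?_⟩
    have h : (s * t * u) ^ 2 = (m ^ 2 + -α) * (m ^ 2 + -β) * (m ^ 2 + -γ) := by
      rw [← hm, ← sub_eq_add_neg, ← sub_eq_add_neg, ← sub_eq_add_neg,
        ← eq_sub_of_add_eq hba, ← eq_sub_of_add_eq hca, ← eq_sub_of_add_eq hda]
      ring
    dsimp only
    exact_mod_cast h
  choose! f hf_sq hf_curve using key
  rw [← Set.ncard_coe_finset S]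
  refine (Set.ncard_le_ncard_of_injOn f hf_curve (fun a ha b hb hab => ?_) hfin).trans hcard
  have h : (a : ℚ) = b := by rw [← hf_sq a ha, ← hf_sq b hb, hab]
  exact_mod_cast h
end

section
/- Assume Hypothesis (U2) with constant C. Then every set of squares A satisfies E₄(A) ≤ (C + 6)·|A|⁴, where E₄(A) = Σ_x r_{A−A}(x)⁴. -/
open Finset Pointwise

/-- The number of translates of a 4-tuple of distinct integers that consist of squares is bounded
by the constant of (U2). -/
lemma card_square_translates_le {C : ℕ} (hU : U2 C) {b : Fin 4 → ℤ} (hb : Function.Injective b)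
    (X : Finset ℤ) (hX : ∀ x ∈ X, ∀ i, ∃ m : ℤ, b i + x = m ^ 2) : X.card ≤ C := by
  have hne : ∀ i j : Fin 4, i ≠ j → b i ≠ b j := fun i j h => hb.ne h
  obtain ⟨hfin, hcard⟩ := hU (b 1 - b 0) (b 2 - b 0) (b 3 - b 0)
    (sub_ne_zero.2 (hne _ _ (by decide))) (sub_ne_zero.2 (hne _ _ (by decide)))
    (sub_ne_zero.2 (hne _ _ (by decide)))
    (fun h => hne 1 2 (by decide) (sub_left_injective h))
    (fun h => hne 1 3 (by decide) (sub_left_injective h))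
    (fun h => hne 2 3 (by decide) (sub_left_injective h))
  refine le_trans ?_ hcard
  choose! m hm using hX
  rw [← Set.ncard_coe_finset X]
  refine Set.ncard_le_ncard_of_injOn
    (fun x => ((m x 0 : ℚ), ((m x 1 * m x 2 * m x 3 : ℤ) : ℚ))) ?_ ?_ hfin
  · intro x hx
    have h (i : Fin 4) : (m x 0) ^ 2 + (b i - b 0) = (m x i) ^ 2 := by
      rw [← hm x hx i, ← hm x hx 0]; ring
    simp only [Set.mem_ofPred_eq]
    norm_cast
    rw [h, h, h]; ring
  · intro x hx y hy hxy
    have h : m x 0 = m y 0 := Int.cast_injective (Prod.ext_iff.1 hxy).1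
    have h0 := hm x hx 0
    have h1 := hm y hy 0
    rw [h] at h0
    linarith

lemma card_piFinset_filter_apply_eq_le {α : Type*} [DecidableEq α] (A : Finset α) {n : ℕ}
    {i j : Fin (n + 1)} (hij : i ≠ j) :
    ((Fintype.piFinset fun _ : Fin (n + 1) => A).filter fun b => b i = b j).card ≤
      A.card ^ n := by
  have : A.card ^ n = (Fintype.piFinset fun _ : Fin n => A).card := by simp
  rw [this]
  refine Finset.card_le_card_of_injOn (fun b k => b (j.succAbove k)) ?_ ?_
  · intro b hb
    simp only [coe_filter, Fintype.mem_piFinset, Set.mem_ofPred_eq] at hb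
    simpa using fun k => hb.1 _
  · intro b hb c hc hbc
    simp only [coe_filter, Fintype.mem_piFinset, Set.mem_ofPred_eq] at hb hc
    have key : ∀ k, k ≠ j → b k = c k := by
      intro k hk
      obtain ⟨l, rfl⟩ := Fin.exists_succAbove_eq hk
      exact congrFun hbc l
    funext k
    by_cases hk : k = j
    · subst hk
      rw [← hb.2, ← hc.2, key i hij]
    · exact key k hk

lemma card_piFinset_filter_not_injective_le {α : Type*} [DecidableEq α] (A : Finset α) :
    ((Fintype.piFinset fun _ : Fin 4 => A).filter fun b => ¬ Function.Injective b).card ≤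
      6 * A.card ^ 3 := by
  let P : Finset (Fin 4 × Fin 4) := univ.filter fun p => p.1 < p.2
  have hP : P.card = 6 := by decide
  rw [← hP]
  refine le_trans (card_le_card ?_) (card_biUnion_le_card_mul P
    (fun p => (Fintype.piFinset fun _ : Fin 4 => A).filter fun b => b p.1 = b p.2) _ ?_)
  · intro b hb
    rw [mem_filter, Function.not_injective_iff] at hb
    obtain ⟨hbA, i, j, hij, hne⟩ := hb
    rw [mem_biUnion]
    rcases lt_or_gt_of_ne hne with h | h
    · exact ⟨(i, j), by simpa [P] using h, mem_filter.2 ⟨hbA, hij⟩⟩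
    · exact ⟨(j, i), by simpa [P] using h, mem_filter.2 ⟨hbA, hij.symm⟩⟩
  · intro p hp
    exact card_piFinset_filter_apply_eq_le A (mem_filter.1 hp).2.ne

/-- A power of the number of representations as a difference counts tuples. -/
lemma card_filter_sub_eq_pow (A : Finset ℤ) (x : ℤ) (n : ℕ) :
    ((A ×ˢ A).filter (fun p => p.1 - p.2 = x)).card ^ n =
      ((Fintype.piFinset fun _ : Fin n => A).filter fun b => ∀ i, b i + x ∈ A).card := by
  have h1 : ((A ×ˢ A).filter (fun p => p.1 - p.2 = x)).card =
      (A.filter fun a => a + x ∈ A).card := by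
    refine card_nbij' Prod.snd (fun a => (a + x, a)) ?_ ?_ ?_ ?_
    · rintro ⟨a, b⟩ h
      simp only [coe_filter, mem_product, Set.mem_ofPred_eq] at h ⊢
      obtain ⟨⟨ha, hb⟩, rfl⟩ := h
      exact ⟨hb, by simpa using ha⟩
    · intro a h
      simp only [coe_filter, mem_product, Set.mem_ofPred_eq] at h ⊢
      exact ⟨⟨h.2, h.1⟩, by ring⟩
    · rintro ⟨a, b⟩ h
      simp only [coe_filter, mem_product, Set.mem_ofPred_eq] at h
      ext <;> simp [← h.2]
    · intro a _
      rfl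
  have h2 : ((Fintype.piFinset fun _ : Fin n => A).filter fun b => ∀ i, b i + x ∈ A) =
      Fintype.piFinset fun _ : Fin n => A.filter fun a => a + x ∈ A := by
    ext b
    simp [forall_and]
  rw [h1, h2]
  simp

/-- `E₄(A) ≤ (C + 6)·|A|⁴` for any set of squares `A`,
where `E₄(A) = Σ_x r_{A−A}(x)⁴`. -/
theorem squares_E4 (C : ℕ) (hC : 1 ≤ C) (hU : U2 C)
    (A : Finset ℤ) (hA : ∀ a ∈ A, ∃ m : ℤ, a = m ^ 2) :
    ∑ x ∈ A - A, ((A ×ˢ A).filter (fun p => p.1 - p.2 = x)).card ^ 4 ≤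
      (C + 6) * A.card ^ 4 := by
  simp only [card_filter_sub_eq_pow]
  obtain ⟨T, hT⟩ : ∃ T, T = Fintype.piFinset fun _ : Fin 4 => A := ⟨_, rfl⟩
  have hTcard : T.card = A.card ^ 4 := by simp [hT]
  rw [← hT]
  let N : (Fin 4 → ℤ) → ℕ := fun b => ((A - A).filter fun x => ∀ i, b i + x ∈ A).card
  have hswap : ∑ x ∈ A - A, (T.filter fun b => ∀ i, b i + x ∈ A).card = ∑ b ∈ T, N b := by
    simp only [N, card_filter]
    exact sum_comm
  have hinj : ∀ b, Function.Injective b → N b ≤ C := fun b hb =>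
    card_square_translates_le hU hb _ fun x hx i => hA _ ((mem_filter.1 hx).2 i)
  have htriv : ∀ b, N b ≤ A.card := fun b =>
    card_le_card_of_injOn (fun x => b 0 + x) (fun x hx => (mem_filter.1 hx).2 0)
      (add_right_injective (b 0)).injOn
  rw [hswap, ← sum_filter_add_sum_filter_not T Function.Injective]
  calc _ ≤ (T.filter Function.Injective).card * C +
        (T.filter fun b => ¬ Function.Injective b).card * A.card := by
        refine Nat.add_le_add ?_ ?_
        · exact sum_le_card_nsmul _ _ _ fun b hb => hinj b (mem_filter.1 hb).2
        · exact sum_le_card_nsmul _ _ _ fun b _ => htriv b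
    _ ≤ A.card ^ 4 * C + 6 * A.card ^ 3 * A.card := by
        refine Nat.add_le_add (Nat.mul_le_mul_right _ ?_) (Nat.mul_le_mul_right _ ?_)
        · exact hTcard ▸ card_filter_le _ _
        · rw [hT]
          exact card_piFinset_filter_not_injective_le A
    _ = (C + 6) * A.card ^ 4 := by ring
end

section
/- Assume Hypothesis (U2). Then there exists a constant K ≥ 1 (depending only on the constant C from (U2)) such that for every set of squares A and every finite set S ⊆ ℤ, the common energy satisfies E(A, S) ≤ K·(|A|^{2/3}·|S|² + |A|·|S|). -/
open Finset

/-- Under `U2 C`, at most `C` integers `x` are such that `x - s` is a square for each of the four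
elements `s` of a given set. -/
lemma U2.card_le_s5 {C : ℕ} (hU : U2 C) {P X : Finset ℤ} (hP : P.card = 4)
    (hX : ∀ x ∈ X, ∀ s ∈ P, ∃ m : ℤ, x - s = m ^ 2) : X.card ≤ C := by
  obtain ⟨a, b, c, d, hab, hac, had, hbc, hbd, hcd, rfl⟩ := Finset.card_eq_four.1 hP
  obtain ⟨hfin, hcard⟩ := hU (a - b) (a - c) (a - d) (sub_ne_zero.2 hab) (sub_ne_zero.2 hac)
    (sub_ne_zero.2 had) (by simpa using hbc) (by simpa using hbd) (by simpa using hcd)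
  have hroots : ∀ x : ℤ, ∃ p : ℚ × ℚ, x ∈ X → p.1 ^ 2 = x - a ∧
      p.2 ^ 2 = (p.1 ^ 2 + ((a - b : ℤ) : ℚ)) * (p.1 ^ 2 + ((a - c : ℤ) : ℚ)) *
        (p.1 ^ 2 + ((a - d : ℤ) : ℚ)) := by
    intro x
    by_cases hx : x ∈ X
    · obtain ⟨m, hm⟩ := hX x hx a (by simp)
      obtain ⟨n, hn⟩ := hX x hx b (by simp)
      obtain ⟨k, hk⟩ := hX x hx c (by simp)
      obtain ⟨l, hl⟩ := hX x hx d (by simp)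
      refine ⟨(m, n * k * l), fun _ => ?_⟩
      have hm' : (m : ℚ) ^ 2 = x - a := by exact_mod_cast hm.symm
      have hn' : (n : ℚ) ^ 2 = x - b := by exact_mod_cast hn.symm
      have hk' : (k : ℚ) ^ 2 = x - c := by exact_mod_cast hk.symm
      have hl' : (l : ℚ) ^ 2 = x - d := by exact_mod_cast hl.symm
      refine ⟨hm', ?_⟩
      simp only [mul_pow, hm', hn', hk', hl']
      push_cast
      ring
    · exact ⟨0, fun h => absurd h hx⟩
  choose f hf using hroots
  refine le_trans ?_ hcard
  rw [← Set.ncard_coe_finset]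
  refine Set.ncard_le_ncard_of_injOn f (fun x hx => (hf x hx).2) ?_ hfin
  intro x hx y hy hxy
  have h₁ := (hf x hx).1
  have h₂ := (hf y hy).1
  rw [hxy] at h₁
  have : (x : ℚ) = y := by linarith
  exact_mod_cast this

/-- The common energy is at most the second moment of the number of representations as a sum. -/
lemma card_common_energy_le_sum_sq (A S : Finset ℤ) :
    (((A ×ˢ A) ×ˢ (S ×ˢ S)).filter (fun q => q.1.1 + q.2.1 = q.1.2 + q.2.2)).card ≤
      ∑ x ∈ (A ×ˢ S).image (fun p => p.1 + p.2), (S.filter (fun s => x - s ∈ A)).card ^ 2 := by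
  rw [Finset.card_eq_sum_card_fiberwise (f := fun q => q.1.1 + q.2.1)
    (t := (A ×ˢ S).image (fun p => p.1 + p.2))]
  · refine Finset.sum_le_sum fun x _ => ?_
    rw [sq, ← Finset.card_product]
    refine Finset.card_le_card_of_injOn Prod.snd ?_ ?_
    · rintro ⟨⟨a, a'⟩, s, s'⟩ h
      simp only [Finset.coe_filter, Finset.mem_filter, Finset.mem_product, Set.mem_ofPred_eq] at h
      obtain ⟨⟨⟨⟨ha, ha'⟩, hs, hs'⟩, h⟩, rfl⟩ := h
      simp only [Finset.coe_product, Finset.coe_filter, Set.mem_prod, Set.mem_ofPred_eq]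
      refine ⟨⟨hs, by simpa using ha⟩, hs', ?_⟩
      rw [h]
      simpa using ha'
    · rintro ⟨⟨a, a'⟩, s, s'⟩ h ⟨⟨b, b'⟩, t, t'⟩ h' heq
      simp only [Finset.coe_filter, Finset.mem_filter, Set.mem_ofPred_eq, Prod.mk.injEq]
        at h h' heq ⊢
      omega
  · rintro ⟨⟨a, a'⟩, s, s'⟩ h
    simp only [Finset.coe_filter, Finset.mem_product, Set.mem_ofPred_eq] at h
    exact Finset.mem_coe.2 (Finset.mem_image.2
      ⟨(a, s), Finset.mem_product.2 ⟨h.1.1.1, h.1.2.1⟩, rfl⟩)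

lemma sum_card_filter_sub_mem_le (A S X : Finset ℤ) :
    ∑ x ∈ X, (S.filter (fun s => x - s ∈ A)).card ≤ A.card * S.card := by
  calc ∑ x ∈ X, (S.filter (fun s => x - s ∈ A)).card
      = ∑ s ∈ S, (X.filter (fun x => x - s ∈ A)).card :=
        Finset.sum_card_bipartiteAbove_eq_sum_card_bipartiteBelow _
    _ ≤ ∑ _s ∈ S, A.card := by
        refine Finset.sum_le_sum fun s _ =>
          Finset.card_le_card_of_injOn (fun x => x - s) (fun x hx => ?_) (by simp)
        exact (Finset.mem_filter.1 hx).2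
    _ = A.card * S.card := by simp [mul_comm]

lemma U2.sum_choose_four_le {C : ℕ} (hU : U2 C) {A : Finset ℤ}
    (hA : ∀ a ∈ A, ∃ m : ℤ, a = m ^ 2) (S X : Finset ℤ) :
    ∑ x ∈ X, (S.filter (fun s => x - s ∈ A)).card.choose 4 ≤ C * S.card ^ 4 := by
  calc ∑ x ∈ X, (S.filter (fun s => x - s ∈ A)).card.choose 4
      = ∑ x ∈ X, ((S.powersetCard 4).filter (fun P => ∀ s ∈ P, x - s ∈ A)).card := by
        refine Finset.sum_congr rfl fun x _ => ?_
        rw [← Finset.card_powersetCard]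
        congr 1
        ext P
        simp only [Finset.mem_powersetCard, Finset.mem_filter, Finset.subset_iff]
        grind
    _ = ∑ P ∈ S.powersetCard 4, (X.filter (fun x => ∀ s ∈ P, x - s ∈ A)).card :=
        Finset.sum_card_bipartiteAbove_eq_sum_card_bipartiteBelow _
    _ ≤ ∑ _P ∈ S.powersetCard 4, C :=
        Finset.sum_le_sum fun P hP => hU.card_le_s5 (Finset.mem_powersetCard.1 hP).2
          fun x hx s hs => hA _ ((Finset.mem_filter.1 hx).2 s hs)
    _ = C * S.card.choose 4 := by simp [mul_comm]
    _ ≤ C * S.card ^ 4 := Nat.mul_le_mul_left _ (Nat.choose_le_pow _ _)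

lemma sq_le_add_choose_four (r : ℕ) {T : ℝ} (hT : 0 < T) :
    (r : ℝ) ^ 2 ≤ 4 * r + T * r + 264 * (r.choose 4 : ℝ) / T ^ 2 := by
  have hr : (0 : ℝ) ≤ r := r.cast_nonneg
  have hch : (0 : ℝ) ≤ 264 * (r.choose 4 : ℝ) / T ^ 2 := by positivity
  rcases le_total (r : ℝ) 4 with h4 | h4
  · nlinarith [mul_nonneg hT.le hr]
  rcases le_total (r : ℝ) T with h | h
  · nlinarith
  have key : (r : ℝ) ^ 4 ≤ 264 * (r.choose 4 : ℝ) := by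
    obtain ⟨k, rfl⟩ := Nat.exists_eq_add_of_le (show 4 ≤ r by exact_mod_cast h4)
    have h₁ : (4 + k).descFactorial 4 = 24 * (4 + k).choose 4 := by
      rw [Nat.descFactorial_eq_factorial_mul_choose]; rfl
    have h₂ : (4 + k).descFactorial 4 = (k + 1) * (k + 2) * (k + 3) * (k + 4) := by
      simp only [Nat.descFactorial_succ, Nat.descFactorial_zero]
      rw [show 4 + k - 3 = k + 1 by omega, show 4 + k - 2 = k + 2 by omega,
        show 4 + k - 1 = k + 3 by omega, show 4 + k - 0 = k + 4 by omega]
      ring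
    have h₃ : (4 + k) ^ 4 ≤ 11 * ((k + 1) * (k + 2) * (k + 3) * (k + 4)) := by
      ring_nf
      nlinarith
    have h₄ : (4 + k) ^ 4 ≤ 264 * (4 + k).choose 4 := by omega
    exact_mod_cast h₄
  have : (r : ℝ) ^ 2 ≤ 264 * (r.choose 4 : ℝ) / T ^ 2 := by
    rw [le_div_iff₀ (by positivity)]
    nlinarith [pow_le_pow_left₀ hT.le h 2, sq_nonneg (r : ℝ)]
  nlinarith [mul_nonneg hT.le hr]

/-- the common energy of a set of squares `A` and an arbitrary finite set `S`
satisfies `E(A, S) ≤ K·(|A|^{2/3}·|S|² + |A|·|S|)`. -/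
theorem squares_common_energy (C : ℕ) (hC : 1 ≤ C) (hU : U2 C) :
    ∃ K : ℝ, 1 ≤ K ∧
      ∀ (A : Finset ℤ), (∀ a ∈ A, ∃ m : ℤ, a = m ^ 2) →
      ∀ (S : Finset ℤ),
        (((((A ×ˢ A) ×ˢ (S ×ˢ S)).filter
            (fun q => q.1.1 + q.2.1 = q.1.2 + q.2.2)).card : ℝ)) ≤
          K * ((A.card : ℝ) ^ ((2 : ℝ) / 3) * (S.card : ℝ) ^ 2 +
                (A.card : ℝ) * (S.card : ℝ)) := by
  refine ⟨5 + 264 * C, by linarith [C.cast_nonneg (α := ℝ)], fun A hA S => ?_⟩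
  rcases A.eq_empty_or_nonempty with rfl | hA₀
  · simp
  rcases S.eq_empty_or_nonempty with rfl | hS₀
  · simp
  have ha : (0 : ℝ) < A.card := by exact_mod_cast hA₀.card_pos
  have hs : (0 : ℝ) < S.card := by exact_mod_cast hS₀.card_pos
  obtain ⟨u, hu₀, hu₃, hu₂⟩ : ∃ u : ℝ, 0 < u ∧ (A.card : ℝ) = u ^ 3 ∧
      (A.card : ℝ) ^ ((2 : ℝ) / 3) = u ^ 2 := by
    refine ⟨(A.card : ℝ) ^ ((1 : ℝ) / 3), Real.rpow_pos_of_pos ha _, ?_, ?_⟩ <;>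
      rw [← Real.rpow_mul_natCast ha.le] <;> norm_num
  set X := (A ×ˢ S).image (fun p => p.1 + p.2)
  have hE : (_ : ℝ) ≤ _ := Nat.cast_le.2 (card_common_energy_le_sum_sq A S)
  have h₁ : (_ : ℝ) ≤ _ := Nat.cast_le.2 (sum_card_filter_sub_mem_le A S X)
  have h₄ : (_ : ℝ) ≤ _ := Nat.cast_le.2 (hU.sum_choose_four_le hA S X)
  push_cast at hE h₁ h₄
  set T : ℝ := S.card / u with hT
  have hT₀ : 0 < T := div_pos hs hu₀
  calc _ ≤ ∑ x ∈ X, ((S.filter (fun s => x - s ∈ A)).card : ℝ) ^ 2 := hE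
    _ ≤ ∑ x ∈ X, (4 * ((S.filter (fun s => x - s ∈ A)).card : ℝ) +
          T * ((S.filter (fun s => x - s ∈ A)).card : ℝ) +
          264 * ((S.filter (fun s => x - s ∈ A)).card.choose 4 : ℝ) / T ^ 2) :=
        Finset.sum_le_sum fun x _ => sq_le_add_choose_four _ hT₀
    _ = (4 + T) * ∑ x ∈ X, ((S.filter (fun s => x - s ∈ A)).card : ℝ) +
          264 * (∑ x ∈ X, ((S.filter (fun s => x - s ∈ A)).card.choose 4 : ℝ)) / T ^ 2 := by
        simp only [Finset.sum_add_distrib, ← Finset.mul_sum, ← Finset.sum_div]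
        ring
    _ ≤ (4 + T) * (A.card * S.card) + 264 * (C * S.card ^ 4) / T ^ 2 := by gcongr
    _ = 4 * (A.card * S.card) + (1 + 264 * C) * (u ^ 2 * S.card ^ 2) := by
        rw [hT, hu₃]
        field_simp
        ring
    _ ≤ (5 + 264 * C) * ((A.card : ℝ) ^ ((2 : ℝ) / 3) * (S.card : ℝ) ^ 2 +
          (A.card : ℝ) * (S.card : ℝ)) := by
        rw [hu₂]
        have h : 0 ≤ u ^ 2 * (S.card : ℝ) ^ 2 := by positivity
        have h' : 0 ≤ (1 + 264 * C) * ((A.card : ℝ) * S.card) := by positivity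
        linarith
end

section
/- Assume Hypothesis (U2). Then there exists a constant c > 0 (depending only on the constant C from (U2)) such that every set of squares A satisfies |A + A| ≥ c·|A|^{4/3} and |A − A| ≥ c·|A|^{4/3}, where A + A = {a₁ + a₂ : a₁, a₂ ∈ A} and A − A = {a₁ − a₂ : a₁, a₂ ∈ A}. -/
open Finset Pointwise

/-- Under `U2 C`, four distinct translates of the set of squares meet in at most `C` points. -/
lemma U2.card_le_of_isSquare_sub {C : ℕ} (hU : U2 C) {s : Finset ℤ} (hs : s.card = 4)
    {T : Finset ℤ} (hT : ∀ d ∈ T, ∀ b ∈ s, IsSquare (d - b)) : T.card ≤ C := by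
  obtain ⟨b₀, b₁, b₂, b₃, _, _, _, _, _, _, rfl⟩ := Finset.card_eq_four.1 hs
  simp only [Finset.mem_insert, Finset.mem_singleton, forall_eq_or_imp, forall_eq] at hT
  obtain ⟨hfin, hcard⟩ := hU (b₀ - b₁) (b₀ - b₂) (b₀ - b₃) (by lia) (by lia) (by lia)
    (by lia) (by lia) (by lia)
  choose! f₀ f₁ f₂ f₃ hf₀ hf₁ hf₂ hf₃ using
    show ∀ d, ∃ x₀ x₁ x₂ x₃ : ℤ, (d ∈ T → d - b₀ = x₀ * x₀) ∧ (d ∈ T → d - b₁ = x₁ * x₁) ∧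
        (d ∈ T → d - b₂ = x₂ * x₂) ∧ (d ∈ T → d - b₃ = x₃ * x₃) by
      intro d
      by_cases hd : d ∈ T
      · obtain ⟨⟨x₀, h₀⟩, ⟨x₁, h₁⟩, ⟨x₂, h₂⟩, ⟨x₃, h₃⟩⟩ := hT d hd
        exact ⟨x₀, x₁, x₂, x₃, fun _ => h₀, fun _ => h₁, fun _ => h₂, fun _ => h₃⟩
      · simp [hd]
  rw [← Set.ncard_coe_finset]
  refine (Set.ncard_le_ncard_of_injOn
    (fun d => ((f₀ d : ℚ), ((f₁ d * f₂ d * f₃ d : ℤ) : ℚ))) ?_ ?_ hfin).trans hcard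
  · intro d hd
    have h₁ : f₀ d ^ 2 + (b₀ - b₁) = f₁ d ^ 2 := by linarith [hf₀ d hd, hf₁ d hd]
    have h₂ : f₀ d ^ 2 + (b₀ - b₂) = f₂ d ^ 2 := by linarith [hf₀ d hd, hf₂ d hd]
    have h₃ : f₀ d ^ 2 + (b₀ - b₃) = f₃ d ^ 2 := by linarith [hf₀ d hd, hf₃ d hd]
    have key : (f₁ d * f₂ d * f₃ d) ^ 2 =
        (f₀ d ^ 2 + (b₀ - b₁)) * (f₀ d ^ 2 + (b₀ - b₂)) * (f₀ d ^ 2 + (b₀ - b₃)) := by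
      rw [h₁, h₂, h₃]; ring
    simp only [Set.mem_ofPred_eq]
    exact_mod_cast key
  · intro d hd e he hde
    have h : f₀ d = f₀ e :=
      Int.cast_injective (congrArg Prod.fst hde : (f₀ d : ℚ) = f₀ e)
    have hd' := hf₀ d hd
    rw [h, ← hf₀ e he] at hd'
    linarith

lemma pow_four_le_choose (r : ℕ) : r ^ 4 ≤ 24 * r.choose 4 + 6 * r ^ 3 := by
  have h : r.descFactorial 4 = 24 * r.choose 4 := Nat.descFactorial_eq_factorial_mul_choose r 4
  rw [← h]
  rcases lt_or_ge r 4 with hr | hr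
  · interval_cases r <;> decide
  · obtain ⟨k, rfl⟩ := Nat.exists_eq_add_of_le' hr
    simp only [Nat.descFactorial_succ, Nat.descFactorial_zero,
      show k + 4 - 3 = k + 1 by lia, show k + 4 - 2 = k + 2 by lia, show k + 4 - 1 = k + 3 by lia,
      Nat.sub_zero]
    nlinarith

/-- A bipartite graph between `D` and `B` with `|B|²` edges, in which any four elements of `B`
have at most `C` common neighbours, satisfies `|B|⁴ ≤ (C + 6)|D|³`. -/
lemma card_pow_four_le_of_common_neighbours {ι κ : Type*} {C : ℕ} (D : Finset ι)
    (B : Finset κ) (r : ι → κ → Prop) [∀ d b, Decidable (r d b)]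
    (hedges : ∑ d ∈ D, (B.filter (r d)).card = B.card ^ 2)
    (hfree : ∀ s ⊆ B, s.card = 4 → (D.filter fun d => ∀ b ∈ s, r d b).card ≤ C) :
    B.card ^ 4 ≤ (C + 6) * D.card ^ 3 := by
  set n := B.card with hn
  have hle : ∀ d, (B.filter (r d)).card ≤ n := fun d => Finset.card_filter_le _ _
  have hchoose : ∑ d ∈ D, (B.filter (r d)).card.choose 4 ≤ C * n.choose 4 := by
    have hswap := Finset.sum_card_bipartiteAbove_eq_sum_card_bipartiteBelow
      (s := D) (t := B.powersetCard 4) (fun d s => ∀ b ∈ s, r d b)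
    have habove : ∀ d, Finset.bipartiteAbove (fun d s => ∀ b ∈ s, r d b) (B.powersetCard 4) d =
        (B.filter (r d)).powersetCard 4 := by
      intro d
      ext s
      simp only [Finset.mem_bipartiteAbove, Finset.mem_powersetCard, Finset.subset_iff,
        Finset.mem_filter]
      grind
    simp only [habove, Finset.card_powersetCard] at hswap
    rw [hswap, mul_comm, ← Finset.card_powersetCard, ← smul_eq_mul]
    refine Finset.sum_le_card_nsmul _ _ _ fun s hs => ?_
    rw [Finset.mem_powersetCard] at hs
    exact hfree s hs.1 hs.2
  have hcube : ∑ d ∈ D, (B.filter (r d)).card ^ 3 ≤ n ^ 4 := by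
    calc ∑ d ∈ D, (B.filter (r d)).card ^ 3
        ≤ ∑ d ∈ D, n ^ 2 * (B.filter (r d)).card := by
          refine Finset.sum_le_sum fun d _ => ?_
          rw [pow_succ]
          gcongr
          exact hle d
      _ = n ^ 4 := by rw [← Finset.mul_sum, hedges]; ring
  have hfourth : ∑ d ∈ D, (B.filter (r d)).card ^ 4 ≤ (C + 6) * n ^ 4 := by
    have hdesc : 24 * n.choose 4 ≤ n ^ 4 :=
      (Nat.descFactorial_eq_factorial_mul_choose n 4).symm.trans_le (Nat.descFactorial_le_pow n 4)
    calc ∑ d ∈ D, (B.filter (r d)).card ^ 4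
        ≤ ∑ d ∈ D, (24 * (B.filter (r d)).card.choose 4 + 6 * (B.filter (r d)).card ^ 3) :=
          Finset.sum_le_sum fun d _ => pow_four_le_choose _
      _ = 24 * ∑ d ∈ D, (B.filter (r d)).card.choose 4 +
            6 * ∑ d ∈ D, (B.filter (r d)).card ^ 3 := by
          rw [Finset.sum_add_distrib, Finset.mul_sum, Finset.mul_sum]
      _ ≤ 24 * (C * n.choose 4) + 6 * n ^ 4 := by gcongr
      _ = C * (24 * n.choose 4) + 6 * n ^ 4 := by ring
      _ ≤ C * n ^ 4 + 6 * n ^ 4 := by gcongr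
      _ = (C + 6) * n ^ 4 := by ring
  have hpower : (n ^ 2) ^ 4 ≤ D.card ^ 3 * ∑ d ∈ D, (B.filter (r d)).card ^ 4 := by
    rw [← hedges]
    exact pow_sum_le_card_mul_sum_pow (fun _ _ => Nat.zero_le _) 3
  rcases Nat.eq_zero_or_pos n with h0 | hpos
  · simp [h0]
  · refine Nat.le_of_mul_le_mul_right (c := n ^ 4) ?_ (by positivity)
    calc n ^ 4 * n ^ 4 = (n ^ 2) ^ 4 := by ring
      _ ≤ D.card ^ 3 * ((C + 6) * n ^ 4) := hpower.trans (by gcongr)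
      _ = (C + 6) * D.card ^ 3 * n ^ 4 := by ring

lemma U2.card_pow_four_le {C : ℕ} (hU : U2 C) {A B : Finset ℤ} (hA : ∀ a ∈ A, IsSquare a)
    (hAB : A.card = B.card) : A.card ^ 4 ≤ (C + 6) * (A + B).card ^ 3 := by
  rw [hAB]
  refine card_pow_four_le_of_common_neighbours (A + B) B (fun d b => d - b ∈ A) ?_ ?_
  · have hswap := Finset.sum_card_bipartiteAbove_eq_sum_card_bipartiteBelow
      (s := A + B) (t := B) (fun d b => d - b ∈ A)
    refine hswap.trans ?_
    rw [sq, ← smul_eq_mul]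
    refine Finset.sum_const_nat fun b hb => ?_
    rw [← hAB, ← Finset.card_image_of_injective A (add_left_injective b)]
    congr 1
    ext d
    simp only [Finset.mem_bipartiteBelow, Finset.mem_image]
    constructor
    · exact fun h => ⟨d - b, h.2, by ring⟩
    · rintro ⟨a, ha, rfl⟩
      exact ⟨Finset.add_mem_add ha hb, by simpa using ha⟩
  · intro s _ hs
    exact hU.card_le_of_isSquare_sub hs fun d hd b hb => hA _ ((Finset.mem_filter.1 hd).2 b hb)

lemma inv_mul_rpow_four_thirds_le {K n m : ℕ} (hK : 1 ≤ K) (h : n ^ 4 ≤ K * m ^ 3) :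
    (K : ℝ)⁻¹ * (n : ℝ) ^ ((4 : ℝ) / 3) ≤ m := by
  have hK' : (1 : ℝ) ≤ K := by exact_mod_cast hK
  have h' : (n : ℝ) ^ 4 ≤ K * (m : ℝ) ^ 3 := by exact_mod_cast h
  have hpow : ((n : ℝ) ^ ((4 : ℝ) / 3)) ^ 3 = (n : ℝ) ^ 4 := by
    rw [← Real.rpow_natCast, ← Real.rpow_mul (by positivity), ← Real.rpow_natCast]
    norm_num
  rw [inv_mul_le_iff₀ (by positivity)]
  refine le_of_pow_le_pow_left₀ (n := 3) (by norm_num) (by positivity) ?_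
  calc ((n : ℝ) ^ ((4 : ℝ) / 3)) ^ 3 ≤ K * (m : ℝ) ^ 3 := hpow.trans_le h'
    _ ≤ (K : ℝ) ^ 3 * (m : ℝ) ^ 3 := by
        gcongr
        exact le_self_pow₀ hK' (by norm_num)
    _ = (K * m : ℝ) ^ 3 := by ring

/-- conditionally, every set of squares `A` satisfies
`|A + A| ≥ c·|A|^{4/3}` and `|A − A| ≥ c·|A|^{4/3}`. -/
theorem squares_sumset_growth (C : ℕ) (hC : 1 ≤ C) (hU : U2 C) :
    ∃ c : ℝ, 0 < c ∧
      ∀ (A : Finset ℤ), (∀ a ∈ A, ∃ m : ℤ, a = m ^ 2) →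
        c * (A.card : ℝ) ^ ((4 : ℝ) / 3) ≤ ((A + A).card : ℝ) ∧
        c * (A.card : ℝ) ^ ((4 : ℝ) / 3) ≤ ((A - A).card : ℝ) := by
  refine ⟨((C + 6 : ℕ) : ℝ)⁻¹, by positivity, fun A hA => ?_⟩
  have hA' : ∀ a ∈ A, IsSquare a := fun a ha => (hA a ha).imp fun m hm => hm.trans (sq m)
  have hneg := hU.card_pow_four_le hA' (Finset.card_neg A).symm
  rw [← sub_eq_add_neg] at hneg
  exact ⟨inv_mul_rpow_four_thirds_le (by lia) (hU.card_pow_four_le hA' rfl),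
    inv_mul_rpow_four_thirds_le (by lia) hneg⟩
end
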